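/- arXiv:1509.08859 — 2 statements merged into one kernel-verified Lean document; each statement's English description precedes it below -/
import Mathlib

section
/- (Rogers–Shephard) Let K be a convex body in EuclideanSpace ℝ (Fin d), d ≥ 2. For a point a ∈ K, the smallest centrally symmetric convex body with center a containing K is convexHull ℝ (K ∪ ((2•a) − K)), where (2•a) − K = {2a − x : x ∈ K} is the reflection of K about a. Then (1 + 2·v_{d−1}/v_d) · vol(K) ≤ sup_{a ∈ K} vol(convexHull ℝ (K ∪ ((2•a) − K))) ≤ 2^d · vol(K), and equality holds on the right if and only if K is a d-simplex (the convex hull of d+1 affinely independent points). -/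
open MeasureTheory

/-- The volume of the closed unit ball of Euclidean `n`-space. -/
noncomputable def unitBallVol (n : ℕ) : ℝ :=
  (volume (Metric.closedBall (0 : EuclideanSpace ℝ (Fin n)) 1)).toReal

/-- The reflection `(2•a) − K = {2a − x : x ∈ K}` of a set `K` about the point `a`. -/
def reflAbout {d : ℕ} (a : EuclideanSpace ℝ (Fin d)) (K : Set (EuclideanSpace ℝ (Fin d))) :
    Set (EuclideanSpace ℝ (Fin d)) :=
  (fun x => (2 : ℝ) • a - x) '' K

section
open scoped Pointwise

/-- homothetic copy -/
def homo {E : Type*} [AddCommGroup E] [Module ℝ E] (v : E) (l : ℝ) (K : Set E) : Set E :=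
  (fun x => v + l • x) '' K

def coneOver {E : Type*} [AddCommGroup E] [Module ℝ E] (K : Set E) : Set (E × ℝ) :=
  {q | 0 ≤ q.2 ∧ ∃ k ∈ K, q.1 = q.2 • k}

/-- the nondegenerate intersections of homothets of `K` are homothets of `K` -/
def HomInt {E : Type*} [NormedAddCommGroup E] [NormedSpace ℝ E] (K : Set E) : Prop :=
  ∀ (v₁ v₂ : E) (l₁ l₂ : ℝ), 0 < l₁ → 0 < l₂ →
    (interior (homo v₁ l₁ K ∩ homo v₂ l₂ K)).Nonempty →
    ∃ w m, 0 ≤ m ∧ homo v₁ l₁ K ∩ homo v₂ l₂ K = homo w m K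

theorem measure_homo {F : Type*} [NormedAddCommGroup F] [NormedSpace ℝ F] [MeasurableSpace F]
    [BorelSpace F] [FiniteDimensional ℝ F] (μ : Measure F) [μ.IsAddHaarMeasure]
    (v : F) (l : ℝ) (hl : 0 ≤ l) (K : Set F) :
    μ (homo v l K) = ENNReal.ofReal (l ^ (Module.finrank ℝ F)) * μ K := by
  have : homo v l K = (fun x => v + x) '' (l • K) := by
    rw [← Set.image_smul, Set.image_image]; rfl
  rw [this, Set.image_add_left, measure_preimage_add, Measure.addHaar_smul,
    abs_of_nonneg (by positivity)]

theorem volume_homo {d : ℕ} (v : EuclideanSpace ℝ (Fin d)) (l : ℝ) (hl : 0 ≤ l)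
    (K : Set (EuclideanSpace ℝ (Fin d))) :
    volume (homo v l K) = ENNReal.ofReal (l ^ d) * volume K := by
  rw [measure_homo volume v l hl]; simp

theorem coneOver_add {E : Type*} [AddCommGroup E] [Module ℝ E] {K : Set E} (hK : Convex ℝ K)
    {p q : E × ℝ} (hp : p ∈ coneOver K) (hq : q ∈ coneOver K) : p + q ∈ coneOver K := by
  obtain ⟨hp0, k, hk, hpk⟩ := hp
  obtain ⟨hq0, k', hk', hqk⟩ := hq
  refine ⟨add_nonneg hp0 hq0, ?_⟩
  rcases (add_nonneg hp0 hq0).eq_or_lt with h | h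
  · have h1 : p.2 = 0 := by linarith
    have h2 : q.2 = 0 := by linarith
    exact ⟨k, hk, by simp [hpk, hqk, h1, h2]⟩
  · refine ⟨(p.2 / (p.2 + q.2)) • k + (q.2 / (p.2 + q.2)) • k',
      hK hk hk' (by positivity) (by positivity) (by field_simp), ?_⟩
    simp only [Prod.fst_add, Prod.snd_add, smul_add, smul_smul, hpk, hqk]
    congr 2 <;> field_simp

/-- order cone implies inclusion -/
theorem homo_subset {E : Type*} [AddCommGroup E] [Module ℝ E] {K : Set E} (hK : Convex ℝ K)
    {p q : E × ℝ} (hp : 0 ≤ p.2) (hpq : q - p ∈ coneOver K) :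
    homo (-p.1) p.2 K ⊆ homo (-q.1) q.2 K := by
  rintro _ ⟨x, hx, rfl⟩
  have h1 : (p.2 • x, p.2) ∈ coneOver K := ⟨hp, x, hx, rfl⟩
  obtain ⟨h0, k, hk, h⟩ := coneOver_add hK hpq h1
  refine ⟨k, hk, ?_⟩
  simp at h
  simp only [← h]
  abel

theorem of_homo_subset {d : ℕ} (hd : d ≠ 0) {K : Set (EuclideanSpace ℝ (Fin d))}
    (hKc : IsCompact K) (hKint : (interior K).Nonempty)
    {p q : EuclideanSpace ℝ (Fin d) × ℝ} (hp : 0 < p.2) (hq : 0 < q.2)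
    (h : homo (-p.1) p.2 K ⊆ homo (-q.1) q.2 K) : q - p ∈ coneOver K := by
  have hpos : 0 < volume K := Measure.measure_pos_of_nonempty_interior _ hKint
  have hfin : volume K ≠ ⊤ := hKc.measure_ne_top
  have hle : p.2 ≤ q.2 := by
    have := measure_mono (μ := volume) h
    rw [volume_homo _ _ hp.le, volume_homo _ _ hq.le, ENNReal.mul_le_mul_iff_left hpos.ne' hfin,
      ENNReal.ofReal_le_ofReal_iff (by positivity)] at this
    exact (pow_le_pow_iff_left₀ hp.le hq.le hd).1 this
  obtain ⟨x, hx'⟩ := hKint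
  have hx : x ∈ K := interior_subset hx'
  have hT : ∀ y ∈ K, q.2⁻¹ • (q.1 - p.1 + p.2 • y) ∈ K := by
    intro y hy
    obtain ⟨z, hz, hz'⟩ := h ⟨y, hy, rfl⟩
    simp only at hz'
    have : q.1 - p.1 + p.2 • y = q.2 • z := by
      have : q.2 • z = q.1 + (-q.1 + q.2 • z) := by abel
      rw [this, hz']; abel
    rw [this, smul_smul, inv_mul_cancel₀ hq.ne', one_smul]; exact hz
  refine ⟨by simpa using hle, ?_⟩
  simp only [Prod.fst_sub, Prod.snd_sub]
  rcases hle.eq_or_lt with he | hlt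
  · refine ⟨x, hx, ?_⟩
    rw [he]; simp only [sub_self, zero_smul]
    set u := q.2⁻¹ • (q.1 - p.1) with hu
    have hn : ∀ n : ℕ, x + (n : ℝ) • u ∈ K := by
      intro n
      induction n with
      | zero => simpa using hx
      | succ n ih =>
        have := hT _ ih
        rw [he, smul_add, smul_smul, inv_mul_cancel₀ hq.ne', one_smul, ← hu] at this
        convert this using 1
        push_cast; module
    obtain ⟨C, hC⟩ := hKc.isBounded.exists_norm_le
    have hu0 : u = 0 := by
      by_contra hne
      obtain ⟨n, hn'⟩ := exists_nat_gt ((C + ‖x‖) / ‖u‖)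
      have h1 := hC _ (hn n)
      have h2 : ‖(n : ℝ) • u‖ ≤ ‖x + (n : ℝ) • u‖ + ‖x‖ := by
        have := norm_sub_le (x + (n : ℝ) • u) x
        simpa using this
      rw [div_lt_iff₀ (norm_pos_iff.2 hne)] at hn'
      rw [norm_smul] at h2
      simp at h2
      linarith
    simpa [hu, hq.ne'] using hu0
  · have hs : 0 < q.2 - p.2 := sub_pos.2 hlt
    set c := (q.2 - p.2)⁻¹ • (q.1 - p.1) with hc
    have hqc : q.1 - p.1 = (q.2 - p.2) • c := by
      rw [hc, smul_smul, mul_inv_cancel₀ hs.ne', one_smul]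
    refine ⟨c, ?_, hqc⟩
    set r := p.2 / q.2 with hr
    have hn : ∀ n : ℕ, c + (r ^ n) • (x - c) ∈ K := by
      intro n
      induction n with
      | zero => simpa using hx
      | succ n ih =>
        have := hT _ ih
        convert this using 1
        rw [hqc]
        have e1 : p.2 = r * q.2 := by rw [hr]; field_simp
        rw [e1, pow_succ]
        have : q.2⁻¹ • ((q.2 - r * q.2) • c + (r * q.2) • (c + r ^ n • (x - c)))
          = (q.2⁻¹ * q.2) • ((1 - r) • c + r • (c + r ^ n • (x - c))) := by module
        rw [this, inv_mul_cancel₀ hq.ne']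
        module
    have hlim : Filter.Tendsto (fun n : ℕ => c + (r ^ n) • (x - c)) Filter.atTop (nhds (c + (0:ℝ) • (x - c))) := by
      refine tendsto_const_nhds.add (Filter.Tendsto.smul_const ?_ _)
      exact tendsto_pow_atTop_nhds_zero_of_lt_one (by positivity) (by rw [hr, div_lt_one hq]; exact hlt)
    have := hKc.isClosed.mem_of_tendsto hlim (Filter.Eventually.of_forall hn)
    simpa using this

theorem interpolation {d : ℕ} (hd : d ≠ 0) {K : Set (EuclideanSpace ℝ (Fin d))}
    (hKc : IsCompact K) (hK : Convex ℝ K) (hKint : (interior K).Nonempty) (hH : HomInt K)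
    {x y z : EuclideanSpace ℝ (Fin d) × ℝ} (hx : x ∈ coneOver K) (hy : y ∈ coneOver K)
    (hxz : x - z ∈ coneOver K) (hyz : y - z ∈ coneOver K) :
    ∃ w, w ∈ coneOver K ∧ w - z ∈ coneOver K ∧ x - w ∈ coneOver K ∧ y - w ∈ coneOver K := by
  set c : ℝ := max 0 (-z.2) + 1 with hc
  have hc1 : 0 < c := by have := le_max_left 0 (-z.2); linarith
  have hc2 : 0 < z.2 + c := by have := le_max_right 0 (-z.2); linarith
  set e : EuclideanSpace ℝ (Fin d) × ℝ := (0, c)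
  have he2 : e.2 = c := rfl
  have hx2 : 0 ≤ x.2 := hx.1
  have hy2 : 0 ≤ y.2 := hy.1
  have s1 : homo (-e.1) e.2 K ⊆ homo (-(x + e).1) (x + e).2 K :=
    homo_subset hK hc1.le (by simpa using hx)
  have s2 : homo (-e.1) e.2 K ⊆ homo (-(y + e).1) (y + e).2 K :=
    homo_subset hK hc1.le (by simpa using hy)
  have s3 : homo (-(z + e).1) (z + e).2 K ⊆ homo (-(x + e).1) (x + e).2 K :=
    homo_subset hK hc2.le (by simpa using hxz)
  have s4 : homo (-(z + e).1) (z + e).2 K ⊆ homo (-(y + e).1) (y + e).2 K :=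
    homo_subset hK hc2.le (by simpa using hyz)
  have hinn : (interior (homo (-e.1) e.2 K)).Nonempty := by
    have : homo (-e.1) e.2 K = c • K := by
      simp [homo, e]
    rw [this, interior_smul₀ hc1.ne']
    exact hKint.smul_set
  obtain ⟨w, m, hm, hw⟩ := hH (-(x + e).1) (-(y + e).1) (x + e).2 (y + e).2
    (by simp [he2]; positivity) (by simp [he2]; positivity)
    (hinn.mono (interior_mono (Set.subset_inter s1 s2)))
  have hm0 : 0 < m := by
    refine hm.lt_of_ne ?_
    rintro rfl
    have h1 := measure_mono (μ := volume) (Set.subset_inter s1 s2)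
    rw [hw, volume_homo _ _ le_rfl] at h1
    have : 0 < volume (homo (-e.1) e.2 K) := Measure.measure_pos_of_nonempty_interior _ hinn
    simp [hd] at h1
    exact this.ne' h1
  set W : EuclideanSpace ℝ (Fin d) × ℝ := (-w, m)
  have hw' : homo (-W.1) W.2 K = homo w m K := by simp [W]
  refine ⟨W - e, ?_, ?_, ?_, ?_⟩
  · exact of_homo_subset hd hKc hKint (p := e) (q := W) hc1 hm0
      (by rw [hw', ← hw]; exact Set.subset_inter s1 s2)
  · have := of_homo_subset hd hKc hKint (p := z + e) (q := W) hc2 hm0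
      (by rw [hw', ← hw]; exact Set.subset_inter s3 s4)
    convert this using 1; abel
  · have := of_homo_subset hd hKc hKint (p := W) (q := x + e) hm0 (by simp [he2]; positivity)
      (by rw [hw', ← hw]; exact Set.inter_subset_left)
    convert this using 1; abel
  · have := of_homo_subset hd hKc hKint (p := W) (q := y + e) hm0 (by simp [he2]; positivity)
      (by rw [hw', ← hw]; exact Set.inter_subset_right)
    convert this using 1; abel

theorem extremal {E : Type*} [NormedAddCommGroup E] [NormedSpace ℝ E] {K : Set E}
    {e : E} (he : e ∈ K.extremePoints ℝ) {a : ℝ} {q : E × ℝ} (hq : q ∈ coneOver K)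
    (h : (a • e, a) - q ∈ coneOver K) : q.1 = q.2 • e := by
  obtain ⟨hq0, k, hk, hqk⟩ := hq
  obtain ⟨h0, k', hk', hk2⟩ := h
  simp only [Prod.fst_sub, Prod.snd_sub] at h0 hk2
  rcases hq0.eq_or_lt with h1 | h1
  · rw [hqk, ← h1]; simp
  have ha : 0 < a := by linarith
  rcases h0.eq_or_lt with h2 | h2
  · rw [← h2, zero_smul, sub_eq_zero] at hk2
    rw [← hk2]; congr 1; linarith
  · have : e ∈ openSegment ℝ k k' := by
      refine ⟨q.2 / a, (a - q.2) / a, by positivity, by positivity, by field_simp; ring, ?_⟩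
      have h3 : a • e = q.2 • k + (a - q.2) • k' := by rw [← hk2, hqk]; abel
      have h4 : e = a⁻¹ • (a • e) := by rw [smul_smul, inv_mul_cancel₀ ha.ne', one_smul]
      rw [h4, h3, div_eq_inv_mul, div_eq_inv_mul]; module
    rw [hqk, he.2 hk hk' this]

theorem indep_step {d : ℕ} (hd : d ≠ 0) {K : Set (EuclideanSpace ℝ (Fin d))}
    (hKc : IsCompact K) (hK : Convex ℝ K) (hKint : (interior K).Nonempty) (hH : HomInt K)
    (e : K.extremePoints ℝ) (a : ℝ) (ha : 0 ≤ a) (b : K.extremePoints ℝ → ℝ)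
    (J : Finset (K.extremePoints ℝ)) (hb : ∀ j ∈ J, 0 ≤ b j) (heJ : e ∉ J)
    (h : ∑ j ∈ J, (b j • (j : EuclideanSpace ℝ (Fin d)), b j) - (a • (e : EuclideanSpace ℝ (Fin d)), a)
      ∈ coneOver K) : a = 0 := by
  classical
  have hmem : ∀ (j : K.extremePoints ℝ) (t : ℝ), 0 ≤ t →
      ((t • (j : EuclideanSpace ℝ (Fin d)), t) : EuclideanSpace ℝ (Fin d) × ℝ) ∈ coneOver K :=
    fun j t ht => ⟨ht, j, j.2.1, rfl⟩
  induction J using Finset.induction_on with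
  | empty =>
    have := h.1
    simp at this
    linarith
  | insert j J hj ih =>
    rw [Finset.sum_insert hj] at h
    have hb' : ∀ j ∈ J, 0 ≤ b j := fun i hi => hb i (Finset.mem_insert_of_mem hi)
    have hne : e ≠ j := fun h => heJ (h ▸ Finset.mem_insert_self _ _)
    have hy2 : ∑ j ∈ J, (b j • (j : EuclideanSpace ℝ (Fin d)), b j) ∈ coneOver K := by
      clear h ih hj heJ hb
      induction J using Finset.induction_on with
      | empty => exact ⟨le_rfl, e, e.2.1, by simp⟩
      | insert i J hi ih =>
        rw [Finset.sum_insert hi]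
        exact coneOver_add hK (hmem _ _ (hb' _ (Finset.mem_insert_self _ _)))
          (ih fun i hi => hb' i (Finset.mem_insert_of_mem hi))
    set y2 := ∑ j ∈ J, (b j • (j : EuclideanSpace ℝ (Fin d)), b j)
    obtain ⟨w, hw0, hwz, hxw, hyw⟩ := interpolation hd hKc hK hKint hH
      (x := (a • (e : EuclideanSpace ℝ (Fin d)), a)) (y := (b j • (j : EuclideanSpace ℝ (Fin d)), b j))
      (z := (a • (e : EuclideanSpace ℝ (Fin d)), a) - y2) (hmem _ _ ha)
      (hmem _ _ (hb _ (Finset.mem_insert_self _ _))) (by simpa using hy2)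
      (by convert h using 1; abel)
    have h1 := extremal e.2 hw0 hxw
    have h2 := extremal j.2 hw0 hyw
    have h3 : w.2 = 0 := by
      by_contra hne0
      apply hne
      rw [h1] at h2
      exact Subtype.ext (smul_right_injective _ hne0 h2)
    have h4 : w = 0 := Prod.ext (by rw [h1, h3, zero_smul]; rfl) h3
    refine ih hb' (fun h => heJ (Finset.mem_insert_of_mem h)) ?_
    rw [h4] at hwz
    convert hwz using 1; abel

theorem extremePoints_affineIndependent {d : ℕ} (hd : d ≠ 0) {K : Set (EuclideanSpace ℝ (Fin d))}
    (hKc : IsCompact K) (hK : Convex ℝ K) (hKint : (interior K).Nonempty) (hH : HomInt K) :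
    AffineIndependent ℝ (fun e : K.extremePoints ℝ => (e : EuclideanSpace ℝ (Fin d))) := by
  classical
  rw [affineIndependent_iff]
  have key : ∀ (s : Finset (K.extremePoints ℝ)) (w : K.extremePoints ℝ → ℝ), s.sum w = 0 →
      ∑ e ∈ s, w e • (e : EuclideanSpace ℝ (Fin d)) = 0 → ∀ e ∈ s, ¬ 0 < w e := by
    intro s w h0 h1 e he hpos
    have h3 : ∑ j ∈ s, (w j • (j : EuclideanSpace ℝ (Fin d)), w j) = 0 :=
      Prod.ext (by rw [Prod.fst_sum]; exact h1) (by rw [Prod.snd_sum]; exact h0)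
    have h4 : ∑ j ∈ s.filter (fun j => w j ≤ 0), ((-w j) • (j : EuclideanSpace ℝ (Fin d)), -w j)
        - (w e • (e : EuclideanSpace ℝ (Fin d)), w e)
        = ∑ j ∈ (s.filter (fun j => ¬ w j ≤ 0)).erase e, (w j • (j : EuclideanSpace ℝ (Fin d)), w j) := by
      rw [← Finset.sum_filter_add_sum_filter_not s (fun j => w j ≤ 0),
        ← Finset.add_sum_erase (s.filter (fun j => ¬ w j ≤ 0)) _
          (Finset.mem_filter.2 ⟨he, not_le.2 hpos⟩)] at h3
      have h5 : ∑ j ∈ s.filter (fun j => w j ≤ 0), ((-w j) • (j : EuclideanSpace ℝ (Fin d)), -w j)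
        = - ∑ j ∈ s.filter (fun j => w j ≤ 0), (w j • (j : EuclideanSpace ℝ (Fin d)), w j) := by
        rw [← Finset.sum_neg_distrib]
        refine Finset.sum_congr rfl fun j _ => ?_
        simp
      rw [h5, sub_eq_iff_eq_add, neg_eq_iff_add_eq_zero, ← h3]
      abel
    refine hpos.ne' (indep_step hd hKc hK hKint hH e (w e) hpos.le (fun j => - w j)
      (s.filter (fun j => w j ≤ 0)) ?_ ?_ ?_)
    · intro j hj; have := (Finset.mem_filter.1 hj).2; linarith
    · intro h; have := (Finset.mem_filter.1 h).2; linarith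
    · rw [h4]
      generalize hJ : (s.filter (fun j => ¬ w j ≤ 0)).erase e = J
      have hb' : ∀ j ∈ J, 0 ≤ w j := by
        intro j hj
        rw [← hJ] at hj
        have := (Finset.mem_filter.1 (Finset.mem_of_mem_erase hj)).2
        linarith
      clear hJ h4
      induction J using Finset.induction_on with
      | empty => exact ⟨le_rfl, e, e.2.1, by simp⟩
      | insert i J hi ih =>
        rw [Finset.sum_insert hi]
        exact coneOver_add hK ⟨hb' _ (Finset.mem_insert_self _ _), i, i.2.1, rfl⟩
          (ih fun i hi => hb' i (Finset.mem_insert_of_mem hi))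
  intro s w h0 h1 e he
  have a1 := key s w h0 h1 e he
  have a2 := key s (-w) (by simp [h0]) (by simp [h1]) e he
  simp at a2
  linarith

theorem simplex_of_homInt {d : ℕ} (hd : d ≠ 0) {K : Set (EuclideanSpace ℝ (Fin d))}
    (hKc : IsCompact K) (hK : Convex ℝ K) (hKint : (interior K).Nonempty) (hH : HomInt K) :
    ∃ f : Fin (d + 1) → EuclideanSpace ℝ (Fin d),
        AffineIndependent ℝ f ∧ K = convexHull ℝ (Set.range f) := by
  have hI := extremePoints_affineIndependent hd hKc hK hKint hH
  have hfin : Finite (K.extremePoints ℝ) := finite_of_fin_dim_affineIndependent ℝ hI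
  have hfin' : (K.extremePoints ℝ).Finite := hfin
  have hKe : K = convexHull ℝ (K.extremePoints ℝ) := by
    conv_lhs => rw [← closure_convexHull_extremePoints hKc hK]
    exact (hfin'.isCompact_convexHull ℝ).isClosed.closure_eq
  have hne : Nonempty (K.extremePoints ℝ) :=
    (hKc.extremePoints_nonempty (hKint.mono interior_subset)).to_subtype
  have htop : affineSpan ℝ (K.extremePoints ℝ) = ⊤ := by
    rw [← interior_convexHull_nonempty_iff_affineSpan_eq_top, ← hKe]; exact hKint
  have := Fintype.ofFinite (K.extremePoints ℝ)
  have hcard : Fintype.card (K.extremePoints ℝ) = d + 1 := by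
    have := (hI.affineSpan_eq_top_iff_card_eq_finrank_add_one).1 (by simpa using htop)
    simpa using this
  let φ := (Fintype.equivFinOfCardEq hcard).symm
  refine ⟨fun i => φ i, hI.comp_embedding φ.toEmbedding, ?_⟩
  conv_lhs => rw [hKe]
  congr 1
  ext x; constructor
  · intro hx; exact ⟨φ.symm ⟨x, hx⟩, by simp⟩
  · rintro ⟨i, rfl⟩; exact (φ i).2

theorem coneOver_smul {E : Type*} [AddCommGroup E] [Module ℝ E] {K : Set E}
    {q : E × ℝ} (hq : q ∈ coneOver K) {c : ℝ} (hc : 0 ≤ c) : c • q ∈ coneOver K := by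
  obtain ⟨h0, k, hk, h⟩ := hq
  exact ⟨mul_nonneg hc h0, k, hk, by simp [h, smul_smul]⟩

/-- the fibre of the Rogers-Shephard body over `y` -/
def fibRS {E : Type*} [AddCommGroup E] [Module ℝ E] (K : Set E) (y : E) : Set (E × ℝ) :=
  {p | p ∈ coneOver K ∧ ((p.1 - y, 1 - p.2) : E × ℝ) ∈ coneOver K}

def bodyRS {E : Type*} [AddCommGroup E] [Module ℝ E] (K : Set E) : Set (E × (E × ℝ)) :=
  {g | g.2 ∈ fibRS K g.1}

def symHull {E : Type*} [AddCommGroup E] [Module ℝ E] (K : Set E) : Set E :=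
  convexHull ℝ (K ∪ -K)

theorem fib_concave {E : Type*} [AddCommGroup E] [Module ℝ E] {K : Set E} (hK : Convex ℝ K)
    {y z : E} {θ : ℝ} (h0 : 0 ≤ θ) (h1 : θ ≤ 1) {p : E × ℝ} (hp : p ∈ fibRS K z) :
    homo ((1 - θ) • p) θ (fibRS K y) ⊆ fibRS K (θ • y + (1 - θ) • z) := by
  rintro _ ⟨q, hq, rfl⟩
  refine ⟨coneOver_add hK (coneOver_smul hp.1 (by linarith)) (coneOver_smul hq.1 h0), ?_⟩
  have := coneOver_add hK (coneOver_smul hp.2 (c := 1 - θ) (by linarith)) (coneOver_smul hq.2 h0)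
  convert this using 1
  ext1
  · simp; module
  · simp; ring

theorem mem_symHull {E : Type*} [AddCommGroup E] [Module ℝ E] {K : Set E} (hK : Convex ℝ K)
    (hne : K.Nonempty) {y : E} : y ∈ symHull K ↔ (fibRS K y).Nonempty := by
  rw [symHull, hK.convexHull_union hK.neg hne hne.neg]
  constructor
  · intro h
    obtain ⟨a, ha, b, hb, s, t, hs, ht, hst, rfl⟩ := mem_convexJoin.1 h
    refine ⟨(s • a, s), ⟨hs, a, ha, rfl⟩, by simp; linarith, -b, hb, ?_⟩
    simp only
    rw [show 1 - s = t by linarith]; module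
  · rintro ⟨⟨x, t⟩, ⟨h0, k, hk, hxk⟩, h1, k', hk', hxk'⟩
    simp only at *
    rw [mem_convexJoin]
    refine ⟨k, hk, -k', by simpa using hk', t, 1 - t, h0, h1, by ring, ?_⟩
    rw [smul_neg, ← hxk', hxk]; abel

theorem isCompact_bodyRS {E : Type*} [NormedAddCommGroup E] [NormedSpace ℝ E] {K : Set E}
    (hK : IsCompact K) : IsCompact (bodyRS K) := by
  have : bodyRS K = (fun g : ℝ × E × E => (g.1 • g.2.1 - (1 - g.1) • g.2.2, (g.1 • g.2.1, g.1))) ''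
      (Set.Icc 0 1 ×ˢ K ×ˢ K) := by
    ext ⟨y, x, t⟩
    constructor
    · rintro ⟨⟨h0, k, hk, hxk⟩, h1, k', hk', hxk'⟩
      simp only at *
      refine ⟨(t, k, k'), ⟨⟨h0, by linarith⟩, hk, hk'⟩, ?_⟩
      simp only [← hxk, ← hxk', Prod.mk.injEq, and_true]; abel
    · rintro ⟨⟨t, k, k'⟩, ⟨⟨h0, h1⟩, hk, hk'⟩, h⟩
      simp only [Prod.mk.injEq] at *
      obtain ⟨rfl, rfl, rfl⟩ := h
      exact ⟨⟨h0, k, hk, rfl⟩, by simpa using h1, k', hk', by simp⟩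
  rw [this]
  exact (isCompact_Icc.prod (hK.prod hK)).image (by fun_prop)

theorem isCompact_fibRS {E : Type*} [NormedAddCommGroup E] [NormedSpace ℝ E] {K : Set E}
    (hK : IsCompact K) (y : E) : IsCompact (fibRS K y) := by
  have : fibRS K y = Prod.snd '' (bodyRS K ∩ Prod.fst ⁻¹' {y}) := by
    ext p; constructor
    · intro h; exact ⟨(y, p), ⟨h, rfl⟩, rfl⟩
    · rintro ⟨⟨y', p⟩, ⟨h, h'⟩, rfl⟩
      simp at h'; subst h'; exact h
  rw [this]
  exact ((isCompact_bodyRS hK).inter_right (isClosed_singleton.preimage continuous_fst)).image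
    continuous_snd

theorem convex_fibRS {E : Type*} [AddCommGroup E] [Module ℝ E] {K : Set E} (hK : Convex ℝ K)
    (y : E) : Convex ℝ (fibRS K y) := by
  intro p hp q hq a b ha hb hab
  have := fib_concave hK (y := y) hb (by linarith) hp ⟨q, hq, rfl⟩
  rw [← add_smul, show b + (1 - b) = 1 by ring, one_smul, show 1 - b = a by linarith] at this
  exact this

theorem fibRS_zero {E : Type*} [AddCommGroup E] [Module ℝ E] {K : Set E} (hK : Convex ℝ K)
    (h0 : (0 : E) ∈ K) (x : E) (t : ℝ) :
    (x, t) ∈ fibRS K (0 : E) ↔ (0 ≤ t ∧ t ≤ 1) ∧ ∃ k ∈ K, x = min t (1 - t) • k := by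
  constructor
  · rintro ⟨⟨h0, k, hk, hxk⟩, h1, k', hk', hxk'⟩
    simp only [sub_zero] at *
    refine ⟨⟨h0, by linarith⟩, ?_⟩
    rcases le_total t (1 - t) with h | h
    · rw [min_eq_left h]; exact ⟨k, hk, hxk⟩
    · rw [min_eq_right h]; exact ⟨k', hk', hxk'⟩
  · rintro ⟨⟨ht, ht1⟩, k, hk, rfl⟩
    have hm : 0 ≤ min t (1 - t) := le_min ht (by linarith)
    have key : ∀ s, min t (1 - t) ≤ s → ∃ k' ∈ K, min t (1 - t) • k = s • k' := by
      intro s hs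
      rcases hm.eq_or_lt with h | h
      · exact ⟨0, h0, by simp [← h]⟩
      · have hs0 : 0 < s := h.trans_le hs
        refine ⟨(min t (1 - t) / s) • k,
          hK.smul_mem_of_zero_mem h0 hk ⟨by positivity, (div_le_one hs0).2 hs⟩, ?_⟩
        rw [smul_smul]; congr 1; field_simp
    exact ⟨⟨ht, key _ (min_le_left _ _)⟩, by simpa using ht1,
      by simpa using key _ (min_le_right _ _)⟩

theorem volume_smul_set {d : ℕ} (l : ℝ) (hl : 0 ≤ l)
    (K : Set (EuclideanSpace ℝ (Fin d))) :
    volume {x | ∃ k ∈ K, x = l • k} = ENNReal.ofReal (l ^ d) * volume K := by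
  rw [← volume_homo 0 l hl]
  congr 1
  ext x; simp [homo, Set.mem_smul_set, eq_comm]

noncomputable def betaRS (d : ℕ) : ENNReal :=
  ∫⁻ t in Set.Ioc (0:ℝ) 1, ENNReal.ofReal (t ^ d * (1 - t) ^ d)

theorem volume_fib_zero {d : ℕ} {K : Set (EuclideanSpace ℝ (Fin d))} (hKc : IsCompact K)
    (hK : Convex ℝ K) (h0 : (0 : EuclideanSpace ℝ (Fin d)) ∈ K) :
    volume (fibRS K (0 : EuclideanSpace ℝ (Fin d))) =
      ENNReal.ofReal ((1 / 2) ^ d / (d + 1)) * volume K := by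
  have hm := (isCompact_fibRS hKc (0 : EuclideanSpace ℝ (Fin d))).measurableSet
  rw [Measure.volume_eq_prod, Measure.prod_apply_symm hm]
  have : ∀ t : ℝ, volume ((fun x => (x, t)) ⁻¹' fibRS K (0 : EuclideanSpace ℝ (Fin d))) =
      (Set.Icc (0:ℝ) 1).indicator (fun t => ENNReal.ofReal (min t (1 - t) ^ d) * volume K) t := by
    intro t
    by_cases ht : t ∈ Set.Icc (0:ℝ) 1
    · rw [Set.indicator_of_mem ht, ← volume_smul_set _ (le_min ht.1 (by linarith [ht.2]))]
      congr 1
      ext x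
      rw [Set.mem_preimage, fibRS_zero hK h0]
      simp [ht.1, ht.2]
    · rw [Set.indicator_of_notMem ht]
      convert measure_empty (μ := (volume : Measure (EuclideanSpace ℝ (Fin d))))
      ext x
      rw [Set.mem_preimage, fibRS_zero hK h0]
      simp only [Set.mem_empty_iff_false, iff_false]
      exact fun h => ht h.1
  simp_rw [this]
  rw [lintegral_indicator measurableSet_Icc, lintegral_mul_const _ (by fun_prop)]
  congr 1
  rw [← ofReal_integral_eq_lintegral_ofReal]
  · congr 1
    rw [integral_Icc_eq_integral_Ioc, ← intervalIntegral.integral_of_le zero_le_one,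
      ← intervalIntegral.integral_add_adjacent_intervals (b := 1/2)
        (Continuous.intervalIntegrable (by fun_prop) _ _)
        (Continuous.intervalIntegrable (by fun_prop) _ _)]
    have e1 : ∫ t in (0:ℝ)..(1/2), min t (1 - t) ^ d = ∫ t in (0:ℝ)..(1/2), t ^ d := by
      refine intervalIntegral.integral_congr fun t ht => ?_
      rw [Set.uIcc_of_le (by norm_num)] at ht
      rw [min_eq_left (by linarith [ht.2])]
    have e2 : ∫ t in (1/2:ℝ)..1, min t (1 - t) ^ d = ∫ t in (1/2:ℝ)..1, (1 - t) ^ d := by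
      refine intervalIntegral.integral_congr fun t ht => ?_
      rw [Set.uIcc_of_le (by norm_num)] at ht
      rw [min_eq_right (by linarith [ht.1])]
    rw [e1, e2, intervalIntegral.integral_comp_sub_left (fun t => t ^ d) 1, integral_pow]
    norm_num
    rw [pow_succ]
    field_simp
    ring
  · exact (Continuous.continuousOn (by fun_prop)).integrableOn_Icc
  · exact (ae_restrict_iff' measurableSet_Icc).2 (Filter.Eventually.of_forall fun t ht =>
      pow_nonneg (le_min ht.1 (by linarith [ht.2])) _)

theorem volume_bodyRS {d : ℕ} {K : Set (EuclideanSpace ℝ (Fin d))} (hKc : IsCompact K) :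
    volume (bodyRS K) = betaRS d * volume K * volume K := by
  have hm := (isCompact_bodyRS hKc).measurableSet
  rw [Measure.volume_eq_prod, Measure.prod_apply_symm hm, Measure.volume_eq_prod,
    lintegral_prod_symm _ (measurable_measure_prodMk_right hm).aemeasurable]
  have : ∀ (t : ℝ) (x : EuclideanSpace ℝ (Fin d)), volume ((fun y => (y, (x, t))) ⁻¹' bodyRS K) =
      (Set.Icc (0:ℝ) 1).indicator (fun t => {x | ∃ k ∈ K, x = t • k}.indicator
        (fun x => ENNReal.ofReal ((1 - t) ^ d) * volume K) x) t := by
    intro t x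
    by_cases ht : t ∈ Set.Icc (0:ℝ) 1
    · rw [Set.indicator_of_mem ht]
      by_cases hx : x ∈ {x | ∃ k ∈ K, x = t • k}
      · rw [Set.indicator_of_mem hx, ← volume_smul_set _ (by linarith [ht.2])]
        set A := {x | ∃ k ∈ K, x = (1 - t) • k}
        have : ((fun y => (y, (x, t))) ⁻¹' bodyRS K) = (fun y => x - y) ⁻¹' A := by
          ext y
          constructor
          · rintro ⟨_, _, h⟩; exact h
          · intro h; exact ⟨⟨ht.1, hx⟩, by simpa using ht.2, h⟩
        rw [this]
        simp only [sub_eq_add_neg]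
        exact (Measure.measure_preimage_neg _ ((fun y => x + y) ⁻¹' A)).trans (measure_preimage_add _ _ _)
      · rw [Set.indicator_of_notMem hx]
        convert measure_empty (μ := (volume : Measure (EuclideanSpace ℝ (Fin d))))
        ext y
        simp only [Set.mem_empty_iff_false, iff_false]
        rintro ⟨⟨_, h⟩, _⟩
        exact hx h
    · rw [Set.indicator_of_notMem ht]
      convert measure_empty (μ := (volume : Measure (EuclideanSpace ℝ (Fin d))))
      ext y
      simp only [Set.mem_empty_iff_false, iff_false]
      rintro ⟨⟨h, _⟩, ⟨h', _⟩⟩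
      exact ht ⟨h, by simpa using h'⟩
  simp_rw [this]
  have h2 : ∀ t : ℝ, ∫⁻ x, (Set.Icc (0:ℝ) 1).indicator (fun t => {x | ∃ k ∈ K, x = t • k}.indicator
        (fun x => ENNReal.ofReal ((1 - t) ^ d) * volume K) x) t =
      (Set.Icc (0:ℝ) 1).indicator
        (fun t => ENNReal.ofReal (t ^ d * (1 - t) ^ d) * volume K * volume K) t := by
    intro t
    by_cases ht : t ∈ Set.Icc (0:ℝ) 1
    · simp_rw [Set.indicator_of_mem ht]
      have hmA : MeasurableSet {x | ∃ k ∈ K, x = t • k} := by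
        have : {x | ∃ k ∈ K, x = t • k} = (fun k => t • k) '' K := by ext; simp [Set.mem_smul_set, eq_comm]
        rw [this]
        exact (hKc.image (by fun_prop)).measurableSet
      rw [lintegral_indicator hmA, setLIntegral_const, volume_smul_set _ ht.1,
        ENNReal.ofReal_mul (pow_nonneg ht.1 _)]
      ring
    · simp_rw [Set.indicator_of_notMem ht]; simp
  rw [lintegral_congr h2, lintegral_indicator measurableSet_Icc,
    lintegral_mul_const _ (by fun_prop), lintegral_mul_const _ (by fun_prop), betaRS,
    restrict_Ioc_eq_restrict_Icc]

theorem betaRS_ne_top (d : ℕ) : betaRS d ≠ ⊤ := by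
  refine ne_of_lt (lt_of_le_of_lt (setLIntegral_mono (g := fun _ => 1) measurable_const ?_) (by simp))
  intro t ht
  rw [ENNReal.ofReal_le_one]
  have : 0 ≤ 1 - t := by linarith [ht.2]
  exact mul_le_one₀ (pow_le_one₀ ht.1.le ht.2) (by positivity) (pow_le_one₀ this (by linarith [ht.1]))

theorem betaRS_ne_zero (d : ℕ) : betaRS d ≠ 0 := by
  have h : 0 < betaRS d := by
    rw [betaRS, setLIntegral_pos_iff (by fun_prop)]
    have : Set.Ioo (0:ℝ) 1 ⊆ (Function.support fun t : ℝ => ENNReal.ofReal (t ^ d * (1 - t) ^ d)) ∩ Set.Ioc 0 1 := by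
      intro t ht
      have : 0 < 1 - t := by linarith [ht.2]
      have := ht.1
      refine ⟨?_, ht.1, ht.2.le⟩
      simp only [Function.mem_support, ne_eq, ENNReal.ofReal_eq_zero, not_le]
      positivity
    refine lt_of_lt_of_le ?_ (measure_mono this)
    simp
  exact h.ne'

theorem symHull_compact {d : ℕ} {K : Set (EuclideanSpace ℝ (Fin d))} (hKc : IsCompact K)
    (hK : Convex ℝ K) (hne : K.Nonempty) : IsCompact (symHull K) := by
  have : symHull K = Prod.fst '' bodyRS K := by
    ext y
    rw [mem_symHull hK hne]
    constructor
    · rintro ⟨p, hp⟩; exact ⟨(y, p), hp, rfl⟩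
    · rintro ⟨⟨y, p⟩, hp, rfl⟩; exact ⟨p, hp⟩
  rw [this]
  exact (isCompact_bodyRS hKc).image continuous_fst

theorem symHull_nhds {d : ℕ} {K : Set (EuclideanSpace ℝ (Fin d))}
    (hKint : (interior K).Nonempty) : symHull K ∈ nhds 0 := by
  have hsub : K ∪ -K ⊆ symHull K := subset_convexHull _ _
  obtain ⟨x, hx⟩ := hKint
  have hc : Convex ℝ (symHull K) := convex_convexHull _ _
  have h1 : x ∈ interior (symHull K) :=
    interior_mono (Set.subset_union_left.trans hsub) hx
  have h2 : -x ∈ symHull K := hsub (Or.inr (by simpa using interior_subset hx))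
  have := hc.combo_interior_self_mem_interior h1 h2 (a := 1/2) (b := 1/2) (by norm_num) (by norm_num) (by norm_num)
  rw [mem_interior_iff_mem_nhds] at this
  simpa using this

theorem gauge_le_iff_symHull {d : ℕ} {K : Set (EuclideanSpace ℝ (Fin d))} (hKc : IsCompact K)
    (hK : Convex ℝ K) (hKint : (interior K).Nonempty) {r : ℝ} (hr : 0 < r)
    (y : EuclideanSpace ℝ (Fin d)) :
    gauge (symHull K) y ≤ r ↔ ∃ k ∈ symHull K, y = r • k := by
  have hcl := (symHull_compact hKc hK (hKint.mono interior_subset)).isClosed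
  have h1 := gauge_le_one_iff_mem_closure (x := r⁻¹ • y) (convex_convexHull ℝ (K ∪ -K)) (symHull_nhds hKint)
  rw [← symHull, hcl.closure_eq, gauge_smul_of_nonneg (by positivity), smul_eq_mul,
    inv_mul_le_iff₀ hr, mul_one] at h1
  rw [h1]
  constructor
  · intro h; exact ⟨_, h, by rw [smul_smul, mul_inv_cancel₀ hr.ne', one_smul]⟩
  · rintro ⟨k, hk, rfl⟩; rwa [smul_smul, inv_mul_cancel₀ hr.ne', one_smul]

theorem lintegral_gauge {d : ℕ} {K : Set (EuclideanSpace ℝ (Fin d))} (hKc : IsCompact K)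
    (hK : Convex ℝ K) (hKint : (interior K).Nonempty) :
    ∫⁻ y, ENNReal.ofReal (max 0 (1 - gauge (symHull K) y) ^ (d + 1)) =
      ENNReal.ofReal (d + 1) * (betaRS d * volume (symHull K)) := by
  have hcont := continuous_gauge (convex_convexHull ℝ (K ∪ -K)) (symHull_nhds hKint)
  rw [← symHull] at hcont
  have := lintegral_rpow_eq_lintegral_meas_le_mul
    (μ := (volume : Measure (EuclideanSpace ℝ (Fin d))))
    (f := fun y => max 0 (1 - gauge (symHull K) y)) (Filter.Eventually.of_forall fun y => le_max_left _ _)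
    (by fun_prop) (p := (d + 1 : ℕ)) (by positivity)
  simp_rw [Real.rpow_natCast] at this
  rw [this]
  push_cast
  congr 1
  rw [betaRS, ← lintegral_mul_const _ (by fun_prop)]
  have hsub : Set.Ioi (0:ℝ) = Set.Ioc 0 1 ∪ Set.Ioi 1 := by simp
  rw [hsub, lintegral_union measurableSet_Ioi (Set.Ioc_disjoint_Ioi le_rfl)]
  have z : ∫⁻ t in Set.Ioi (1:ℝ), volume {a | t ≤ max 0 (1 - gauge (symHull K) a)} * ENNReal.ofReal (t ^ ((d:ℝ) + 1 - 1)) = 0 := by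
    rw [setLIntegral_congr_fun (g := fun _ => 0) measurableSet_Ioi]
    · simp
    · intro t ht
      have : {a | t ≤ max 0 (1 - gauge (symHull K) a)} = ∅ := by
        ext a
        have ht' : 1 < t := ht
        have := gauge_nonneg (s := symHull K) a
        simp only [Set.mem_ofPred_eq, Set.mem_empty_iff_false, iff_false, not_le]
        exact max_lt (by linarith) (by linarith)
      beta_reduce; rw [this]; simp
  rw [z, add_zero, ← restrict_Ioo_eq_restrict_Ioc]
  refine setLIntegral_congr_fun measurableSet_Ioo fun t ht => ?_
  have h1 : 0 < 1 - t := by linarith [ht.2]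
  have : {a | t ≤ max 0 (1 - gauge (symHull K) a)} = {x | ∃ k ∈ symHull K, x = (1 - t) • k} := by
    ext a
    rw [Set.mem_ofPred_eq, Set.mem_ofPred_eq, ← gauge_le_iff_symHull hKc hK hKint h1, le_max_iff]
    constructor
    · rintro (h | h)
      · exact absurd ht.1 (not_lt.2 h)
      · linarith
    · intro h; right; linarith
  rw [this, volume_smul_set _ h1.le, ENNReal.ofReal_mul (pow_nonneg ht.1.le _)]
  rw [show (d:ℝ) + 1 - 1 = d by ring, Real.rpow_natCast]
  ring

theorem fib_lower {d : ℕ} {K : Set (EuclideanSpace ℝ (Fin d))} (hKc : IsCompact K)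
    (hK : Convex ℝ K) (hKint : (interior K).Nonempty)
    (y : EuclideanSpace ℝ (Fin d)) (hy : gauge (symHull K) y ≤ 1) :
    ∃ p, homo p (1 - gauge (symHull K) y) (fibRS K 0) ⊆ fibRS K y := by
  have hne := hKint.mono interior_subset
  set s := gauge (symHull K) y with hs
  have hs0 : 0 ≤ s := gauge_nonneg y
  have hz : ∃ z ∈ symHull K, y = s • z := by
    rcases hs0.eq_or_lt with h | h
    · refine ⟨0, mem_of_mem_nhds (symHull_nhds hKint), ?_⟩
      rw [smul_zero]
      refine (gauge_eq_zero (absorbent_nhds_zero (symHull_nhds hKint)) ?_).1 h.symm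
      rw [NormedSpace.isVonNBounded_iff]
      exact (symHull_compact hKc hK hne).isBounded
    · exact (gauge_le_iff_symHull hKc hK hKint h y).1 le_rfl
  obtain ⟨z, hz, hyz⟩ := hz
  obtain ⟨p, hp⟩ := (mem_symHull hK hne).1 hz
  refine ⟨_, (fib_concave hK (y := 0) (θ := 1 - s) (by linarith) (by linarith) hp).trans ?_⟩
  rw [smul_zero, zero_add, sub_sub_cancel, ← hyz]

theorem haar_prod (d : ℕ) : (volume : Measure (EuclideanSpace ℝ (Fin d) × ℝ)).IsAddHaarMeasure := by
  rw [Measure.volume_eq_prod]; infer_instance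

theorem fib_lower_volume {d : ℕ} {K : Set (EuclideanSpace ℝ (Fin d))} (hKc : IsCompact K)
    (hK : Convex ℝ K) (hKint : (interior K).Nonempty) (y : EuclideanSpace ℝ (Fin d)) :
    ENNReal.ofReal (max 0 (1 - gauge (symHull K) y) ^ (d + 1)) *
      volume (fibRS K (0 : EuclideanSpace ℝ (Fin d))) ≤ volume (fibRS K y) := by
  rcases le_total (gauge (symHull K) y) 1 with h | h
  · obtain ⟨p, hp⟩ := fib_lower hKc hK hKint y h
    rw [max_eq_right (by linarith)]
    have hmm := measure_mono (μ := volume) hp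
    have := haar_prod d
    have e := measure_homo (volume : Measure (EuclideanSpace ℝ (Fin d) × ℝ)) p
      (1 - gauge (symHull K) y) (by linarith) (fibRS K 0)
    rw [e] at hmm
    simpa using hmm
  · rw [max_eq_left (by linarith)]; simp

theorem const_arith (d : ℕ) : ENNReal.ofReal ((d:ℝ) + 1) * ENNReal.ofReal ((1 / 2) ^ d / (d + 1)) * 2 ^ d = 1 := by
  rw [show (2:ENNReal) ^ d = ENNReal.ofReal (2 ^ d) by rw [ENNReal.ofReal_pow (by norm_num)]; simp,
    ← ENNReal.ofReal_mul (by positivity), ← ENNReal.ofReal_mul (by positivity)]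
  rw [show ((d:ℝ) + 1) * ((1 / 2) ^ d / (d + 1)) * 2 ^ d = 1 by
    rw [mul_div_cancel₀ _ (by positivity), ← mul_pow]; norm_num]
  simp

theorem volume_bodyRS' {d : ℕ} {K : Set (EuclideanSpace ℝ (Fin d))} (hKc : IsCompact K) :
    volume (bodyRS K) = ∫⁻ y, volume (fibRS K y) := by
  have hm := (isCompact_bodyRS hKc).measurableSet
  rw [Measure.volume_eq_prod, Measure.prod_apply hm]; rfl

theorem upper_aux {d : ℕ} {K : Set (EuclideanSpace ℝ (Fin d))} (hKc : IsCompact K)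
    (hK : Convex ℝ K) (hKint : (interior K).Nonempty) (h0 : (0 : EuclideanSpace ℝ (Fin d)) ∈ K) :
    2 ^ d * ∫⁻ y, ENNReal.ofReal (max 0 (1 - gauge (symHull K) y) ^ (d + 1)) *
      volume (fibRS K (0 : EuclideanSpace ℝ (Fin d))) = betaRS d * volume K * volume (symHull K) := by
  have hcont := continuous_gauge (convex_convexHull ℝ (K ∪ -K)) (symHull_nhds hKint)
  rw [← symHull] at hcont
  rw [lintegral_mul_const _ (by fun_prop), lintegral_gauge hKc hK hKint, volume_fib_zero hKc hK h0]
  have := const_arith d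
  calc _ = (ENNReal.ofReal ((d:ℝ) + 1) * ENNReal.ofReal ((1 / 2) ^ d / (d + 1)) * 2 ^ d) *
        (betaRS d * volume K * volume (symHull K)) := by ring
    _ = _ := by rw [this, one_mul]

theorem upper_bound {d : ℕ} {K : Set (EuclideanSpace ℝ (Fin d))} (hKc : IsCompact K)
    (hK : Convex ℝ K) (hKint : (interior K).Nonempty) (h0 : (0 : EuclideanSpace ℝ (Fin d)) ∈ K) :
    volume (symHull K) ≤ 2 ^ d * volume K := by
  have hpos : volume K ≠ 0 := (Measure.measure_pos_of_nonempty_interior _ hKint).ne'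
  have hfin : volume K ≠ ⊤ := hKc.measure_ne_top
  have h1 := upper_aux hKc hK hKint h0
  have h2 : betaRS d * volume K * volume (symHull K) ≤ betaRS d * volume K * (2 ^ d * volume K) := by
    rw [← h1, show betaRS d * volume K * (2 ^ d * volume K) = 2 ^ d * (betaRS d * volume K * volume K) by ring,
      ← volume_bodyRS hKc, volume_bodyRS' hKc]
    gcongr with y
    exact fib_lower_volume hKc hK hKint y
  exact (ENNReal.mul_le_mul_iff_right (mul_ne_zero (betaRS_ne_zero d) hpos)
    (ENNReal.mul_ne_top (betaRS_ne_top d) hfin)).1 h2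

theorem equality_ae {d : ℕ} {K : Set (EuclideanSpace ℝ (Fin d))} (hKc : IsCompact K)
    (hK : Convex ℝ K) (hKint : (interior K).Nonempty) (h0 : (0 : EuclideanSpace ℝ (Fin d)) ∈ K)
    (heq : volume (symHull K) = 2 ^ d * volume K) :
    ∀ᵐ y, ENNReal.ofReal (max 0 (1 - gauge (symHull K) y) ^ (d + 1)) *
      volume (fibRS K (0 : EuclideanSpace ℝ (Fin d))) = volume (fibRS K y) := by
  have hfin : volume K ≠ ⊤ := hKc.measure_ne_top
  have h1 := upper_aux hKc hK hKint h0
  have h2 : ∫⁻ y, ENNReal.ofReal (max 0 (1 - gauge (symHull K) y) ^ (d + 1)) *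
      volume (fibRS K (0 : EuclideanSpace ℝ (Fin d))) = ∫⁻ y, volume (fibRS K y) := by
    rw [← volume_bodyRS' hKc, volume_bodyRS hKc]
    rw [heq, show betaRS d * volume K * (2 ^ d * volume K) = 2 ^ d * (betaRS d * volume K * volume K) by ring] at h1
    exact (ENNReal.mul_right_inj (by simp) (by simp)).1 h1
  refine ae_eq_of_ae_le_of_lintegral_le (Filter.Eventually.of_forall (fib_lower_volume hKc hK hKint)) ?_ ?_ h2.ge
  · rw [h2, ← volume_bodyRS' hKc]; exact (isCompact_bodyRS hKc).measure_ne_top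
  · exact (measurable_measure_prodMk_left (isCompact_bodyRS hKc).measurableSet).aemeasurable

theorem equality_all {d : ℕ} {K : Set (EuclideanSpace ℝ (Fin d))} (hKc : IsCompact K)
    (hK : Convex ℝ K) (hKint : (interior K).Nonempty) (h0 : (0 : EuclideanSpace ℝ (Fin d)) ∈ K)
    (heq : volume (symHull K) = 2 ^ d * volume K) (y : EuclideanSpace ℝ (Fin d))
    (hy : y ∈ interior (symHull K)) :
    volume (fibRS K y) ≤ ENNReal.ofReal (max 0 (1 - gauge (symHull K) y) ^ (d + 1)) *
      volume (fibRS K (0 : EuclideanSpace ℝ (Fin d))) := by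
  have hne := hKint.mono interior_subset
  have hcont := continuous_gauge (convex_convexHull ℝ (K ∪ -K)) (symHull_nhds hKint)
  rw [← symHull] at hcont
  set h : EuclideanSpace ℝ (Fin d) → ENNReal := fun y =>
    ENNReal.ofReal (max 0 (1 - gauge (symHull K) y) ^ (d + 1)) *
      volume (fibRS K (0 : EuclideanSpace ℝ (Fin d))) with hh
  have hfin0 : volume (fibRS K (0 : EuclideanSpace ℝ (Fin d))) ≠ ⊤ :=
    (isCompact_fibRS hKc _).measure_ne_top
  have hhc : Continuous h := by
    refine (ENNReal.continuous_mul_const hfin0).comp ?_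
    exact ENNReal.continuous_ofReal.comp (by fun_prop)
  have hdense : Dense {y | h y = volume (fibRS K y)} :=
    Measure.dense_of_ae (equality_ae hKc hK hKint h0 heq)
  have := haar_prod d
  have key : ∀ θ : ℝ, 0 < θ → θ < 1 → ENNReal.ofReal (θ ^ (d + 1)) * volume (fibRS K y) ≤ h y := by
    intro θ h0 h1
    by_contra hlt
    rw [not_le] at hlt
    have n1 : {y' | h y' < ENNReal.ofReal (θ ^ (d + 1)) * volume (fibRS K y)} ∈ nhds y :=
      hhc.continuousAt.eventually_lt continuousAt_const hlt
    have n2 : (fun y' => (1 - θ)⁻¹ • (y' - θ • y)) ⁻¹' (symHull K) ∈ nhds y := by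
      have hc : ContinuousAt (fun y' => (1 - θ)⁻¹ • (y' - θ • y)) y := by fun_prop
      refine hc.preimage_mem_nhds ?_
      have : (1 - θ)⁻¹ • (y - θ • y) = y := by
        rw [show y - θ • y = (1 - θ) • y by module, smul_smul, inv_mul_cancel₀ (by linarith), one_smul]
      simp only [this]
      exact mem_interior_iff_mem_nhds.1 hy
    obtain ⟨y', hd', hy'⟩ := hdense.inter_nhds_nonempty (Filter.inter_mem n1 n2)
    obtain ⟨p, hp⟩ := (mem_symHull hK hne).1 hy'.2
    have hs := fib_concave hK (y := y) h0.le h1.le hp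
    rw [smul_smul, mul_inv_cancel₀ (by linarith), one_smul, add_sub_cancel] at hs
    have := measure_mono (μ := volume) hs
    rw [measure_homo _ _ _ h0.le] at this
    have h3 := hy'.1
    have hd2 : h y' = volume (fibRS K y') := hd'
    simp only [Set.mem_ofPred_eq] at h3
    rw [hd2] at h3
    simp at this
    exact absurd h3 (not_lt.2 this)
  have hl : Filter.Tendsto (fun θ : ℝ => ENNReal.ofReal (θ ^ (d + 1)) * volume (fibRS K y))
      (nhdsWithin 1 (Set.Iio 1)) (nhds (ENNReal.ofReal (1 ^ (d + 1)) * volume (fibRS K y))) := by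
    refine Filter.Tendsto.mono_left ?_ nhdsWithin_le_nhds
    have hc : Continuous (fun θ : ℝ => ENNReal.ofReal (θ ^ (d + 1)) * volume (fibRS K y)) :=
      (ENNReal.continuous_mul_const (isCompact_fibRS hKc _).measure_ne_top).comp
        (ENNReal.continuous_ofReal.comp (by fun_prop))
    exact hc.tendsto 1
  have := le_of_tendsto hl (b := h y) (by
    filter_upwards [Ioo_mem_nhdsLT (show (0:ℝ) < 1 by norm_num)] with θ hθ
    exact key θ hθ.1 hθ.2)
  rw [one_pow, ENNReal.ofReal_one, one_mul] at this
  exact this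

theorem eq_of_measure_le {F : Type*} [NormedAddCommGroup F] [NormedSpace ℝ F] [MeasurableSpace F]
    [BorelSpace F] [FiniteDimensional ℝ F] (μ : Measure F) [μ.IsAddHaarMeasure] {A B : Set F}
    (hA : IsCompact A) (hB : IsCompact B) (hBc : Convex ℝ B) (hAB : A ⊆ B) (hpos : μ B ≠ 0)
    (h : μ B ≤ μ A) : A = B := by
  have hinn : (interior B).Nonempty := by
    by_contra hne
    rw [Set.not_nonempty_iff_eq_empty] at hne
    have := hBc.addHaar_frontier μ
    rw [frontier, hne, hB.isClosed.closure_eq, Set.sdiff_empty] at this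
    exact hpos this
  refine hAB.antisymm ?_
  have hdiff : μ (B \ A) = 0 := by
    rw [measure_sdiff hAB hA.measurableSet.nullMeasurableSet hA.measure_ne_top]
    exact tsub_eq_zero_of_le h
  have ho : IsOpen (interior B \ A) := isOpen_interior.sdiff hA.isClosed
  have : interior B \ A = ∅ := by
    rw [← ho.measure_eq_zero_iff μ]
    exact measure_mono_null (Set.sdiff_subset_sdiff_left interior_subset) hdiff
  have hsub : interior B ⊆ A := Set.sdiff_eq_empty.1 this
  calc B ⊆ closure B := subset_closure
    _ = closure (interior B) := (hBc.closure_interior_eq_closure_of_nonempty_interior hinn).symm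
    _ ⊆ A := hA.isClosed.closure_subset_iff.2 hsub

theorem fib_eq {d : ℕ} {K : Set (EuclideanSpace ℝ (Fin d))} (hKc : IsCompact K)
    (hK : Convex ℝ K) (hKint : (interior K).Nonempty) (h0 : (0 : EuclideanSpace ℝ (Fin d)) ∈ K)
    (heq : volume (symHull K) = 2 ^ d * volume K) (y : EuclideanSpace ℝ (Fin d))
    (hy : y ∈ interior (symHull K)) : ∃ p, ∃ s > 0, homo p s (fibRS K 0) = fibRS K y := by
  have hg : gauge (symHull K) y < 1 := interior_subset_gauge_lt_one _ hy
  obtain ⟨p, hp⟩ := fib_lower hKc hK hKint y hg.le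
  have := haar_prod d
  have hpos : volume K ≠ 0 := (Measure.measure_pos_of_nonempty_interior _ hKint).ne'
  have hm := measure_homo (volume : Measure (EuclideanSpace ℝ (Fin d) × ℝ)) p
      (1 - gauge (symHull K) y) (by linarith) (fibRS K 0)
  have hm0 : volume (homo p (1 - gauge (symHull K) y) (fibRS K 0)) ≠ 0 := by
    rw [hm, volume_fib_zero hKc hK h0]
    have : 0 < 1 - gauge (symHull K) y := by linarith
    refine mul_ne_zero ?_ (mul_ne_zero ?_ hpos) <;>
    · rw [ENNReal.ofReal_ne_zero_iff]; positivity
  refine ⟨p, 1 - gauge (symHull K) y, by linarith, eq_of_measure_le volume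
    ((isCompact_fibRS hKc 0).image (by fun_prop)) (isCompact_fibRS hKc y) (convex_fibRS hK y) hp ?_ ?_⟩
  · intro h
    exact hm0 (measure_mono_null hp h)
  · rw [hm]
    have := equality_all hKc hK hKint h0 heq y hy
    rw [max_eq_right (by linarith)] at this
    simpa using this

theorem homInt_of_eq {d : ℕ} {K : Set (EuclideanSpace ℝ (Fin d))} (hKc : IsCompact K)
    (hK : Convex ℝ K) (hKint : (interior K).Nonempty) (h0 : (0 : EuclideanSpace ℝ (Fin d)) ∈ K)
    (heq : volume (symHull K) = 2 ^ d * volume K) : HomInt K := by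
  have hne := hKint.mono interior_subset
  intro v₁ v₂ l₁ l₂ hl₁ hl₂ hinn
  set L := l₁ + l₂ with hL
  have hLp : 0 < L := by positivity
  set t := l₁ / L with ht
  have htL : L * t = l₁ := by rw [ht]; field_simp
  have htL2 : L * (1 - t) = l₂ := by linarith
  have ht0 : 0 ≤ t := by positivity
  have ht1 : 0 ≤ 1 - t := by
    rw [← htL2] at hl₂; exact (pos_of_mul_pos_right hl₂ hLp.le).le
  have hmem : ∀ (y x : EuclideanSpace ℝ (Fin d)),
      v₁ + L • x ∈ homo v₁ l₁ K ∩ homo (v₁ + L • y) l₂ K ↔ (x, t) ∈ fibRS K y := by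
    intro y x
    have e1 : v₁ + L • x ∈ homo v₁ l₁ K ↔ ∃ k ∈ K, x = t • k := by
      constructor
      · rintro ⟨k, hk, h⟩
        refine ⟨k, hk, smul_right_injective _ hLp.ne' ?_⟩
        simp only [smul_smul, htL]
        exact (add_left_cancel h).symm
      · rintro ⟨k, hk, rfl⟩
        exact ⟨k, hk, by simp only [smul_smul, htL]⟩
    have e2 : v₁ + L • x ∈ homo (v₁ + L • y) l₂ K ↔ ∃ k ∈ K, x - y = (1 - t) • k := by
      constructor
      · rintro ⟨k, hk, h⟩
        refine ⟨k, hk, smul_right_injective _ hLp.ne' ?_⟩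
        simp only [smul_smul, htL2]
        simp only at h
        rw [add_assoc] at h
        rw [smul_sub, ← add_left_cancel h]; abel
      · rintro ⟨k, hk, h⟩
        refine ⟨k, hk, ?_⟩
        show v₁ + L • y + l₂ • k = v₁ + L • x
        rw [← htL2, ← smul_smul, ← h]; module
    rw [Set.mem_inter_iff, e1, e2]
    exact ⟨fun h => ⟨⟨ht0, h.1⟩, ht1, h.2⟩, fun h => ⟨h.1.2, h.2.2⟩⟩
  set y := L⁻¹ • (v₂ - v₁) with hyd
  have hv₂ : v₂ = v₁ + L • y := by
    rw [hyd, smul_smul, mul_inv_cancel₀ hLp.ne', one_smul]; abel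
  obtain ⟨x₀, hx₀⟩ := hinn
  rw [hv₂] at hx₀ ⊢
  set ξ := L⁻¹ • (x₀ - v₁) with hξ
  have hxξ : x₀ = v₁ + L • ξ := by
    rw [hξ, smul_smul, mul_inv_cancel₀ hLp.ne', one_smul]; abel
  have hyint : y ∈ interior (symHull K) := by
    rw [mem_interior_iff_mem_nhds]
    have hc : ContinuousAt (fun y' => x₀ + L • (y - y')) y := by fun_prop
    have hn : (fun y' => x₀ + L • (y - y')) ⁻¹' (homo v₁ l₁ K ∩ homo (v₁ + L • y) l₂ K) ∈ nhds y := by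
      refine hc.preimage_mem_nhds ?_
      simpa using mem_interior_iff_mem_nhds.1 hx₀
    filter_upwards [hn] with y' hy'
    rw [mem_symHull hK hne]
    refine ⟨(ξ, t), (hmem y' ξ).1 ⟨?_, ?_⟩⟩
    · rw [← hxξ]; exact (interior_subset hx₀).1
    · obtain ⟨k, hk, h⟩ := hy'.2
      refine ⟨k, hk, ?_⟩
      simp only at h
      rw [← hxξ]
      show v₁ + L • y' + l₂ • k = x₀
      have : v₁ + L • y' + l₂ • k = (v₁ + L • y + l₂ • k) - L • (y - y') := by module
      rw [this, h]; abel
  obtain ⟨p, s, hs, hps⟩ := fib_eq hKc hK hKint h0 heq y hyint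
  set τ := (t - p.2) / s with hτ
  have htτ : t = p.2 + s * τ := by rw [hτ]; field_simp; ring
  have hsec : ∀ x, (x, t) ∈ fibRS K y ↔ (0 ≤ τ ∧ τ ≤ 1) ∧ ∃ k ∈ K, x = p.1 + (s * min τ (1 - τ)) • k := by
    intro x
    rw [← hps]
    constructor
    · rintro ⟨⟨x', τ'⟩, hq, he⟩
      simp only [Prod.ext_iff, Prod.fst_add, Prod.snd_add, Prod.smul_mk, smul_eq_mul] at he
      have : τ' = τ := by
        have : s * τ' = s * τ := by linarith [he.2]
        exact mul_left_cancel₀ hs.ne' this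
      subst this
      obtain ⟨h1, k, hk, h2⟩ := (fibRS_zero hK h0 _ _).1 hq
      exact ⟨h1, k, hk, by rw [← he.1, h2, smul_smul]⟩
    · rintro ⟨h1, k, hk, rfl⟩
      refine ⟨(min τ (1 - τ) • k, τ), (fibRS_zero hK h0 _ _).2 ⟨h1, k, hk, rfl⟩, ?_⟩
      ext1
      · simp [smul_smul]
      · simp [htτ]
  have hτ01 : 0 ≤ τ ∧ τ ≤ 1 := by
    have := interior_subset hx₀
    rw [hxξ, hmem, hsec] at this
    exact this.1
  refine ⟨v₁ + L • p.1, L * (s * min τ (1 - τ)), ?_, ?_⟩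
  · have : 0 ≤ min τ (1 - τ) := le_min hτ01.1 (by linarith [hτ01.2])
    positivity
  · ext x
    set ζ := L⁻¹ • (x - v₁) with hζ
    have hxζ : x = v₁ + L • ζ := by
      rw [hζ, smul_smul, mul_inv_cancel₀ hLp.ne', one_smul]; abel
    rw [hxζ, hmem, hsec]
    constructor
    · rintro ⟨_, k, hk, h⟩
      exact ⟨k, hk, by rw [h]; module⟩
    · rintro ⟨k, hk, h⟩
      refine ⟨hτ01, k, hk, smul_right_injective _ hLp.ne' ?_⟩
      have : v₁ + L • (p.1 + (s * min τ (1 - τ)) • k) = v₁ + L • ζ := by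
        rw [← h]; module
      exact (add_left_cancel this).symm

theorem simplex_basis {d : ℕ} (b : Module.Basis (Fin d) ℝ (EuclideanSpace ℝ (Fin d))) :
    2 ^ d * volume (convexHull ℝ (insert 0 (Set.range b))) ≤
      volume (symHull (convexHull ℝ (insert 0 (Set.range b)))) := by
  set K := convexHull ℝ (insert 0 (Set.range b)) with hK
  set e : (Fin d → Bool) → Fin d → ℝ := fun ε i => if ε i then 1 else -1 with he
  have he2 : ∀ ε i, e ε i * e ε i = 1 := by
    intro ε i; simp only [he]; split_ifs <;> norm_num
  set T : (Fin d → Bool) → (EuclideanSpace ℝ (Fin d) →ₗ[ℝ] EuclideanSpace ℝ (Fin d)) :=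
    fun ε => b.constr ℝ (fun i => e ε i • b i) with hT
  have hTb : ∀ ε i, T ε (b i) = e ε i • b i := fun ε i => by simp [hT]
  have hTT : ∀ ε, T ε ∘ₗ T ε = LinearMap.id := by
    intro ε
    refine b.ext fun i => ?_
    simp [hTb, smul_smul, he2]
  have hdet : ∀ ε, |LinearMap.det (T ε)| = 1 := by
    intro ε
    have := congrArg LinearMap.det (hTT ε)
    rw [LinearMap.det_comp, LinearMap.det_id] at this
    rcases mul_self_eq_one_iff.1 this with h | h <;> rw [h] <;> norm_num
  have hvol : ∀ ε, volume (T ε '' K) = volume K := by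
    intro ε
    rw [Measure.addHaar_image_linearMap, hdet]; simp
  have hTr : ∀ ε x i, b.repr (T ε x) i = e ε i * b.repr x i := by
    intro ε x i
    have : (b.coord i) ∘ₗ (T ε) = e ε i • b.coord i := by
      refine b.ext fun j => ?_
      simp [hTb]
      by_cases hij : i = j
      · subst hij; simp
      · simp [Finsupp.single_apply, Ne.symm hij]
    have := LinearMap.congr_fun this x
    simpa using this
  have hKcomp : IsCompact K := ((Set.finite_range b).insert 0).isCompact_convexHull (𝕜 := ℝ)
  have hKpos : ∀ x ∈ K, ∀ i, 0 ≤ b.repr x i := by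
    intro x hx i
    have hc : Convex ℝ {x | 0 ≤ b.coord i x} := convex_halfSpace_ge (b.coord i).isLinear 0
    refine convexHull_min ?_ hc hx
    rintro y (rfl | ⟨j, rfl⟩)
    · simp
    · simp [Finsupp.single_apply]; split_ifs <;> norm_num
  have hsub : ∀ ε, T ε '' K ⊆ symHull K := by
    intro ε
    rw [hK, LinearMap.image_convexHull]
    refine convexHull_min ?_ (convex_convexHull _ _)
    rintro _ ⟨y, (rfl | ⟨j, rfl⟩), rfl⟩
    · rw [map_zero]
      exact subset_convexHull _ _ (Or.inl (subset_convexHull _ _ (Or.inl rfl)))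
    · rw [hTb]
      have hb : b j ∈ K := subset_convexHull _ _ (Or.inr ⟨j, rfl⟩)
      refine subset_convexHull _ _ ?_
      simp only [he]
      split_ifs
      · left; simpa using hb
      · right; simpa using hb
  have hdisj : Pairwise (Function.onFun (AEDisjoint volume) fun ε => T ε '' K) := by
    intro ε ε' hne
    obtain ⟨i, hi⟩ := Function.ne_iff.1 hne
    have hnull : volume ((LinearMap.ker (b.coord i) : Submodule ℝ _) : Set (EuclideanSpace ℝ (Fin d))) = 0 := by
      refine Measure.addHaar_submodule _ _ ?_
      intro h
      have : b i ∈ LinearMap.ker (b.coord i) := by rw [h]; trivial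
      simp at this
    refine measure_mono_null ?_ hnull
    rintro x ⟨⟨y, hy, rfl⟩, ⟨z, hz, hzy⟩⟩
    have h1 := hTr ε y i
    have h2 := hTr ε' z i
    rw [hzy] at h2
    have h3 := hKpos y hy i
    have h4 := hKpos z hz i
    have : e ε' i = - e ε i := by
      simp only [he]
      cases h5 : ε i <;> cases h6 : ε' i <;> simp_all
    rw [this] at h2
    have h7 := he2 ε i
    show b.repr (T ε y) i = 0
    have h8 : e ε i * (b.repr y i + b.repr z i) = 0 := by linarith
    have h9 : e ε i ≠ 0 := by intro h; rw [h] at h7; norm_num at h7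
    have h10 := (mul_eq_zero.1 h8).resolve_left h9
    rw [h1, show b.repr y i = 0 by linarith, mul_zero]
  have hm := measure_iUnion₀ hdisj (fun ε => (hKcomp.image (T ε).continuous_of_finiteDimensional).measurableSet.nullMeasurableSet)
  simp only [hvol] at hm
  rw [tsum_fintype, Finset.sum_const, Finset.card_univ] at hm
  calc 2 ^ d * volume K = volume (⋃ ε, T ε '' K) := by
        rw [hm]; simp
    _ ≤ _ := measure_mono (Set.iUnion_subset hsub)

theorem hull_translate {d : ℕ} (a : EuclideanSpace ℝ (Fin d)) (K : Set (EuclideanSpace ℝ (Fin d))) :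
    convexHull ℝ (K ∪ reflAbout a K) = a +ᵥ symHull ((-a) +ᵥ K) := by
  rw [symHull, ← convexHull_vadd, Set.vadd_set_union, vadd_neg_vadd]
  congr 2
  ext x
  constructor
  · rintro ⟨k, hk, rfl⟩
    refine ⟨-(-a + k), ?_, ?_⟩
    · rw [Set.mem_neg, neg_neg]; exact ⟨k, hk, rfl⟩
    · simp only [vadd_eq_add]; module
  · rintro ⟨y, hy, rfl⟩
    obtain ⟨k, hk, h⟩ := hy
    refine ⟨k, hk, ?_⟩
    simp only [vadd_eq_add] at h ⊢
    rw [← neg_neg y, ← h]; module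

theorem volume_hull {d : ℕ} (a : EuclideanSpace ℝ (Fin d)) (K : Set (EuclideanSpace ℝ (Fin d))) :
    volume (convexHull ℝ (K ∪ reflAbout a K)) = volume (symHull ((-a) +ᵥ K)) := by
  rw [hull_translate, measure_vadd]

theorem interior_vadd_nonempty {d : ℕ} (a : EuclideanSpace ℝ (Fin d))
    {K : Set (EuclideanSpace ℝ (Fin d))} (h : (interior K).Nonempty) :
    (interior (a +ᵥ K)).Nonempty := by
  rw [interior_vadd]; exact h.vadd_set

theorem zero_mem_vadd {d : ℕ} {a : EuclideanSpace ℝ (Fin d)}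
    {K : Set (EuclideanSpace ℝ (Fin d))} (h : a ∈ K) : (0 : EuclideanSpace ℝ (Fin d)) ∈ (-a) +ᵥ K :=
  ⟨a, h, by simp⟩

theorem upper_all {d : ℕ} {K : Set (EuclideanSpace ℝ (Fin d))} (hKc : IsCompact K)
    (hK : Convex ℝ K) (hKint : (interior K).Nonempty) {a : EuclideanSpace ℝ (Fin d)} (ha : a ∈ K) :
    volume (convexHull ℝ (K ∪ reflAbout a K)) ≤ 2 ^ d * volume K := by
  rw [volume_hull, ← measure_vadd volume (-a) K]
  exact upper_bound (hKc.vadd _) (hK.vadd _) (interior_vadd_nonempty _ hKint) (zero_mem_vadd ha)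

theorem isCompact_hull {d : ℕ} {K : Set (EuclideanSpace ℝ (Fin d))} (hKc : IsCompact K)
    (hK : Convex ℝ K) (hKne : K.Nonempty) (a : EuclideanSpace ℝ (Fin d)) :
    IsCompact (convexHull ℝ (K ∪ reflAbout a K)) := by
  rw [hull_translate]
  exact (symHull_compact (hKc.vadd _) (hK.vadd _) hKne.vadd_set).vadd _

theorem usc_hull {d : ℕ} {K : Set (EuclideanSpace ℝ (Fin d))} (hKc : IsCompact K)
    (hK : Convex ℝ K) (hKne : K.Nonempty) :
    UpperSemicontinuous (fun a => volume (convexHull ℝ (K ∪ reflAbout a K))) := by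
  intro a y hy
  have hc := isCompact_hull hKc hK hKne a
  have ht := tendsto_measure_cthickening_of_isCompact (μ := volume) hc
  have h1 := ht.eventually (gt_mem_nhds hy)
  have h2 : Filter.Tendsto (fun a' => 2 * dist a' a) (nhds a) (nhds 0) := by
    have : Continuous (fun a' => 2 * dist a' a) := by fun_prop
    simpa using this.tendsto a
  filter_upwards [h2.eventually h1] with a' ha'
  refine lt_of_le_of_lt (measure_mono ?_) ha'
  refine convexHull_min ?_ ((convex_convexHull _ _).cthickening _)
  rintro x (hx | ⟨k, hk, rfl⟩)
  · exact Metric.self_subset_cthickening _ (subset_convexHull _ _ (Or.inl hx))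
  · refine Metric.mem_cthickening_of_dist_le _ ((2:ℝ) • a - k) _ _ (subset_convexHull _ _ (Or.inr ⟨k, hk, rfl⟩)) ?_
    simp only
    rw [dist_sub_right, dist_smul₀]; simp

theorem eq_imp_simplex {d : ℕ} (hd : d ≠ 0) {K : Set (EuclideanSpace ℝ (Fin d))} (hKc : IsCompact K)
    (hK : Convex ℝ K) (hKint : (interior K).Nonempty)
    (h : ∀ c, (∀ a ∈ K, volume (convexHull ℝ (K ∪ reflAbout a K)) ≤ c) → 2 ^ d * volume K ≤ c) :
    ∃ f : Fin (d + 1) → EuclideanSpace ℝ (Fin d),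
        AffineIndependent ℝ f ∧ K = convexHull ℝ (Set.range f) := by
  have hne := hKint.mono interior_subset
  obtain ⟨a, ha, hmax⟩ := ((usc_hull hKc hK hne).upperSemicontinuousOn K).exists_isMaxOn hne hKc
  have h1 := h _ hmax
  have h2 := le_antisymm (upper_all hKc hK hKint ha) h1
  rw [volume_hull, ← measure_vadd volume (-a) K] at h2
  have hH := homInt_of_eq (hKc.vadd _) (hK.vadd _) (interior_vadd_nonempty _ hKint) (zero_mem_vadd ha) h2
  obtain ⟨f, hf, hKf⟩ := simplex_of_homInt hd (hKc.vadd _) (hK.vadd _) (interior_vadd_nonempty _ hKint) hH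
  refine ⟨a +ᵥ f, ?_, ?_⟩
  · exact (affineIndependent_vadd ℝ).2 hf
  · have : K = a +ᵥ ((-a) +ᵥ K) := by rw [vadd_neg_vadd]
    rw [this, hKf, ← convexHull_vadd]
    congr 1
    ext x; simp [Set.mem_vadd_set]

theorem simplex_imp_eq {d : ℕ} (f : Fin (d + 1) → EuclideanSpace ℝ (Fin d)) (hf : AffineIndependent ℝ f) :
    2 ^ d * volume (convexHull ℝ (Set.range f)) ≤
      volume (convexHull ℝ (convexHull ℝ (Set.range f) ∪ reflAbout (f 0) (convexHull ℝ (Set.range f)))) := by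
  have h1 := (affineIndependent_iff_linearIndependent_vsub ℝ f 0).1 hf
  have h2 : LinearIndependent ℝ (fun i : Fin d => f i.succ - f 0) := by
    have := h1.comp (fun i : Fin d => ⟨i.succ, Fin.succ_ne_zero i⟩) (by
      intro i j hij; simpa using hij)
    exact this
  let b := basisOfLinearIndependentOfCardEqFinrank' _ h2 (by simp)
  have h3 := simplex_basis b
  have h4 : -f 0 +ᵥ convexHull ℝ (Set.range f) = convexHull ℝ (insert 0 (Set.range b)) := by
    rw [← convexHull_vadd]
    congr 1
    ext x
    simp only [Set.mem_vadd_set, Set.mem_range, exists_exists_eq_and, Set.mem_insert_iff, b,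
      coe_basisOfLinearIndependentOfCardEqFinrank', vadd_eq_add]
    rw [Fin.exists_fin_succ, neg_add_cancel]
    refine or_congr eq_comm (exists_congr fun i => ?_)
    rw [neg_add_eq_sub]
  rw [volume_hull, ← measure_vadd volume (-f 0) (convexHull ℝ (Set.range f)), h4]
  exact h3

theorem exists_split {n : ℕ} (w : EuclideanSpace ℝ (Fin (n + 1))) (hw : ‖w‖ = 1) :
    ∃ J : EuclideanSpace ℝ (Fin n) →ₗ[ℝ] EuclideanSpace ℝ (Fin (n + 1)),
      (∀ (s : ℝ) y, ‖s • w + J y‖ ^ 2 = s ^ 2 + ‖y‖ ^ 2) ∧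
      (∀ x, ∃ (s : ℝ), ∃ y, s • w + J y = x) ∧
      (∀ y, inner ℝ w (J y) = 0) ∧
      MeasurePreserving (fun p : ℝ × EuclideanSpace ℝ (Fin n) => p.1 • w + J p.2)
        volume volume := by
  obtain ⟨B, hB⟩ := Orthonormal.exists_orthonormalBasis_extension_of_card_eq (𝕜 := ℝ)
    (E := EuclideanSpace ℝ (Fin (n + 1))) (ι := Fin (n + 1)) (by simp) (v := fun _ => w) (s := {0}) (by
      rw [orthonormal_iff_ite]
      rintro ⟨i, hi⟩ ⟨j, hj⟩
      simp only [Set.mem_singleton_iff] at hi hj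
      subst hi; subst hj
      simp [hw])
  have hB0 : B 0 = w := hB 0 rfl
  set J : EuclideanSpace ℝ (Fin n) →ₗ[ℝ] EuclideanSpace ℝ (Fin (n + 1)) :=
    { toFun := fun y => ∑ i, y i • B i.succ
      map_add' := fun x y => by simp [add_smul, Finset.sum_add_distrib]
      map_smul' := fun c y => by simp [Finset.smul_sum, smul_smul] } with hJ
  have hJa : ∀ y, J y = ∑ i, y i • B i.succ := fun y => rfl
  have hrep : ∀ (s : ℝ) (y : EuclideanSpace ℝ (Fin n)),
      s • w + J y = B.repr.symm (WithLp.toLp 2 (Fin.cons s y.ofLp)) := by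
    intro s y
    rw [← B.sum_repr_symm, Fin.sum_univ_succ, hB0, hJa]
    simp
  refine ⟨J, ?_, ?_, ?_, ?_⟩
  · intro s y
    rw [hrep, LinearIsometryEquiv.norm_map, EuclideanSpace.norm_sq_eq, EuclideanSpace.norm_sq_eq,
      Fin.sum_univ_succ]
    simp
  · intro x
    refine ⟨B.repr x 0, WithLp.toLp 2 (Fin.tail (B.repr x).ofLp), ?_⟩
    rw [hrep]
    simp only [Fin.cons_self_tail]
    simp
  · intro y
    rw [hJa, inner_sum, ← hB0]
    refine Finset.sum_eq_zero fun i _ => ?_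
    rw [inner_smul_right, B.orthonormal.2 (Fin.succ_ne_zero i).symm, mul_zero]
  · have h1 : MeasurePreserving (Prod.map (id : ℝ → ℝ) (WithLp.ofLp : EuclideanSpace ℝ (Fin n) → (Fin n → ℝ)))
        volume volume := (MeasurePreserving.id volume).prod (PiLp.volume_preserving_ofLp (Fin n))
    have h2 := (volume_preserving_piFinSuccAbove (fun _ : Fin (n + 1) => ℝ) 0).symm
    have h3 := PiLp.volume_preserving_toLp (Fin (n + 1))
    have h4 := B.measurePreserving_repr_symm
    have := h4.comp (h3.comp (h2.comp h1))
    convert this using 2 with p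
    rw [hrep]
    simp [MeasurableEquiv.piFinSuccAbove, Fin.insertNthEquiv]

theorem fubini_split {n : ℕ} {w : EuclideanSpace ℝ (Fin (n + 1))}
    {J : EuclideanSpace ℝ (Fin n) →ₗ[ℝ] EuclideanSpace ℝ (Fin (n + 1))}
    (h : MeasurePreserving (fun p : ℝ × EuclideanSpace ℝ (Fin n) => p.1 • w + J p.2) volume volume)
    {A : Set (EuclideanSpace ℝ (Fin (n + 1)))} (hA : MeasurableSet A) :
    volume A = ∫⁻ y, volume {s : ℝ | s • w + J y ∈ A} := by
  rw [← h.measure_preimage hA.nullMeasurableSet, Measure.volume_eq_prod,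
    Measure.prod_apply_symm (h.measurable hA)]
  rfl

/-- A two-body version of Steiner symmetrization. -/
def nSet {n : ℕ} (w : EuclideanSpace ℝ (Fin n)) (A B : Set (EuclideanSpace ℝ (Fin n))) :
    Set (EuclideanSpace ℝ (Fin n)) :=
  (fun z : EuclideanSpace ℝ (Fin n) × EuclideanSpace ℝ (Fin n) =>
    (1 / 2 : ℝ) • (z.1 + z.2) - (inner ℝ w z.2) • w) ''
    {z | z.1 ∈ A ∧ z.2 ∈ B ∧ z.1 - z.2 = (inner ℝ w (z.1 - z.2)) • w}

theorem nSet_compact {n : ℕ} {w : EuclideanSpace ℝ (Fin n)} {A B : Set (EuclideanSpace ℝ (Fin n))}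
    (hA : IsCompact A) (hB : IsCompact B) : IsCompact (nSet w A B) := by
  refine IsCompact.image ?_ (by fun_prop)
  have : {z : EuclideanSpace ℝ (Fin n) × EuclideanSpace ℝ (Fin n) |
      z.1 ∈ A ∧ z.2 ∈ B ∧ z.1 - z.2 = (inner ℝ w (z.1 - z.2)) • w} =
      (A ×ˢ B) ∩ {z | z.1 - z.2 = (inner ℝ w (z.1 - z.2)) • w} := by
    ext z; simp [Set.mem_prod, and_assoc]
  rw [this]
  exact (hA.prod hB).inter_right (isClosed_eq (by fun_prop) (by fun_prop))

theorem nSet_convex {n : ℕ} {w : EuclideanSpace ℝ (Fin n)} {A B : Set (EuclideanSpace ℝ (Fin n))}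
    (hA : Convex ℝ A) (hB : Convex ℝ B) : Convex ℝ (nSet w A B) := by
  rintro _ ⟨⟨p, q⟩, ⟨hp, hq, h⟩, rfl⟩ _ ⟨⟨p', q'⟩, ⟨hp', hq', h'⟩, rfl⟩ a b ha hb hab
  refine ⟨(a • p + b • p', a • q + b • q'), ⟨hA hp hp' ha hb hab, hB hq hq' ha hb hab, ?_⟩, ?_⟩
  · simp only at h h' ⊢
    have e : a • p + b • p' - (a • q + b • q') = a • (p - q) + b • (p' - q') := by module
    rw [e, inner_add_right, inner_smul_right, inner_smul_right, add_smul, mul_smul, mul_smul, ← h, ← h']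
  · simp only [inner_add_right, inner_smul_right]
    module

theorem nSet_mono {n : ℕ} {w : EuclideanSpace ℝ (Fin n)} {A B A' B' : Set (EuclideanSpace ℝ (Fin n))}
    (hA : A ⊆ A') (hB : B ⊆ B') : nSet w A B ⊆ nSet w A' B' :=
  Set.image_mono fun _ hz => ⟨hA hz.1, hB hz.2.1, hz.2.2⟩

theorem interval_diff {I J : Set ℝ} (hI : IsCompact I) (hJ : IsCompact J) (hIc : Convex ℝ I)
    (hJc : Convex ℝ J) (hIn : I.Nonempty) (hJn : J.Nonempty) :
    volume {s : ℝ | ∃ σ ∈ I, ∃ τ ∈ J, s = (σ - τ) / 2} = 2⁻¹ * (volume I + volume J) := by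
  have h1 := eq_Icc_of_connected_compact ⟨hIn, hIc.isPreconnected⟩ hI
  have h2 := eq_Icc_of_connected_compact ⟨hJn, hJc.isPreconnected⟩ hJ
  set a := sInf I
  set b := sSup I
  set c := sInf J
  set e := sSup J
  have hab : a ≤ b := by rw [h1] at hIn; exact Set.nonempty_Icc.1 hIn
  have hce : c ≤ e := by rw [h2] at hJn; exact Set.nonempty_Icc.1 hJn
  have : {s : ℝ | ∃ σ ∈ I, ∃ τ ∈ J, s = (σ - τ) / 2} = Set.Icc ((a - e) / 2) ((b - c) / 2) := by
    ext s
    rw [h1, h2]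
    constructor
    · rintro ⟨σ, hσ, τ, hτ, rfl⟩
      exact ⟨by linarith [hσ.1, hτ.2], by linarith [hσ.2, hτ.1]⟩
    · rintro ⟨hs1, hs2⟩
      by_cases hs : 2 * s + c ≤ a
      · exact ⟨a, ⟨le_rfl, hab⟩, a - 2 * s, ⟨by linarith, by linarith⟩, by ring⟩
      · push Not at hs
        exact ⟨2 * s + c, ⟨hs.le, by linarith⟩, c, ⟨le_rfl, hce⟩, by ring⟩
  rw [this, h1, h2, Real.volume_Icc, Real.volume_Icc, Real.volume_Icc,
    ← ENNReal.ofReal_add (by linarith) (by linarith), show (2:ENNReal)⁻¹ = ENNReal.ofReal (1/2) by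
      rw [one_div, ENNReal.ofReal_inv_of_pos (by norm_num)]; simp, ← ENNReal.ofReal_mul (by norm_num)]
  congr 1; ring

theorem nSet_fibre {n : ℕ} {w : EuclideanSpace ℝ (Fin (n + 1))} (hw : ‖w‖ = 1)
    {J : EuclideanSpace ℝ (Fin n) →ₗ[ℝ] EuclideanSpace ℝ (Fin (n + 1))}
    (h1 : ∀ (s : ℝ) y, ‖s • w + J y‖ ^ 2 = s ^ 2 + ‖y‖ ^ 2)
    (h2 : ∀ x, ∃ (s : ℝ), ∃ y, s • w + J y = x)
    (h3 : ∀ y, inner ℝ w (J y) = 0)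
    (A B : Set (EuclideanSpace ℝ (Fin (n + 1)))) (y : EuclideanSpace ℝ (Fin n)) :
    {s : ℝ | s • w + J y ∈ nSet w A B} =
      {s : ℝ | ∃ σ ∈ {s : ℝ | s • w + J y ∈ A}, ∃ τ ∈ {s : ℝ | s • w + J y ∈ B}, s = (σ - τ) / 2} := by
  have hww : inner ℝ w w = (1 : ℝ) := by rw [real_inner_self_eq_norm_sq, hw]; norm_num
  have hin : ∀ (s : ℝ) y, inner ℝ w (s • w + J y) = s := by
    intro s y; rw [inner_add_right, inner_smul_right, hww, h3]; ring
  have hinj : ∀ (s s' : ℝ) y y', s • w + J y = s' • w + J y' → s = s' ∧ y = y' := by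
    intro s s' y y' h
    have e1 : s = s' := by rw [← hin s y, h, hin]
    refine ⟨e1, ?_⟩
    subst e1
    have e2 : (0:ℝ) • w + J (y - y') = 0 := by
      rw [map_sub, add_left_cancel h]; simp
    have := h1 0 (y - y')
    rw [e2] at this
    have : ‖y - y'‖ = 0 := by simpa using this.symm
    rwa [norm_sub_eq_zero_iff] at this
  ext s
  constructor
  · rintro ⟨⟨p, q⟩, ⟨hp, hq, h⟩, hs⟩
    obtain ⟨σ, y1, rfl⟩ := h2 p
    obtain ⟨τ, y2, rfl⟩ := h2 q
    simp only at hp hq h hs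
    have e : σ • w + J y1 - (τ • w + J y2) = (σ - τ) • w + J (y1 - y2) := by
      rw [map_sub]; module
    rw [e, hin] at h
    have h' : (σ - τ) • w + J (y1 - y2) = (σ - τ) • w + J 0 := by rw [h]; simp
    have hy := (hinj _ _ _ _ h').2
    have hy : y1 = y2 := sub_eq_zero.1 hy
    subst hy
    have e3 : (1 / 2 : ℝ) • (σ • w + J y1 + (τ • w + J y1)) - (inner ℝ w (τ • w + J y1)) • w =
        ((σ - τ) / 2) • w + J y1 := by
      rw [hin]; module
    rw [e3] at hs
    obtain ⟨rfl, rfl⟩ := hinj _ _ _ _ hs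
    exact ⟨σ, hp, τ, hq, rfl⟩
  · rintro ⟨σ, hσ, τ, hτ, rfl⟩
    refine ⟨(σ • w + J y, τ • w + J y), ⟨hσ, hτ, ?_⟩, ?_⟩
    · have e : σ • w + J y - (τ • w + J y) = (σ - τ) • w + J 0 := by
        rw [map_zero]; module
      simp only
      rw [e, hin, map_zero, add_zero]
    · simp only
      rw [hin]; module

theorem fibre_compact {n : ℕ} {w : EuclideanSpace ℝ (Fin (n + 1))} (hw : ‖w‖ = 1)
    {A : Set (EuclideanSpace ℝ (Fin (n + 1)))} (hA : IsCompact A) (v : EuclideanSpace ℝ (Fin (n + 1))) :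
    IsCompact {s : ℝ | s • w + v ∈ A} := by
  have hi : Isometry (fun s : ℝ => s • w + v) := by
    refine Isometry.of_dist_eq fun s t => ?_
    rw [dist_add_right, dist_eq_norm, ← sub_smul, norm_smul, hw, mul_one, Real.dist_eq, Real.norm_eq_abs]
  exact hi.isClosedEmbedding.isCompact_preimage hA

theorem fibre_convex {n : ℕ} {w : EuclideanSpace ℝ (Fin (n + 1))}
    {A : Set (EuclideanSpace ℝ (Fin (n + 1)))} (hA : Convex ℝ A) (v : EuclideanSpace ℝ (Fin (n + 1))) :
    Convex ℝ {s : ℝ | s • w + v ∈ A} := by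
  intro s hs t ht a b ha hb hab
  have := hA hs ht ha hb hab
  show (a • s + b • t) • w + v ∈ A
  convert this using 1
  have : v = (a + b) • v := by rw [hab, one_smul]
  nth_rw 1 [this]
  simp only [smul_eq_mul]
  module

theorem nSet_volume_le {n : ℕ} {w : EuclideanSpace ℝ (Fin (n + 1))} (hw : ‖w‖ = 1)
    {A B : Set (EuclideanSpace ℝ (Fin (n + 1)))} (hA : IsCompact A) (hB : IsCompact B)
    (hAc : Convex ℝ A) (hBc : Convex ℝ B) :
    volume (nSet w A B) ≤ 2⁻¹ * (volume A + volume B) := by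
  obtain ⟨J, h1, h2, h3, hmp⟩ := exists_split w hw
  have hJ : Continuous J := J.continuous_of_finiteDimensional
  have hmeas : ∀ C : Set (EuclideanSpace ℝ (Fin (n + 1))), MeasurableSet C →
      Measurable (fun y => volume {s : ℝ | s • w + J y ∈ C}) := fun C hC =>
    measurable_measure_prodMk_right (hmp.measurable hC)
  rw [fubini_split hmp (nSet_compact hA hB).measurableSet, fubini_split hmp hA.measurableSet,
    fubini_split hmp hB.measurableSet, ← lintegral_add_left (hmeas A hA.measurableSet),
    ← lintegral_const_mul' _ _ (by norm_num)]
  refine lintegral_mono fun y => ?_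
  simp only
  rw [nSet_fibre hw h1 h2 h3]
  by_cases hne : {s : ℝ | s • w + J y ∈ A}.Nonempty ∧ {s : ℝ | s • w + J y ∈ B}.Nonempty
  · rw [interval_diff (fibre_compact hw hA _) (fibre_compact hw hB _) (fibre_convex hAc _)
      (fibre_convex hBc _) hne.1 hne.2]
  · have : {s : ℝ | ∃ σ ∈ {s : ℝ | s • w + J y ∈ A}, ∃ τ ∈ {s : ℝ | s • w + J y ∈ B}, s = (σ - τ) / 2} = ∅ := by
      rw [Set.eq_empty_iff_forall_notMem]
      rintro s ⟨σ, hσ, τ, hτ, _⟩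
      exact hne ⟨⟨σ, hσ⟩, ⟨τ, hτ⟩⟩
    rw [this]; simp

theorem nSet_volume_self {n : ℕ} {w : EuclideanSpace ℝ (Fin (n + 1))} (hw : ‖w‖ = 1)
    {A : Set (EuclideanSpace ℝ (Fin (n + 1)))} (hA : IsCompact A)
    (hAc : Convex ℝ A) :
    volume A ≤ volume (nSet w A A) := by
  obtain ⟨J, h1, h2, h3, hmp⟩ := exists_split w hw
  rw [fubini_split hmp (nSet_compact hA hA).measurableSet, fubini_split hmp hA.measurableSet]
  refine lintegral_mono fun y => ?_
  simp only
  rw [nSet_fibre hw h1 h2 h3]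
  by_cases hne : {s : ℝ | s • w + J y ∈ A}.Nonempty
  · rw [interval_diff (fibre_compact hw hA _) (fibre_compact hw hA _) (fibre_convex hAc _)
      (fibre_convex hAc _) hne hne, ← two_mul, ← mul_assoc, ENNReal.inv_mul_cancel (by norm_num) (by norm_num),
      one_mul]
  · rw [Set.not_nonempty_iff_eq_empty.1 hne]; simp

/-- All the central symmetrals have volume at most `c`. -/
def PBound {n : ℕ} (K : Set (EuclideanSpace ℝ (Fin n))) (c : ENNReal) : Prop :=
  ∀ a ∈ K, volume (convexHull ℝ (K ∪ reflAbout a K)) ≤ c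

theorem PBound.nSet {n : ℕ} {w : EuclideanSpace ℝ (Fin (n + 1))} (hw : ‖w‖ = 1)
    {K : Set (EuclideanSpace ℝ (Fin (n + 1)))} (hKc : IsCompact K) (hK : Convex ℝ K) {c : ENNReal}
    (hP : PBound K c) : PBound (nSet w K K) c := by
  rintro _ ⟨⟨a, b⟩, ⟨ha, hb, hab⟩, rfl⟩
  simp only at ha hb hab ⊢
  have hne : K.Nonempty := ⟨a, ha⟩
  have hsub : convexHull ℝ (_root_.nSet w K K ∪
      reflAbout ((1 / 2 : ℝ) • (a + b) - (inner ℝ w b) • w) (_root_.nSet w K K)) ⊆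
      _root_.nSet w (convexHull ℝ (K ∪ reflAbout a K)) (convexHull ℝ (K ∪ reflAbout b K)) := by
    refine convexHull_min (Set.union_subset ?_ ?_) (nSet_convex (convex_convexHull _ _) (convex_convexHull _ _))
    · exact nSet_mono (Set.subset_union_left.trans (subset_convexHull _ _))
        (Set.subset_union_left.trans (subset_convexHull _ _))
    · rintro _ ⟨_, ⟨⟨p, q⟩, ⟨hp, hq, hpq⟩, rfl⟩, rfl⟩
      simp only at hp hq hpq ⊢
      refine ⟨((2:ℝ) • a - p, (2:ℝ) • b - q), ⟨subset_convexHull _ _ (Or.inr ⟨p, hp, rfl⟩),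
        subset_convexHull _ _ (Or.inr ⟨q, hq, rfl⟩), ?_⟩, ?_⟩
      · simp only
        have e : (2:ℝ) • a - p - ((2:ℝ) • b - q) = (2:ℝ) • (a - b) - (p - q) := by module
        rw [e, inner_sub_right, inner_smul_right, sub_smul, mul_smul, ← hab, ← hpq]
      · simp only [inner_sub_right, inner_smul_right]
        module
  refine (measure_mono hsub).trans ((nSet_volume_le hw (isCompact_hull hKc hK hne a)
    (isCompact_hull hKc hK hne b) (convex_convexHull _ _) (convex_convexHull _ _)).trans ?_)
  calc _ ≤ 2⁻¹ * (c + c) := by gcongr; exacts [hP a ha, hP b hb]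
    _ = c := by rw [← two_mul, ← mul_assoc, ENNReal.inv_mul_cancel (by norm_num) (by norm_num), one_mul]

theorem nSet_spread {n : ℕ} {w : EuclideanSpace ℝ (Fin n)} (hw : ‖w‖ = 1)
    {C : Set (EuclideanSpace ℝ (Fin n))} (hC : C ⊆ Metric.closedBall 0 1)
    {z : EuclideanSpace ℝ (Fin n)} (hz : z ∈ nSet w C C) (hz1 : ‖z‖ = 1) :
    z ∈ C ∧ z - (2 * inner ℝ w z) • w ∈ C := by
  obtain ⟨⟨p, q⟩, ⟨hp, hq, h⟩, rfl⟩ := hz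
  simp only at hp hq h hz1 ⊢
  have hww : inner ℝ w w = (1 : ℝ) := by rw [real_inner_self_eq_norm_sq, hw]; norm_num
  have hp1 : ‖p‖ ≤ 1 := by simpa using hC hp
  have hq1 : ‖q‖ ≤ 1 := by simpa using hC hq
  set q' := q - (2 * inner ℝ w q) • w with hq'
  have hwq' : inner ℝ w q' = - inner ℝ w q := by
    rw [hq', inner_sub_right, inner_smul_right, hww]; ring
  have hq'n : ‖q'‖ ^ 2 = ‖q‖ ^ 2 := by
    rw [hq', ← real_inner_self_eq_norm_sq, ← real_inner_self_eq_norm_sq, inner_sub_left, inner_sub_right,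
      inner_sub_right, inner_smul_left, inner_smul_right, inner_smul_right, inner_smul_left, hww,
      real_inner_comm w q]
    simp; ring
  have e : (1 / 2 : ℝ) • (p + q) - (inner ℝ w q) • w = (1 / 2 : ℝ) • (p + q') := by
    rw [hq']; module
  rw [e] at hz1 ⊢
  have hs : ‖p + q'‖ = 2 := by
    rw [norm_smul] at hz1
    norm_num at hz1
    linarith
  have hpar := parallelogram_law_with_norm ℝ p q'
  have hd : ‖p - q'‖ = 0 := by
    rw [hs] at hpar
    have : ‖p - q'‖ * ‖p - q'‖ ≤ 0 := by nlinarith [norm_nonneg p, norm_nonneg q]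
    nlinarith [norm_nonneg (p - q')]
  have hpq : p = q' := by rwa [norm_sub_eq_zero_iff] at hd
  have e2 : (1 / 2 : ℝ) • (p + q') = q' := by rw [hpq]; module
  rw [e2]
  refine ⟨hpq ▸ hp, ?_⟩
  rw [hwq']
  have : q' - (2 * -inner ℝ w q) • w = q := by rw [hq']; module
  rw [this]; exact hq

theorem nSet_ball {n : ℕ} {w : EuclideanSpace ℝ (Fin n)} (hw : ‖w‖ = 1)
    {C : Set (EuclideanSpace ℝ (Fin n))} (hC : C ⊆ Metric.closedBall 0 1) :
    nSet w C C ⊆ Metric.closedBall 0 1 := by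
  rintro _ ⟨⟨p, q⟩, ⟨hp, hq, h⟩, rfl⟩
  simp only at hp hq h ⊢
  have hww : inner ℝ w w = (1 : ℝ) := by rw [real_inner_self_eq_norm_sq, hw]; norm_num
  have hp1 : ‖p‖ ≤ 1 := by simpa using hC hp
  have hq1 : ‖q‖ ≤ 1 := by simpa using hC hq
  set q' := q - (2 * inner ℝ w q) • w with hq'
  have hq'n : ‖q'‖ ^ 2 = ‖q‖ ^ 2 := by
    rw [hq', ← real_inner_self_eq_norm_sq, ← real_inner_self_eq_norm_sq, inner_sub_left, inner_sub_right,
      inner_sub_right, inner_smul_left, inner_smul_right, inner_smul_right, inner_smul_left, hww,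
      real_inner_comm w q]
    simp; ring
  have hq'1 : ‖q'‖ ≤ 1 := by
    have : ‖q'‖ = ‖q‖ := by
      rwa [sq_eq_sq₀ (norm_nonneg _) (norm_nonneg _)] at hq'n
    rw [this]; exact hq1
  have e : (1 / 2 : ℝ) • (p + q) - (inner ℝ w q) • w = (1 / 2 : ℝ) • (p + q') := by
    rw [hq']; module
  rw [e, mem_closedBall_zero_iff, norm_smul]
  have := norm_add_le p q'
  norm_num
  linarith

theorem nSet_smul {n : ℕ} {w : EuclideanSpace ℝ (Fin n)} (r : ℝ)
    (A B : Set (EuclideanSpace ℝ (Fin n))) : r • nSet w A B ⊆ nSet w (r • A) (r • B) := by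
  rintro _ ⟨_, ⟨⟨p, q⟩, ⟨hp, hq, h⟩, rfl⟩, rfl⟩
  simp only at hp hq h ⊢
  refine ⟨(r • p, r • q), ⟨Set.smul_mem_smul_set hp, Set.smul_mem_smul_set hq, ?_⟩, ?_⟩
  · simp only
    rw [← smul_sub, inner_smul_right, mul_smul, ← h]
  · simp only [inner_smul_right]; module

/-- Iterated Steiner symmetrization. -/
def steiner {n : ℕ} (W : List (EuclideanSpace ℝ (Fin n))) (K : Set (EuclideanSpace ℝ (Fin n))) :
    Set (EuclideanSpace ℝ (Fin n)) :=
  W.foldr (fun w K => nSet w K K) K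

theorem steiner_smul {n : ℕ} (W : List (EuclideanSpace ℝ (Fin n))) (r : ℝ)
    (K : Set (EuclideanSpace ℝ (Fin n))) : r • steiner W K ⊆ steiner W (r • K) := by
  induction W with
  | nil => exact subset_rfl
  | cons w W ih => exact (nSet_smul r _ _).trans (nSet_mono ih ih)

theorem steiner_mono {n : ℕ} (W : List (EuclideanSpace ℝ (Fin n)))
    {K K' : Set (EuclideanSpace ℝ (Fin n))} (h : K ⊆ K') : steiner W K ⊆ steiner W K' := by
  induction W with
  | nil => exact h
  | cons w W ih => exact nSet_mono ih ih

theorem steiner_compact {n : ℕ} (W : List (EuclideanSpace ℝ (Fin n)))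
    {K : Set (EuclideanSpace ℝ (Fin n))} (h : IsCompact K) : IsCompact (steiner W K) := by
  induction W with
  | nil => exact h
  | cons w W ih => exact nSet_compact ih ih

theorem steiner_ball {n : ℕ} {W : List (EuclideanSpace ℝ (Fin n))} (hW : ∀ w ∈ W, ‖w‖ = 1)
    {K : Set (EuclideanSpace ℝ (Fin n))} (h : K ⊆ Metric.closedBall 0 1) :
    steiner W K ⊆ Metric.closedBall 0 1 := by
  induction W with
  | nil => exact h
  | cons w W ih =>
    exact nSet_ball (hW w (by simp)) (ih fun w hw => hW w (by simp [hw]))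

theorem steiner_spread {n : ℕ} {W : List (EuclideanSpace ℝ (Fin n))} (hW : ∀ w ∈ W, ‖w‖ = 1)
    {K : Set (EuclideanSpace ℝ (Fin n))} (h : K ⊆ Metric.closedBall 0 1)
    {z : EuclideanSpace ℝ (Fin n)} (hz : z ∈ steiner W K) (hz1 : ‖z‖ = 1) :
    z ∈ K ∧ ∀ w ∈ W, z - (2 * inner ℝ w z) • w ∈ K := by
  induction W generalizing z with
  | nil => exact ⟨hz, by simp⟩
  | cons w W ih =>
    have hW' : ∀ w ∈ W, ‖w‖ = 1 := fun w hw => hW w (by simp [hw])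
    have hw1 : ‖w‖ = 1 := hW w (by simp)
    have hs := nSet_spread hw1 (steiner_ball hW' h) hz hz1
    have h1 := ih hW' hs.1 hz1
    have hn : ‖z - (2 * inner ℝ w z) • w‖ = 1 := by
      have hww : inner ℝ w w = (1 : ℝ) := by rw [real_inner_self_eq_norm_sq, hw1]; norm_num
      have : ‖z - (2 * inner ℝ w z) • w‖ ^ 2 = ‖z‖ ^ 2 := by
        rw [← real_inner_self_eq_norm_sq, ← real_inner_self_eq_norm_sq, inner_sub_left, inner_sub_right,
          inner_sub_right, inner_smul_left, inner_smul_right, inner_smul_right, inner_smul_left, hww,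
          real_inner_comm w z]
        simp; ring
      rw [sq_eq_sq₀ (norm_nonneg _) (norm_nonneg _)] at this
      rw [this, hz1]
    have h2 := ih hW' hs.2 hn
    refine ⟨h1.1, ?_⟩
    intro w' hw'
    rcases List.mem_cons.1 hw' with rfl | hw'
    · exact h2.1
    · exact h1.2 w' hw'

/-- The part of the unit ball below a hyperplane. -/
def capSet {n : ℕ} (u : EuclideanSpace ℝ (Fin n)) (κ : ℝ) : Set (EuclideanSpace ℝ (Fin n)) :=
  {x | ‖x‖ ≤ 1 ∧ inner ℝ u x ≤ κ}

theorem capSet_ball {n : ℕ} (u : EuclideanSpace ℝ (Fin n)) (κ : ℝ) :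
    capSet u κ ⊆ Metric.closedBall 0 1 := fun x hx => by simpa using hx.1

theorem capSet_compact {n : ℕ} (u : EuclideanSpace ℝ (Fin n)) (κ : ℝ) : IsCompact (capSet u κ) := by
  have : capSet u κ = Metric.closedBall 0 1 ∩ {x | inner ℝ u x ≤ κ} := by
    ext x; simp [capSet]
  rw [this]
  exact (isCompact_closedBall _ _).inter_right (isClosed_le (by fun_prop) (by fun_prop))

theorem cap_cover {n : ℕ} {u : EuclideanSpace ℝ (Fin n)} (hu : ‖u‖ = 1) {κ : ℝ} (hκ : κ < 1) :
    ∃ W : List (EuclideanSpace ℝ (Fin n)), (∀ w ∈ W, ‖w‖ = 1) ∧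
      ∀ z : EuclideanSpace ℝ (Fin n), ‖z‖ = 1 →
        z ∉ capSet u κ ∨ ∃ w ∈ W, z - (2 * inner ℝ w z) • w ∉ capSet u κ := by
  have hcomp : IsCompact (Metric.sphere (0 : EuclideanSpace ℝ (Fin n)) 1) := isCompact_sphere _ _
  have huu : inner ℝ u u = (1 : ℝ) := by rw [real_inner_self_eq_norm_sq, hu]; norm_num
  have key : ∃ W : List (EuclideanSpace ℝ (Fin n)), (∀ w ∈ W, ‖w‖ = 1) ∧
      ∀ z ∈ Metric.sphere (0 : EuclideanSpace ℝ (Fin n)) 1,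
        z ∉ capSet u κ ∨ ∃ w ∈ W, z - (2 * inner ℝ w z) • w ∉ capSet u κ := by
    refine hcomp.induction_on (p := fun s => ∃ W : List (EuclideanSpace ℝ (Fin n)), (∀ w ∈ W, ‖w‖ = 1) ∧
      ∀ z ∈ s, z ∉ capSet u κ ∨ ∃ w ∈ W, z - (2 * inner ℝ w z) • w ∉ capSet u κ) ?_ ?_ ?_ ?_
    · exact ⟨[], by simp, by simp⟩
    · rintro s t hst ⟨W, hW, h⟩
      exact ⟨W, hW, fun z hz => h z (hst hz)⟩
    · rintro s t ⟨W, hW, h⟩ ⟨W', hW', h'⟩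
      refine ⟨W ++ W', ?_, ?_⟩
      · intro w hw
        rcases List.mem_append.1 hw with hw | hw
        exacts [hW w hw, hW' w hw]
      · rintro z (hz | hz)
        · refine (h z hz).imp_right ?_
          rintro ⟨w, hw, hh⟩; exact ⟨w, List.mem_append_left _ hw, hh⟩
        · refine (h' z hz).imp_right ?_
          rintro ⟨w, hw, hh⟩; exact ⟨w, List.mem_append_right _ hw, hh⟩
    · intro z hz
      have hz1 : ‖z‖ = 1 := by simpa using hz
      by_cases hzu : z = u
      · refine ⟨{x | κ < inner ℝ u x}, mem_nhdsWithin_of_mem_nhds ?_, [], by simp, ?_⟩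
        · refine (isOpen_lt (by fun_prop) (by fun_prop)).mem_nhds ?_
          show κ < inner ℝ u z
          rw [hzu, huu]; exact hκ
        · intro x hx
          left; intro hc; exact absurd hc.2 (not_le.2 hx)
      · have hne : ‖z - u‖ ≠ 0 := by rw [norm_ne_zero_iff]; exact sub_ne_zero.2 hzu
        set w := ‖z - u‖⁻¹ • (z - u) with hw
        have hw1 : ‖w‖ = 1 := by
          rw [hw, norm_smul, norm_inv, norm_norm, inv_mul_cancel₀ hne]
        refine ⟨{x | κ < inner ℝ u (x - (2 * inner ℝ w x) • w)}, mem_nhdsWithin_of_mem_nhds ?_, [w],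
          by simpa using hw1, ?_⟩
        · refine (isOpen_lt (by fun_prop) (by fun_prop)).mem_nhds ?_
          show κ < inner ℝ u (z - (2 * inner ℝ w z) • w)
          have : z - (2 * inner ℝ w z) • w = u := by
            have h1 : 2 * inner ℝ (z - u) z = ‖z - u‖ ^ 2 := by
              rw [norm_sub_sq_real, inner_sub_left, real_inner_self_eq_norm_sq, hz1, hu, real_inner_comm]
              ring
            rw [hw, inner_smul_left, smul_smul]
            have h2 : 2 * ((starRingEnd ℝ) ‖z - u‖⁻¹ * inner ℝ (z - u) z) * ‖z - u‖⁻¹ = 1 := by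
              have : 2 * ((starRingEnd ℝ) ‖z - u‖⁻¹ * inner ℝ (z - u) z) * ‖z - u‖⁻¹ =
                (2 * inner ℝ (z - u) z) * (‖z - u‖⁻¹ * ‖z - u‖⁻¹) := by simp; ring
              rw [this, h1]; field_simp
            rw [h2]; module
          rw [this, huu]; exact hκ
        · intro x hx
          right
          exact ⟨w, by simp, fun hc => absurd hc.2 (not_le.2 hx)⟩
  obtain ⟨W, hW, h⟩ := key
  exact ⟨W, hW, fun z hz => h z (by simpa using hz)⟩

theorem cap_shrink {n : ℕ} {u : EuclideanSpace ℝ (Fin n)} (hu : ‖u‖ = 1) {κ : ℝ} (hκ : κ < 1) :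
    ∃ κ' : ℝ, 0 ≤ κ' ∧ κ' < 1 ∧ ∃ W : List (EuclideanSpace ℝ (Fin n)), (∀ w ∈ W, ‖w‖ = 1) ∧
      steiner W (capSet u κ) ⊆ Metric.closedBall 0 κ' := by
  obtain ⟨W, hW, h⟩ := cap_cover hu hκ
  have hc := steiner_compact W (capSet_compact u κ)
  rcases Set.eq_empty_or_nonempty (steiner W (capSet u κ)) with he | hne
  · exact ⟨0, le_rfl, by norm_num, W, hW, by rw [he]; simp⟩
  obtain ⟨z, hz, hmax⟩ := hc.exists_isMaxOn hne continuous_norm.continuousOn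
  refine ⟨‖z‖, norm_nonneg _, ?_, W, hW, fun x hx => by simpa using hmax hx⟩
  have hz1 : ‖z‖ ≤ 1 := by simpa using steiner_ball hW (capSet_ball u κ) hz
  refine lt_of_le_of_ne hz1 fun hz1 => ?_
  have hs := steiner_spread hW (capSet_ball u κ) hz hz1
  rcases h z hz1 with h | ⟨w, hw, h⟩
  · exact h hs.1
  · exact h (hs.2 w hw)

theorem cap_uniform {n : ℕ} {κ : ℝ} (hκ : κ < 1) :
    ∃ κ' : ℝ, 0 ≤ κ' ∧ κ' < 1 ∧ ∀ u : EuclideanSpace ℝ (Fin n), ‖u‖ = 1 →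
      ∃ W : List (EuclideanSpace ℝ (Fin n)), (∀ w ∈ W, ‖w‖ = 1) ∧
      steiner W (capSet u κ) ⊆ Metric.closedBall 0 κ' := by
  have hcomp : IsCompact (Metric.sphere (0 : EuclideanSpace ℝ (Fin n)) 1) := isCompact_sphere _ _
  have key : ∃ κ' : ℝ, 0 ≤ κ' ∧ κ' < 1 ∧ ∀ u ∈ Metric.sphere (0 : EuclideanSpace ℝ (Fin n)) 1,
      ∃ W : List (EuclideanSpace ℝ (Fin n)), (∀ w ∈ W, ‖w‖ = 1) ∧
      steiner W (capSet u κ) ⊆ Metric.closedBall 0 κ' := by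
    refine hcomp.induction_on (p := fun s => ∃ κ' : ℝ, 0 ≤ κ' ∧ κ' < 1 ∧ ∀ u ∈ s,
      ∃ W : List (EuclideanSpace ℝ (Fin n)), (∀ w ∈ W, ‖w‖ = 1) ∧
      steiner W (capSet u κ) ⊆ Metric.closedBall 0 κ') ?_ ?_ ?_ ?_
    · exact ⟨0, le_rfl, by norm_num, by simp⟩
    · rintro s t hst ⟨k, h0, h1, h⟩
      exact ⟨k, h0, h1, fun u hu => h u (hst hu)⟩
    · rintro s t ⟨k, h0, h1, h⟩ ⟨k', h0', h1', h'⟩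
      refine ⟨max k k', le_max_of_le_left h0, max_lt h1 h1', ?_⟩
      rintro u (hu | hu)
      · obtain ⟨W, hW, hh⟩ := h u hu
        exact ⟨W, hW, hh.trans (Metric.closedBall_subset_closedBall (le_max_left _ _))⟩
      · obtain ⟨W, hW, hh⟩ := h' u hu
        exact ⟨W, hW, hh.trans (Metric.closedBall_subset_closedBall (le_max_right _ _))⟩
    · intro u hu
      obtain ⟨k, h0, h1, W, hW, h⟩ := cap_shrink (u := u) (by simpa using hu) (κ := (κ + 1) / 2) (by linarith)
      refine ⟨Metric.ball u ((1 - κ) / 2), mem_nhdsWithin_of_mem_nhds (Metric.ball_mem_nhds _ (by linarith)),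
        k, h0, h1, fun u' hu' => ⟨W, hW, (steiner_mono W ?_).trans h⟩⟩
      rintro x ⟨hx1, hx2⟩
      refine ⟨hx1, ?_⟩
      have e : inner ℝ u x = inner ℝ u' x - inner ℝ (u' - u) x := by rw [inner_sub_left]; ring
      have e2 := abs_real_inner_le_norm (u' - u) x
      have e3 : ‖u' - u‖ < (1 - κ) / 2 := by rw [← dist_eq_norm]; exact hu'
      have e4 := (abs_le.1 e2).1
      have e5 : ‖u' - u‖ * ‖x‖ ≤ ‖u' - u‖ := mul_le_of_le_one_right (norm_nonneg _) hx1
      rw [e]; linarith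
  obtain ⟨k, h0, h1, h⟩ := key
  exact ⟨k, h0, h1, fun u hu => h u (by simpa using hu)⟩

/-- The class of competitors in the symmetrization argument. -/
def Compet {n : ℕ} (V c : ENNReal) (L : Set (EuclideanSpace ℝ (Fin n))) : Prop :=
  IsCompact L ∧ Convex ℝ L ∧ V ≤ volume L ∧ PBound L c

theorem Compet.steiner {n : ℕ} {V c : ENNReal} {L : Set (EuclideanSpace ℝ (Fin (n + 1)))}
    (hL : Compet V c L) {W : List (EuclideanSpace ℝ (Fin (n + 1)))} (hW : ∀ w ∈ W, ‖w‖ = 1) :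
    Compet V c (steiner W L) := by
  induction W with
  | nil => exact hL
  | cons w W ih =>
    obtain ⟨h1, h2, h3, h4⟩ := ih fun w hw => hW w (by simp [hw])
    have hw := hW w (by simp)
    exact ⟨nSet_compact h1 h1, nSet_convex h2 h2, h3.trans (nSet_volume_self hw h1 h2),
      PBound.nSet hw h1 h2 h4⟩

theorem exists_halfspace {n : ℕ} {L : Set (EuclideanSpace ℝ (Fin n))} (hL : IsCompact L)
    (hLc : Convex ℝ L) (hne : L.Nonempty) {r : ℝ} (h : ¬ Metric.closedBall 0 r ⊆ L) :
    ∃ u : EuclideanSpace ℝ (Fin n), ‖u‖ = 1 ∧ ∀ x ∈ L, inner ℝ u x ≤ r := by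
  obtain ⟨x, hx, hxL⟩ := Set.not_subset.1 h
  obtain ⟨f, s, hf, hs⟩ := geometric_hahn_banach_closed_point hLc hL.isClosed hxL
  set v := (InnerProductSpace.toDual ℝ (EuclideanSpace ℝ (Fin n))).symm f with hv
  have hvf : ∀ y, inner ℝ v y = f y := fun y => InnerProductSpace.toDual_symm_apply
  have hv0 : ‖v‖ ≠ 0 := by
    rw [norm_ne_zero_iff]
    intro h0
    obtain ⟨y, hy⟩ := hne
    have h1 := (hf y hy).trans hs
    rw [← hvf, ← hvf, h0] at h1
    simp at h1
  refine ⟨‖v‖⁻¹ • v, by rw [norm_smul, norm_inv, norm_norm, inv_mul_cancel₀ hv0], fun y hy => ?_⟩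
  have h1 := (hf y hy).trans hs
  rw [← hvf, ← hvf] at h1
  have h2 := real_inner_le_norm v x
  have h3 : ‖x‖ ≤ r := by simpa using hx
  have hpos : 0 < ‖v‖ := lt_of_le_of_ne (norm_nonneg _) (Ne.symm hv0)
  rw [inner_smul_left]
  simp only [conj_trivial]
  rw [inv_mul_le_iff₀ hpos]
  have : ‖v‖ * ‖x‖ ≤ ‖v‖ * r := by gcongr
  linarith

theorem exists_compet_ball {n : ℕ} {V c : ENNReal} {K : Set (EuclideanSpace ℝ (Fin (n + 1)))}
    (hK : Compet V c K) {r0 r1 : ℝ} (hr0 : 0 < r0) (hr1 : r1 < r0)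
    (hV : V = volume (Metric.closedBall (0 : EuclideanSpace ℝ (Fin (n + 1))) r0)) :
    ∃ L : Set (EuclideanSpace ℝ (Fin (n + 1))), Compet V c L ∧ Metric.closedBall 0 r1 ⊆ L := by
  by_contra hcon
  push Not at hcon
  have hball : ∀ R : ℝ, 0 ≤ R → ∀ L : Set (EuclideanSpace ℝ (Fin (n + 1))), Compet V c L → L ⊆ Metric.closedBall 0 R → r0 ≤ R := by
    intro R hR L hL hLR
    by_contra hlt
    push Not at hlt
    have h1 := hL.2.2.1.trans (measure_mono hLR)
    rw [hV, Measure.addHaar_closedBall _ _ hr0.le, Measure.addHaar_closedBall _ _ hR] at h1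
    have hb0 : volume (Metric.ball (0 : EuclideanSpace ℝ (Fin (n + 1))) 1) ≠ 0 :=
      (Metric.measure_ball_pos _ _ one_pos).ne'
    have hbt : volume (Metric.ball (0 : EuclideanSpace ℝ (Fin (n + 1))) 1) ≠ ⊤ := measure_ball_lt_top.ne
    rw [ENNReal.mul_le_mul_iff_left hb0 hbt, ENNReal.ofReal_le_ofReal_iff (by positivity)] at h1
    have := pow_lt_pow_left₀ hlt hR (n := Module.finrank ℝ (EuclideanSpace ℝ (Fin (n + 1)))) (by simp)
    linarith
  have hVpos : V ≠ 0 := by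
    rw [hV]; exact (Metric.measure_closedBall_pos _ _ hr0).ne'
  obtain ⟨κ, hκ0, hκ1, hκ⟩ := cap_uniform (n := n + 1) (κ := max 0 (r1 / r0)) (max_lt (by norm_num) (by rwa [div_lt_one hr0]))
  have step : ∀ R : ℝ, 0 ≤ R → ∀ L : Set (EuclideanSpace ℝ (Fin (n + 1))), Compet V c L → L ⊆ Metric.closedBall 0 R →
      ∃ L' : Set (EuclideanSpace ℝ (Fin (n + 1))), Compet V c L' ∧ L' ⊆ Metric.closedBall 0 (κ * R) := by
    intro R hR L hL hLR
    have hRr := hball R hR L hL hLR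
    have hRp : 0 < R := by linarith
    have hne : L.Nonempty := by
      rw [Set.nonempty_iff_ne_empty]; rintro rfl
      have := hL.2.2.1
      simp at this; exact hVpos this
    obtain ⟨u, hu, hux⟩ := exists_halfspace hL.1 hL.2.1 hne (hcon L hL)
    obtain ⟨W, hW, hWs⟩ := hκ u hu
    refine ⟨_root_.steiner W L, hL.steiner hW, ?_⟩
    have hsub : R⁻¹ • L ⊆ capSet u (max 0 (r1 / r0)) := by
      rintro _ ⟨x, hx, rfl⟩
      constructor
      · have : ‖x‖ ≤ R := by simpa using hLR hx
        simp only
        rw [norm_smul, norm_inv, Real.norm_of_nonneg hR, inv_mul_le_iff₀ hRp]; linarith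
      · simp only
        rw [inner_smul_right, inv_mul_le_iff₀ hRp]
        have h1 := hux x hx
        have h2 : r0 * (r1 / r0) = r1 := by field_simp
        have h3 : r0 * (r1 / r0) ≤ r0 * max 0 (r1 / r0) := by gcongr; exact le_max_right _ _
        have h4 : r0 * max 0 (r1 / r0) ≤ R * max 0 (r1 / r0) := by
          gcongr
        linarith
    intro x hx
    have h1 : R⁻¹ • x ∈ Metric.closedBall (0 : EuclideanSpace ℝ (Fin (n + 1))) κ :=
      hWs (steiner_mono W hsub (steiner_smul W _ _ (Set.smul_mem_smul_set hx)))
    rw [mem_closedBall_zero_iff, norm_smul, norm_inv, Real.norm_of_nonneg hR, inv_mul_le_iff₀ hRp] at h1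
    rw [mem_closedBall_zero_iff]; linarith
  obtain ⟨R, hRp, hR⟩ := hK.1.isBounded.subset_closedBall_lt 0 0
  have iter : ∀ k : ℕ, ∃ L' : Set (EuclideanSpace ℝ (Fin (n + 1))), Compet V c L' ∧ L' ⊆ Metric.closedBall 0 (κ ^ k * R) := by
    intro k
    induction k with
    | zero => exact ⟨K, hK, by simpa using hR⟩
    | succ k ih =>
      obtain ⟨L, hL, hLR⟩ := ih
      obtain ⟨L', h1, h2⟩ := step _ (by positivity) L hL hLR
      exact ⟨L', h1, by rwa [pow_succ', mul_assoc]⟩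
  have ht : Filter.Tendsto (fun k : ℕ => κ ^ k * R) Filter.atTop (nhds 0) := by
    simpa using (tendsto_pow_atTop_nhds_zero_of_lt_one hκ0 hκ1).mul_const R
  obtain ⟨k, hk⟩ := (ht.eventually (gt_mem_nhds hr0)).exists
  obtain ⟨L, hL, hLR⟩ := iter k
  have := hball _ (by positivity) L hL hLR
  linarith

theorem ball_symmetral {n : ℕ} {c : ENNReal} {L : Set (EuclideanSpace ℝ (Fin (n + 1)))}
    (hLc : IsCompact L) (hL : Convex ℝ L) (hP : PBound L c) {r : ℝ} (hr : 0 < r)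
    (hB : Metric.closedBall 0 r ⊆ L) :
    volume (Metric.closedBall (0 : EuclideanSpace ℝ (Fin (n + 1))) r) +
      ENNReal.ofReal (2 * r) * volume (Metric.closedBall (0 : EuclideanSpace ℝ (Fin n)) r) ≤ c := by
  set w : EuclideanSpace ℝ (Fin (n + 1)) := EuclideanSpace.single 0 1 with hw
  have hw1 : ‖w‖ = 1 := by simp [hw]
  have ha : r • w ∈ L := hB (by simp [norm_smul, hw1, abs_of_pos hr])
  refine le_trans ?_ (hP _ ha)
  have hne : L.Nonempty := ⟨_, ha⟩
  have hMc := isCompact_hull hLc hL hne (r • w)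
  set M := convexHull ℝ (L ∪ reflAbout (r • w) L) with hM
  obtain ⟨J, h1, h2, h3, hmp⟩ := exists_split w hw1
  have hBm : MeasurableSet (Metric.closedBall (0 : EuclideanSpace ℝ (Fin (n + 1))) r) := measurableSet_closedBall
  have hBn : MeasurableSet (Metric.closedBall (0 : EuclideanSpace ℝ (Fin n)) r) := measurableSet_closedBall
  rw [fubini_split hmp hBm, fubini_split hmp hMc.measurableSet, ← lintegral_indicator_const hBn,
    ← lintegral_add_right _ (measurable_const.indicator hBn)]
  refine lintegral_mono fun y => ?_
  have hBM : Metric.closedBall 0 r ⊆ M := hB.trans (Set.subset_union_left.trans (subset_convexHull _ _))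
  by_cases hy : y ∈ Metric.closedBall (0 : EuclideanSpace ℝ (Fin n)) r
  · simp only [Set.indicator_of_mem hy]
    have hyr : ‖y‖ ≤ r := by simpa using hy
    set h := Real.sqrt (r ^ 2 - ‖y‖ ^ 2) with hh
    have hnn : 0 ≤ r ^ 2 - ‖y‖ ^ 2 := by nlinarith [norm_nonneg y]
    have hhn : 0 ≤ h := Real.sqrt_nonneg _
    have hhs : h ^ 2 = r ^ 2 - ‖y‖ ^ 2 := Real.sq_sqrt hnn
    have hBy : {s : ℝ | s • w + J y ∈ Metric.closedBall 0 r} = Set.Icc (-h) h := by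
      ext s
      show s • w + J y ∈ Metric.closedBall 0 r ↔ _
      rw [mem_closedBall_zero_iff, ← sq_le_sq₀ (norm_nonneg _) hr.le, h1, Set.mem_Icc, ← abs_le,
        ← sq_le_sq₀ (abs_nonneg _) hhn, sq_abs, hhs]
      constructor <;> intro _ <;> linarith
    have hMy : Set.Icc (-h) (h + 2 * r) ⊆ {s : ℝ | s • w + J y ∈ M} := by
      have hc : Convex ℝ {s : ℝ | s • w + J y ∈ M} := fibre_convex (convex_convexHull _ _) _
      refine hc.ordConnected.out ?_ ?_
      · have : -h ∈ {s : ℝ | s • w + J y ∈ Metric.closedBall 0 r} := by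
          rw [hBy]; exact ⟨le_rfl, by linarith⟩
        exact hBM this
      · have hmem : (-h) • w + J (-y) ∈ Metric.closedBall (0 : EuclideanSpace ℝ (Fin (n + 1))) r := by
          rw [mem_closedBall_zero_iff, ← sq_le_sq₀ (norm_nonneg _) hr.le, h1, norm_neg]
          nlinarith
        refine subset_convexHull _ _ (Or.inr ⟨_, hB hmem, ?_⟩)
        simp only [map_neg]; module
    rw [hBy]
    refine le_trans ?_ (measure_mono hMy)
    rw [Real.volume_Icc, Real.volume_Icc, ← ENNReal.ofReal_add (by linarith) (by linarith)]
    apply ENNReal.ofReal_le_ofReal; linarith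
  · simp only [Set.indicator_of_notMem hy, add_zero]
    exact measure_mono fun s hs => hBM hs

theorem unitBallVol_pos (n : ℕ) : 0 < unitBallVol n := by
  refine ENNReal.toReal_pos (Metric.measure_closedBall_pos _ _ one_pos).ne' ?_
  exact (isCompact_closedBall _ _).measure_ne_top

theorem volume_closedBall_eq (n : ℕ) {r : ℝ} (hr : 0 ≤ r) :
    volume (Metric.closedBall (0 : EuclideanSpace ℝ (Fin n)) r) = ENNReal.ofReal (r ^ n * unitBallVol n) := by
  rw [Measure.addHaar_closedBall' _ _ hr, ENNReal.ofReal_mul (by positivity), unitBallVol,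
    ENNReal.ofReal_toReal (isCompact_closedBall _ _).measure_ne_top]
  simp

theorem lower_bound {n : ℕ} {K : Set (EuclideanSpace ℝ (Fin (n + 1)))} (hKc : IsCompact K)
    (hK : Convex ℝ K) (hKint : (interior K).Nonempty) {C : ℝ} (hC : 0 ≤ C)
    (hP : PBound K (ENNReal.ofReal C)) :
    (1 + 2 * unitBallVol n / unitBallVol (n + 1)) * (volume K).toReal ≤ C := by
  have hv := unitBallVol_pos (n + 1)
  have hv' := unitBallVol_pos n
  set V := (volume K).toReal with hV
  have hVpos : 0 < V := ENNReal.toReal_pos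
    (Measure.measure_pos_of_nonempty_interior _ hKint).ne' hKc.measure_ne_top
  set r0 : ℝ := (V / unitBallVol (n + 1)) ^ ((1 : ℝ) / ((n + 1 : ℕ) : ℝ)) with hr0
  have hr0p : 0 < r0 := Real.rpow_pos_of_pos (by positivity) _
  have hr0n : r0 ^ (n + 1) = V / unitBallVol (n + 1) := by
    rw [hr0, one_div, Real.rpow_inv_natCast_pow (by positivity) (by simp)]
  have hVK : volume K = volume (Metric.closedBall (0 : EuclideanSpace ℝ (Fin (n + 1))) r0) := by
    rw [volume_closedBall_eq _ hr0p.le, hr0n, div_mul_cancel₀ _ hv.ne', hV,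
      ENNReal.ofReal_toReal hKc.measure_ne_top]
  have key : ∀ r : ℝ, 0 < r → r < r0 → r ^ (n + 1) * (unitBallVol (n + 1) + 2 * unitBallVol n) ≤ C := by
    intro r hr hrr
    obtain ⟨L, ⟨hL1, hL2, hL3, hL4⟩, hLB⟩ :=
      exists_compet_ball (V := volume K) ⟨hKc, hK, le_rfl, hP⟩ hr0p hrr hVK
    have := ball_symmetral hL1 hL2 hL4 hr hLB
    rw [volume_closedBall_eq _ hr.le, volume_closedBall_eq _ hr.le, ← ENNReal.ofReal_mul (by positivity),
      ← ENNReal.ofReal_add (by positivity) (by positivity), ENNReal.ofReal_le_ofReal_iff hC] at this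
    calc _ = _ := by ring
      _ ≤ C := this
  have hl : Filter.Tendsto (fun r : ℝ => r ^ (n + 1) * (unitBallVol (n + 1) + 2 * unitBallVol n))
      (nhdsWithin r0 (Set.Iio r0)) (nhds (r0 ^ (n + 1) * (unitBallVol (n + 1) + 2 * unitBallVol n))) := by
    refine Filter.Tendsto.mono_left ?_ nhdsWithin_le_nhds
    have hc : Continuous (fun r : ℝ => r ^ (n + 1) * (unitBallVol (n + 1) + 2 * unitBallVol n)) := by fun_prop
    exact hc.tendsto r0
  have := le_of_tendsto hl (b := C) (by
    filter_upwards [Ioo_mem_nhdsLT hr0p] with r hr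
    exact key r hr.1 hr.2)
  rw [hr0n] at this
  calc _ = V / unitBallVol (n + 1) * (unitBallVol (n + 1) + 2 * unitBallVol n) := by field_simp
    _ ≤ C := this

end

/-- Rogers–Shephard: for a convex body `K` in Euclidean `d`-space, the maximal volume of the
smallest centrally symmetric convex body with center `a ∈ K` containing `K`, namely
`convexHull ℝ (K ∪ ((2•a) − K))`, lies between `(1 + 2·v_{d−1}/v_d)·vol(K)` and
`2^d·vol(K)`, with equality on the right if and only if `K` is a `d`-simplex. -/
theorem rogers_shephard_central_symmetral (d : ℕ) (hd : 2 ≤ d)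
    (K : Set (EuclideanSpace ℝ (Fin d)))
    (hKc : IsCompact K) (hKconv : Convex ℝ K) (hKint : (interior K).Nonempty) :
    (1 + 2 * unitBallVol (d - 1) / unitBallVol d) * (volume K).toReal ≤
      sSup ((fun a => (volume (convexHull ℝ (K ∪ reflAbout a K))).toReal) '' K) ∧
    sSup ((fun a => (volume (convexHull ℝ (K ∪ reflAbout a K))).toReal) '' K) ≤
      2 ^ d * (volume K).toReal ∧
    (sSup ((fun a => (volume (convexHull ℝ (K ∪ reflAbout a K))).toReal) '' K) =
        2 ^ d * (volume K).toReal ↔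
      ∃ f : Fin (d + 1) → EuclideanSpace ℝ (Fin d),
        AffineIndependent ℝ f ∧ K = convexHull ℝ (Set.range f)) := by
  have hne := hKint.mono interior_subset
  have hfin : ∀ a, volume (convexHull ℝ (K ∪ reflAbout a K)) ≠ ⊤ := fun a =>
    (isCompact_hull hKc hKconv hne a).measure_ne_top
  have hKfin : volume K ≠ ⊤ := hKc.measure_ne_top
  have h2 : (2 ^ d * volume K).toReal = 2 ^ d * (volume K).toReal := by
    rw [ENNReal.toReal_mul, ENNReal.toReal_pow]; simp
  have h2fin : 2 ^ d * volume K ≠ ⊤ := ENNReal.mul_ne_top (by simp) hKfin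
  have hub : ∀ a ∈ K, (volume (convexHull ℝ (K ∪ reflAbout a K))).toReal ≤ 2 ^ d * (volume K).toReal := by
    intro a ha
    rw [← h2]
    exact ENNReal.toReal_mono h2fin (upper_all hKc hKconv hKint ha)
  set Φ := (fun a => (volume (convexHull ℝ (K ∪ reflAbout a K))).toReal) with hΦ
  have hbdd : BddAbove (Φ '' K) := ⟨_, by rintro _ ⟨a, ha, rfl⟩; exact hub a ha⟩
  have hle : ∀ a ∈ K, Φ a ≤ sSup (Φ '' K) := fun a ha => le_csSup hbdd ⟨a, ha, rfl⟩
  have hup : sSup (Φ '' K) ≤ 2 ^ d * (volume K).toReal :=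
    csSup_le (hne.image _) (by rintro _ ⟨a, ha, rfl⟩; exact hub a ha)
  refine ⟨?_, hup, ?_, ?_⟩
  · obtain ⟨n, rfl⟩ : ∃ n, d = n + 1 := ⟨d - 1, by omega⟩
    obtain ⟨a, ha⟩ := hne
    refine lower_bound hKc hKconv hKint (ENNReal.toReal_nonneg.trans (hle a ha)) ?_
    intro b hb
    rw [← ENNReal.ofReal_toReal (hfin b)]
    exact ENNReal.ofReal_le_ofReal (hle b hb)
  · intro heq
    refine eq_imp_simplex (by omega) hKc hKconv hKint fun c hc => ?_
    by_cases hct : c = ⊤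
    · rw [hct]; exact le_top
    rw [← ENNReal.toReal_le_toReal h2fin hct, h2, ← heq]
    refine csSup_le (hne.image _) ?_
    rintro _ ⟨a, ha, rfl⟩
    exact ENNReal.toReal_mono hct (hc a ha)
  · rintro ⟨f, hf, hKf⟩
    refine le_antisymm hup ?_
    have h := simplex_imp_eq f hf
    rw [← hKf] at h
    have hf0 : f 0 ∈ K := by rw [hKf]; exact subset_convexHull _ _ ⟨0, rfl⟩
    refine le_trans ?_ (hle _ hf0)
    rw [← h2]
    exact ENNReal.toReal_mono (hfin _) h
end

section
/- (Rogers–Shephard) Let K be a convex body in EuclideanSpace ℝ (Fin d), d ≥ 2, which is centrally symmetric: there is a point c with K = (2•c) − K. Then (1 + 2·v_{d−1}/v_d) · vol(K) ≤ sup_{a ∈ K} vol(convexHull ℝ (K ∪ ((2•a) − K))) ≤ (1 + d) · vol(K), where (2•a) − K = {2a − x : x ∈ K} is the reflection of K about a. -/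
open MeasureTheory

namespace RS

open Set Metric
open scoped ENNReal Pointwise

/-- A point of Euclidean `(n+1)`-space from its first coordinate and the others. -/
noncomputable def mkE {n : ℕ} (s : ℝ) (y : Fin n → ℝ) : EuclideanSpace ℝ (Fin (n + 1)) :=
  WithLp.toLp 2 (Fin.cons s y)

@[simp] lemma mkE_zero {n : ℕ} (s : ℝ) (y : Fin n → ℝ) : mkE s y 0 = s := rfl
@[simp] lemma mkE_succ {n : ℕ} (s : ℝ) (y : Fin n → ℝ) (i : Fin n) : mkE s y i.succ = y i := rfl

lemma ext_iff' {n : ℕ} {x z : EuclideanSpace ℝ (Fin (n + 1))} :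
    x = z ↔ x 0 = z 0 ∧ ∀ i : Fin n, x i.succ = z i.succ := by
  constructor
  · rintro rfl; simp
  · rintro ⟨h0, h1⟩
    ext i
    exact Fin.cases h0 h1 i

lemma norm_sq_eq {n : ℕ} (x : EuclideanSpace ℝ (Fin (n + 1))) :
    ‖x‖ ^ 2 = x 0 ^ 2 + ∑ i : Fin n, x i.succ ^ 2 := by
  rw [EuclideanSpace.real_norm_sq_eq, Fin.sum_univ_succ]

lemma continuous_mkE {n : ℕ} : Continuous (fun p : ℝ × (Fin n → ℝ) => mkE p.1 p.2) := by
  unfold mkE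
  refine (PiLp.continuous_toLp 2 _).comp ?_
  refine continuous_pi fun i => ?_
  refine Fin.cases ?_ (fun j => ?_) i
  · simpa using continuous_fst
  · exact (continuous_apply j).comp continuous_snd

/-- fibre over `y` -/
def fib {n : ℕ} (A : Set (EuclideanSpace ℝ (Fin (n + 1)))) (y : Fin n → ℝ) : Set ℝ :=
  {s | mkE s y ∈ A}

lemma measurePreserving_mkE {n : ℕ} :
    MeasurePreserving (fun p : ℝ × (Fin n → ℝ) => mkE p.1 p.2) := by
  have h1 := (volume_preserving_piFinSuccAbove (fun _ : Fin (n + 1) => ℝ) 0).symm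
  have h2 := (PiLp.volume_preserving_toLp (Fin (n + 1))).comp h1
  convert! h2 using 1
  funext p
  rw [ext_iff']
  refine ⟨?_, fun i => ?_⟩
  · simp [MeasurableEquiv.piFinSuccAbove]
  · simp [MeasurableEquiv.piFinSuccAbove]

lemma measurable_fib {n : ℕ} {A : Set (EuclideanSpace ℝ (Fin (n + 1)))} (hA : MeasurableSet A) :
    Measurable (fun y => volume (fib A y)) := by
  have := measurable_measure_prodMk_right (μ := (volume : Measure ℝ))
    ((continuous_mkE (n := n)).measurable hA)
  exact this

lemma volume_eq_lintegral_fib {n : ℕ} {A : Set (EuclideanSpace ℝ (Fin (n + 1)))}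
    (hA : MeasurableSet A) : volume A = ∫⁻ y, volume (fib A y) := by
  rw [← (measurePreserving_mkE (n := n)).measure_preimage hA.nullMeasurableSet,
    Measure.volume_eq_prod, Measure.prod_apply_symm ((continuous_mkE (n := n)).measurable hA)]
  rfl

lemma isCompact_fib {n : ℕ} {A : Set (EuclideanSpace ℝ (Fin (n + 1)))}
    (hA : IsCompact A) (y : Fin n → ℝ) : IsCompact (fib A y) := by
  have : Topology.IsClosedEmbedding (fun s : ℝ => mkE s y) := by
    refine Isometry.isClosedEmbedding (Isometry.of_dist_eq fun s t => ?_)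
    rw [EuclideanSpace.dist_eq, Fin.sum_univ_succ]
    simp [Real.sqrt_sq_eq_abs, Real.dist_eq]
  exact this.isCompact_preimage hA

lemma convex_fib {n : ℕ} {A : Set (EuclideanSpace ℝ (Fin (n + 1)))}
    (hA : Convex ℝ A) (y : Fin n → ℝ) : Convex ℝ (fib A y) := by
  intro s hs t ht a b ha hb hab
  have := hA hs ht ha hb hab
  show mkE _ y ∈ A
  convert this using 1
  rw [ext_iff']
  refine ⟨by simp, fun i => ?_⟩
  simp only [mkE_succ, PiLp.add_apply, PiLp.smul_apply, smul_eq_mul]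
  rw [← add_mul, hab, one_mul]

lemma le_vol_fib {n : ℕ} {A : Set (EuclideanSpace ℝ (Fin (n + 1)))}
    (hA : Convex ℝ A) {y : Fin n → ℝ} {s t : ℝ} (hs : mkE s y ∈ A) (ht : mkE t y ∈ A) :
    ENNReal.ofReal (s - t) ≤ volume (fib A y) := by
  rw [← Real.volume_Icc]
  exact measure_mono ((convex_fib hA y).ordConnected.out ht hs)

/-- The stadium `L + [-a,a]`. -/
def stad {E : Type*} [AddCommGroup E] [Module ℝ E] (L : Set E) (a : E) : Set E :=
  (fun p : E × ℝ => p.1 + p.2 • a) '' (L ×ˢ Icc (-1) 1)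

section gen
variable {E : Type*} [NormedAddCommGroup E] [NormedSpace ℝ E]

lemma mem_stad {L : Set E} {a z : E} :
    z ∈ stad L a ↔ ∃ x ∈ L, ∃ l ∈ Icc (-1 : ℝ) 1, x + l • a = z := by
  constructor
  · rintro ⟨⟨x, l⟩, ⟨hx, hl⟩, rfl⟩
    exact ⟨x, hx, l, hl, rfl⟩
  · rintro ⟨x, hx, l, hl, rfl⟩
    exact ⟨(x, l), ⟨hx, hl⟩, rfl⟩

lemma isCompact_stad {L : Set E} (hL : IsCompact L) (a : E) : IsCompact (stad L a) :=
  (hL.prod isCompact_Icc).image (by fun_prop)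

lemma convex_stad {L : Set E} (hL : Convex ℝ L) (a : E) : Convex ℝ (stad L a) := by
  intro z hz w hw p q hp hq hpq
  rw [mem_stad] at *
  obtain ⟨x, hx, l, hl, rfl⟩ := hz
  obtain ⟨x', hx', l', hl', rfl⟩ := hw
  refine ⟨_, hL hx hx' hp hq hpq, _, convex_Icc _ _ hl hl' hp hq hpq, ?_⟩
  simp only [smul_eq_mul]
  module

lemma stad_mono {L L' : Set E} (h : L ⊆ L') (a : E) : stad L a ⊆ stad L' a :=
  image_mono (prod_mono_left h)

end gen

structure Good {E : Type*} [NormedAddCommGroup E] [NormedSpace ℝ E] [MeasureSpace E]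
    (R : ℝ) (V m : ℝ≥0∞) (L : Set E) : Prop where
  cpt : IsCompact L
  cvx : Convex ℝ L
  sym : ∀ x ∈ L, -x ∈ L
  bdd : L ⊆ closedBall 0 R
  vol : V ≤ volume L
  sta : ∀ a ∈ L, volume (stad L a) ≤ m

/-- Steiner symmetral in the direction of the first coordinate. -/
def steiner {n : ℕ} (L : Set (EuclideanSpace ℝ (Fin (n + 1)))) :
    Set (EuclideanSpace ℝ (Fin (n + 1))) :=
  {z | ∃ x ∈ L, ∃ w ∈ L, (∀ i : Fin n, x i.succ = z i.succ) ∧ (∀ i : Fin n, w i.succ = z i.succ) ∧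
    2 * |z 0| ≤ x 0 - w 0}

section st
variable {n : ℕ} {L : Set (EuclideanSpace ℝ (Fin (n + 1)))}

lemma steiner_bdd {R : ℝ} (hL : L ⊆ closedBall 0 R) : steiner L ⊆ closedBall 0 R := by
  rintro z ⟨x, hx, w, hw, h1, h2, h3⟩
  have hx' := hL hx
  have hw' := hL hw
  rw [mem_closedBall_zero_iff] at *
  have hR : 0 ≤ R := (norm_nonneg _).trans hx'
  refine abs_le_of_sq_le_sq' ?_ hR |>.2
  have ex := norm_sq_eq x
  have ew := norm_sq_eq w
  have ez := norm_sq_eq z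
  simp only [h1] at ex
  simp only [h2] at ew
  have hx2 : ‖x‖ ^ 2 ≤ R ^ 2 := by gcongr
  have hw2 : ‖w‖ ^ 2 ≤ R ^ 2 := by gcongr
  have : z 0 ^ 2 ≤ (x 0 ^ 2 + w 0 ^ 2) / 2 := by
    have h4 : (2 * |z 0|) ^ 2 ≤ (x 0 - w 0) ^ 2 := by gcongr
    have h5 : (2 * |z 0|) ^ 2 = 4 * z 0 ^ 2 := by rw [mul_pow, sq_abs]; norm_num
    nlinarith [sq_nonneg (x 0 + w 0)]
  linarith

lemma steiner_compact (hL : IsCompact L) : IsCompact (steiner L) := by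
  obtain ⟨R, hR⟩ := hL.isBounded.subset_closedBall 0
  have hB : IsCompact (closedBall (0 : EuclideanSpace ℝ (Fin (n + 1))) R) := isCompact_closedBall _ _
  let C : Set (EuclideanSpace ℝ (Fin (n + 1)) × EuclideanSpace ℝ (Fin (n + 1)) ×
    EuclideanSpace ℝ (Fin (n + 1))) := {p | (∀ i : Fin n, p.2.1 i.succ = p.1 i.succ) ∧
      (∀ i : Fin n, p.2.2 i.succ = p.1 i.succ) ∧ 2 * |p.1 0| ≤ p.2.1 0 - p.2.2 0}
  have hC : IsClosed C := by
    have e : ∀ i, Continuous (fun x : EuclideanSpace ℝ (Fin (n + 1)) => x i) := fun i => by fun_prop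
    refine IsClosed.inter ?_ (IsClosed.inter ?_ ?_)
    · show IsClosed {p : EuclideanSpace ℝ (Fin (n + 1)) × EuclideanSpace ℝ (Fin (n + 1)) ×
        EuclideanSpace ℝ (Fin (n + 1)) | ∀ i : Fin n, p.2.1 i.succ = p.1 i.succ}
      rw [ofPred_forall]
      exact isClosed_iInter fun i => isClosed_eq (by fun_prop) (by fun_prop)
    · show IsClosed {p : EuclideanSpace ℝ (Fin (n + 1)) × EuclideanSpace ℝ (Fin (n + 1)) ×
        EuclideanSpace ℝ (Fin (n + 1)) | ∀ i : Fin n, p.2.2 i.succ = p.1 i.succ}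
      rw [ofPred_forall]
      exact isClosed_iInter fun i => isClosed_eq (by fun_prop) (by fun_prop)
    · show IsClosed {p : EuclideanSpace ℝ (Fin (n + 1)) × EuclideanSpace ℝ (Fin (n + 1)) ×
        EuclideanSpace ℝ (Fin (n + 1)) | 2 * |p.1 0| ≤ p.2.1 0 - p.2.2 0}
      exact isClosed_le (by fun_prop) (by fun_prop)
  have := ((hB.prod (hL.prod hL)).inter_right hC).image continuous_fst
  convert this using 1
  ext z
  constructor
  · intro hz
    obtain ⟨x, hx, w, hw, h1, h2, h3⟩ := id hz
    exact ⟨(z, x, w), ⟨⟨steiner_bdd hR hz, hx, hw⟩, h1, h2, h3⟩, rfl⟩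
  · rintro ⟨⟨z', x, w⟩, ⟨⟨_, hx, hw⟩, h1, h2, h3⟩, rfl⟩
    exact ⟨x, hx, w, hw, h1, h2, h3⟩

lemma steiner_convex (hL : Convex ℝ L) : Convex ℝ (steiner L) := by
  rintro z ⟨x, hx, w, hw, h1, h2, h3⟩ z' ⟨x', hx', w', hw', h1', h2', h3'⟩ p q hp hq hpq
  refine ⟨_, hL hx hx' hp hq hpq, _, hL hw hw' hp hq hpq, ?_, ?_, ?_⟩
  · intro i; simp [h1, h1']
  · intro i; simp [h2, h2']
  · simp only [PiLp.add_apply, PiLp.smul_apply, smul_eq_mul]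
    have : |p * z 0 + q * z' 0| ≤ p * |z 0| + q * |z' 0| := by
      refine (abs_add_le _ _).trans ?_
      rw [abs_mul, abs_mul, abs_of_nonneg hp, abs_of_nonneg hq]
    nlinarith

lemma steiner_sym (hL : ∀ x ∈ L, -x ∈ L) : ∀ x ∈ steiner L, -x ∈ steiner L := by
  rintro z ⟨x, hx, w, hw, h1, h2, h3⟩
  refine ⟨_, hL _ hw, _, hL _ hx, ?_, ?_, ?_⟩
  · intro i; simp [h2]
  · intro i; simp [h1]
  · simp only [PiLp.neg_apply, abs_neg]; linarith

/-- Fibre bounds. -/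
lemma fib_steiner {y : Fin n → ℝ} {p q : ℝ} (hp : mkE p y ∈ L) (hq : mkE q y ∈ L) :
    Icc (-((p - q) / 2)) ((p - q) / 2) ⊆ fib (steiner L) y := by
  intro s hs
  have := abs_le.2 hs
  exact ⟨_, hp, _, hq, fun i => rfl, fun i => rfl, by simp only [mkE_zero]; linarith⟩

lemma exists_fib_bounds (hL : IsCompact L) (y : Fin n → ℝ) (h : (fib L y).Nonempty) :
    ∃ p q, mkE p y ∈ L ∧ mkE q y ∈ L ∧ fib L y ⊆ Icc q p := by
  obtain ⟨p, hp, hp'⟩ := (isCompact_fib hL y).exists_isGreatest h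
  obtain ⟨q, hq, hq'⟩ := (isCompact_fib hL y).exists_isLeast h
  exact ⟨p, q, hp, hq, fun s hs => ⟨hq' hs, hp' hs⟩⟩

lemma steiner_vol (hL : IsCompact L) : volume L ≤ volume (steiner L) := by
  rw [volume_eq_lintegral_fib hL.measurableSet,
    volume_eq_lintegral_fib (steiner_compact hL).measurableSet]
  refine lintegral_mono fun y => ?_
  rcases (fib L y).eq_empty_or_nonempty with h | h
  · simp [h]
  · obtain ⟨p, q, hp, hq, hsub⟩ := exists_fib_bounds hL y h
    calc volume (fib L y) ≤ volume (Icc q p) := measure_mono hsub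
      _ = volume (Icc (-((p - q) / 2)) ((p - q) / 2)) := by
        rw [Real.volume_Icc, Real.volume_Icc]; congr 1; ring
      _ ≤ _ := measure_mono (fib_steiner hp hq)

lemma steiner_stad (hL : IsCompact L) (hLc : Convex ℝ L) {m : ℝ≥0∞}
    (hm : ∀ a ∈ L, volume (stad L a) ≤ m) :
    ∀ a ∈ steiner L, volume (stad (steiner L) a) ≤ m := by
  rintro a ⟨x, hx, w, hw, h1, h2, h3⟩
  have h4 := abs_le.1 (show |a 0| ≤ (x 0 - w 0) / 2 by linarith)
  set μ := (x 0 + w 0) / 2 with hμ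
  have key : ∀ s : ℝ, w 0 ≤ s → s ≤ x 0 → mkE s (fun i => a i.succ) ∈ L := by
    intro s hs1 hs2
    have hx' : mkE (x 0) (fun i => a i.succ) ∈ L := by
      convert hx using 1; rw [ext_iff']; simp [h1]
    have hw' : mkE (w 0) (fun i => a i.succ) ∈ L := by
      convert hw using 1; rw [ext_iff']; simp [h2]
    exact (convex_fib hLc _).ordConnected.out hw' hx' ⟨hs1, hs2⟩
  have hα := key (μ + a 0) (by linarith) (by linarith)
  have hβ := key (μ - a 0) (by linarith) (by linarith)
  set α := mkE (μ + a 0) (fun i => a i.succ) with hαd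
  set β := mkE (μ - a 0) (fun i => a i.succ) with hβd
  have hfib : ∀ y, 2 * volume (fib (stad (steiner L) a) y) ≤
      volume (fib (stad L α) y) + volume (fib (stad L β) y) := by
    intro y
    rcases (fib (stad (steiner L) a) y).eq_empty_or_nonempty with h | h
    · simp [h]
    obtain ⟨t, t', ht, ht', hsub⟩ :=
      exists_fib_bounds (isCompact_stad (steiner_compact hL) a) y h
    obtain ⟨z, ⟨p, hp, p', hp', e1, e2, e3⟩, l, hl, hz⟩ := mem_stad.1 ht
    obtain ⟨z', ⟨v, hv, v', hv', f1, f2, f3⟩, l', hl', hz'⟩ := mem_stad.1 ht'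
    rw [ext_iff'] at hz hz'
    simp only [PiLp.add_apply, PiLp.smul_apply, smul_eq_mul, mkE_zero, mkE_succ] at hz hz'
    have g : ∀ (u : EuclideanSpace ℝ (Fin (n + 1))) (k s : ℝ), u ∈ L → k ∈ Icc (-1 : ℝ) 1 →
        (∀ i : Fin n, u i.succ + k * a i.succ = y i) →
        mkE s (fun i => a i.succ) ∈ L →
        mkE (u 0 + k * s) y ∈ stad L (mkE s (fun i => a i.succ)) := by
      intro u k s hu hk hy _
      refine mem_stad.2 ⟨u, hu, k, hk, ?_⟩
      rw [ext_iff']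
      simpa using hy
    have A1 := g p l _ hp hl (fun i => by rw [e1, hz.2]) hα
    have A2 := g v' l' _ hv' hl' (fun i => by rw [f2, hz'.2]) hα
    have B1 := g v l' _ hv hl' (fun i => by rw [f1, hz'.2]) hβ
    have B2 := g p' l _ hp' hl (fun i => by rw [e2, hz.2]) hβ
    have A := le_vol_fib (convex_stad hLc _) A1 A2
    have B := le_vol_fib (convex_stad hLc _) B1 B2
    refine le_trans ?_ (add_le_add A B)
    refine le_trans ?_ ENNReal.ofReal_add_le
    calc 2 * volume (fib (stad (steiner L) a) y) ≤ 2 * volume (Icc t' t) := by gcongr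
      _ = ENNReal.ofReal (2 * (t - t')) := by
        rw [Real.volume_Icc, ENNReal.ofReal_mul (by norm_num)]; simp
      _ ≤ _ := by
        apply ENNReal.ofReal_le_ofReal
        have := le_abs_self (z 0)
        have := neg_abs_le (z' 0)
        rw [← hz.1, ← hz'.1]
        nlinarith
  have h2 : 2 * volume (stad (steiner L) a) ≤ 2 * m := by
    have m1 := (isCompact_stad (steiner_compact hL) a).measurableSet
    have m2 := (isCompact_stad hL α).measurableSet
    have m3 := (isCompact_stad hL β).measurableSet
    calc 2 * volume (stad (steiner L) a) = ∫⁻ y, 2 * volume (fib (stad (steiner L) a) y) := by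
          rw [volume_eq_lintegral_fib m1, lintegral_const_mul _ (measurable_fib m1)]
      _ ≤ ∫⁻ y, (volume (fib (stad L α) y) + volume (fib (stad L β) y)) := lintegral_mono hfib
      _ = volume (stad L α) + volume (stad L β) := by
          rw [lintegral_add_left (measurable_fib m2), ← volume_eq_lintegral_fib m2,
            ← volume_eq_lintegral_fib m3]
      _ ≤ m + m := add_le_add (hm _ hα) (hm _ hβ)
      _ = 2 * m := (two_mul m).symm
  exact (ENNReal.mul_le_mul_iff_right (by norm_num) (by norm_num)).1 h2

lemma Good.steiner {R : ℝ} {V m : ℝ≥0∞} (h : Good R V m L) : Good R V m (steiner L) :=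
  ⟨steiner_compact h.cpt, steiner_convex h.cvx, steiner_sym h.sym, steiner_bdd h.bdd,
    h.vol.trans (steiner_vol h.cpt), steiner_stad h.cpt h.cvx h.sta⟩

end st

section strict
variable {n : ℕ} {L : Set (EuclideanSpace ℝ (Fin (n + 1)))}

lemma fib_ball_mono {r : ℝ} {y : Fin n → ℝ} {s t : ℝ}
    (hs : mkE s y ∈ closedBall (0 : EuclideanSpace ℝ (Fin (n + 1))) r) (h : |t| ≤ |s|) :
    mkE t y ∈ closedBall (0 : EuclideanSpace ℝ (Fin (n + 1))) r := by
  rw [mem_closedBall_zero_iff] at *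
  refine le_trans ?_ hs
  refine abs_le_of_sq_le_sq' ?_ (norm_nonneg _) |>.2
  rw [norm_sq_eq, norm_sq_eq]
  have := sq_le_sq.2 h
  simpa using this

lemma exists_fib_ball {r : ℝ} {y : Fin n → ℝ}
    (h : (fib (closedBall (0 : EuclideanSpace ℝ (Fin (n + 1))) r) y).Nonempty) :
    ∃ j, 0 ≤ j ∧ fib (closedBall (0 : EuclideanSpace ℝ (Fin (n + 1))) r) y = Icc (-j) j := by
  obtain ⟨p, q, hp, hq, hsub⟩ := exists_fib_bounds (isCompact_closedBall _ _) y h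
  have hp' : -p ∈ fib (closedBall (0 : EuclideanSpace ℝ (Fin (n + 1))) r) y :=
    fib_ball_mono hp (by rw [abs_neg])
  have hq' : -q ∈ fib (closedBall (0 : EuclideanSpace ℝ (Fin (n + 1))) r) y :=
    fib_ball_mono hq (by rw [abs_neg])
  have h1 := hsub hp'
  have h2 := hsub hq'
  have hp0 : 0 ≤ p := by linarith [h1.1, h1.2, h2.1, h2.2]
  refine ⟨p, hp0, Subset.antisymm ?_ ?_⟩
  · exact hsub.trans (Icc_subset_Icc (by linarith [h2.2]) le_rfl)
  · intro s hs
    exact fib_ball_mono hp (by rw [abs_of_nonneg hp0]; exact abs_le.2 hs)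

lemma steiner_fib_le (hL : IsCompact L) (r : ℝ) (y : Fin n → ℝ) :
    volume (fib (L ∩ closedBall 0 r) y) ≤ volume (fib (steiner L ∩ closedBall 0 r) y) := by
  rcases (fib (L ∩ closedBall 0 r) y).eq_empty_or_nonempty with h | h
  · simp [h]
  obtain ⟨s, hs⟩ := h
  obtain ⟨p, q, hp, hq, hsub⟩ := exists_fib_bounds hL y ⟨s, hs.1⟩
  obtain ⟨j, hj, hB⟩ := exists_fib_ball (n := n) (r := r) (y := y) ⟨s, hs.2⟩
  have e1 : fib (L ∩ closedBall 0 r) y ⊆ Icc (max q (-j)) (min p j) := by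
    rintro t ⟨ht1, ht2⟩
    have ht2' : t ∈ Icc (-j) j := hB ▸ ht2
    have ht1' := hsub ht1
    exact ⟨max_le ht1'.1 ht2'.1, le_min ht1'.2 ht2'.2⟩
  have e2 : Icc (-(min ((p - q) / 2) j)) (min ((p - q) / 2) j) ⊆
      fib (steiner L ∩ closedBall 0 r) y := by
    intro t ht
    refine ⟨fib_steiner hp hq ⟨?_, ht.2.trans (min_le_left _ _)⟩, ?_⟩
    · linarith [ht.1, min_le_left ((p - q) / 2) j]
    · show t ∈ fib (closedBall (0 : EuclideanSpace ℝ (Fin (n + 1))) r) y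
      rw [hB]
      exact ⟨by linarith [ht.1, min_le_right ((p - q) / 2) j], ht.2.trans (min_le_right _ _)⟩
  refine (measure_mono e1).trans (le_trans ?_ (measure_mono e2))
  rw [Real.volume_Icc, Real.volume_Icc]
  apply ENNReal.ofReal_le_ofReal
  have := min_le_left p j
  have := min_le_right p j
  have := le_max_left q (-j)
  have := le_max_right q (-j)
  rcases min_choice ((p - q) / 2) j with h | h <;> rw [h] <;> linarith

lemma steiner_fib_lt (hL : IsCompact L) (hLc : Convex ℝ L) (r : ℝ) (y : Fin n → ℝ) {s t : ℝ}
    (hsi : mkE s y ∈ interior L) (hs' : mkE s y ∉ closedBall (0 : EuclideanSpace ℝ (Fin (n + 1))) r)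
    (ht : mkE t y ∉ L) (ht' : mkE t y ∈ ball (0 : EuclideanSpace ℝ (Fin (n + 1))) r) :
    volume (fib (L ∩ closedBall 0 r) y) < volume (fib (steiner L ∩ closedBall 0 r) y) := by
  have ht'' := ball_subset_closedBall ht'
  have hs := interior_subset hsi
  obtain ⟨p, q, hp, hq, hsub⟩ := exists_fib_bounds hL y ⟨s, hs⟩
  obtain ⟨j, hj, hB⟩ := exists_fib_ball (n := n) (r := r) (y := y) ⟨t, ht''⟩
  have hsJ : s ∉ Icc (-j) j := by rw [← hB]; exact hs'
  have htJ : t ∈ Icc (-j) j := by rw [← hB]; exact ht''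
  have hoc := (convex_fib hLc y).ordConnected
  have hsI := hsub hs
  have e1 : fib (L ∩ closedBall 0 r) y ⊆ Icc (max q (-j)) (min p j) := by
    rintro u ⟨ht1, ht2⟩
    have ht2' : u ∈ Icc (-j) j := hB ▸ ht2
    have ht1' := hsub ht1
    exact ⟨max_le ht1'.1 ht2'.1, le_min ht1'.2 ht2'.2⟩
  have e2 : Icc (-(min ((p - q) / 2) j)) (min ((p - q) / 2) j) ⊆
      fib (steiner L ∩ closedBall 0 r) y := by
    intro t ht
    refine ⟨fib_steiner hp hq ⟨?_, ht.2.trans (min_le_left _ _)⟩, ?_⟩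
    · linarith [ht.1, min_le_left ((p - q) / 2) j]
    · show t ∈ fib (closedBall (0 : EuclideanSpace ℝ (Fin (n + 1))) r) y
      rw [hB]
      exact ⟨by linarith [ht.1, min_le_right ((p - q) / 2) j], ht.2.trans (min_le_right _ _)⟩
  have aux : ∀ (U : Set (EuclideanSpace ℝ (Fin (n + 1)))) (u a b : ℝ), IsOpen U → mkE u y ∈ U →
      fib U y ⊆ Icc a b → a < b := by
    intro U u a b hU hu hsub
    have hop : IsOpen (fib U y) :=
      hU.preimage (continuous_mkE.comp (by fun_prop : Continuous fun s : ℝ => (s, y)))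
    have h1 := (hop.measure_pos volume ⟨u, hu⟩).trans_le (measure_mono hsub)
    rw [Real.volume_Icc, ENNReal.ofReal_pos] at h1
    linarith
  have hj0 : 0 < j := by
    have := aux _ _ (-j) j isOpen_ball ht' (fun u hu => by
      rw [← hB]; exact ball_subset_closedBall hu)
    linarith
  have hqp : q < p := aux _ _ q p isOpen_interior hsi (fun u hu => hsub (show mkE u y ∈ L from interior_subset hu))
  have hd : (j < p ∧ -j < q) ∨ (p < j ∧ q < -j) := by
    rcases lt_or_ge t s with hts | hts
    · have h1 : j < s := by
        by_contra hcon
        exact hsJ ⟨by linarith [htJ.1], not_lt.1 hcon⟩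
      have h2 : t < q := by
        by_contra hcon
        exact ht (hoc.out hq hs ⟨not_lt.1 hcon, hts.le⟩)
      exact Or.inl ⟨by linarith [hsI.2], by linarith [htJ.1]⟩
    · have h1 : s < -j := by
        by_contra hcon
        exact hsJ ⟨not_lt.1 hcon, by linarith [htJ.2]⟩
      have h2 : p < t := by
        by_contra hcon
        exact ht (hoc.out hs hp ⟨hts, not_lt.1 hcon⟩)
      exact Or.inr ⟨by linarith [htJ.2], by linarith [hsI.1]⟩
  refine (measure_mono e1).trans_lt (lt_of_lt_of_le ?_ (measure_mono e2))
  rw [Real.volume_Icc, Real.volume_Icc]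
  have hpos : 0 < min ((p - q) / 2) j := lt_min (by linarith) hj0
  rw [ENNReal.ofReal_lt_ofReal_iff (by linarith)]
  have := min_le_left p j
  have := min_le_right p j
  have := le_max_left q (-j)
  have := le_max_right q (-j)
  rcases hd with ⟨h1, h2⟩ | ⟨h1, h2⟩ <;>
    rcases min_choice ((p - q) / 2) j with h | h <;> rw [h] <;> linarith

lemma steiner_strict (hL : IsCompact L) (hLc : Convex ℝ L) (r : ℝ)
    {x y : EuclideanSpace ℝ (Fin (n + 1))} (hx : x ∈ interior L) (hx' : x ∉ closedBall 0 r)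
    (hy : y ∉ L) (hy' : y ∈ ball 0 r) (hxy : ∀ i : Fin n, x i.succ = y i.succ) :
    volume (L ∩ closedBall 0 r) < volume (steiner L ∩ closedBall 0 r) := by
  have m1 : MeasurableSet (L ∩ closedBall 0 r) := hL.measurableSet.inter measurableSet_closedBall
  have m2 : MeasurableSet (steiner L ∩ closedBall 0 r) :=
    (steiner_compact hL).measurableSet.inter measurableSet_closedBall
  have hfin : volume (L ∩ closedBall 0 r) ≠ ∞ :=
    ((measure_mono inter_subset_left).trans_lt hL.measure_lt_top).ne
  rw [volume_eq_lintegral_fib m1] at hfin ⊢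
  rw [volume_eq_lintegral_fib m2]
  let c : ℝ → (Fin n → ℝ) → EuclideanSpace ℝ (Fin (n + 1)) := fun s v => mkE s v
  have hc : ∀ s, Continuous (c s) := fun s =>
    continuous_mkE.comp (by fun_prop : Continuous fun v : Fin n → ℝ => (s, v))
  let U : Set (Fin n → ℝ) := (c (x 0) ⁻¹' (interior L ∩ (closedBall 0 r)ᶜ)) ∩
    (c (y 0) ⁻¹' (Lᶜ ∩ ball 0 r))
  have hU : IsOpen U :=
    ((isOpen_interior.inter isClosed_closedBall.isOpen_compl).preimage (hc _)).inter
      ((hL.isClosed.isOpen_compl.inter isOpen_ball).preimage (hc _))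
  have hUne : U.Nonempty := by
    refine ⟨fun i => x i.succ, ?_, ?_⟩
    · have : c (x 0) (fun i => x i.succ) = x := by rw [ext_iff']; simp [c]
      rw [mem_preimage, this]; exact ⟨hx, hx'⟩
    · have : c (y 0) (fun i => x i.succ) = y := by rw [ext_iff']; simp [c, hxy]
      rw [mem_preimage, this]; exact ⟨hy, hy'⟩
  refine lintegral_strict_mono_of_ae_le_of_ae_lt_on (measurable_fib m2).aemeasurable hfin
    (ae_of_all _ fun v => steiner_fib_le hL r v) (s := U) (hU.measure_pos _ hUne).ne' ?_
  refine ae_of_all _ fun v hv => ?_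
  exact steiner_fib_lt hL hLc r v hv.1.1 hv.1.2 hv.2.1 hv.2.2

end strict

section comp
variable {E : Type*} [NormedAddCommGroup E] [InnerProductSpace ℝ E] [FiniteDimensional ℝ E]
  [MeasurableSpace E] [BorelSpace E]

lemma vol_image (T : E ≃ₗᵢ[ℝ] E) (S : Set E) : volume (T '' S) = volume S := by
  have h := T.symm.measurePreserving.measure_preimage_emb
    T.symm.toHomeomorph.measurableEmbedding S
  rw [← h]
  congr 1
  exact T.toEquiv.image_eq_preimage_symm S

lemma Good.map {R : ℝ} {V m : ℝ≥0∞} {L : Set E} (h : Good R V m L) (T : E ≃ₗᵢ[ℝ] E) :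
    Good R V m (T '' L) := by
  have hv : ∀ S : Set E, volume (T '' S) = volume S := vol_image T
  have hst : ∀ a, stad (T '' L) (T a) = T '' stad L a := by
    intro a
    ext z
    simp only [mem_stad, mem_image]
    constructor
    · rintro ⟨_, ⟨x, hx, rfl⟩, l, hl, rfl⟩
      exact ⟨x + l • a, ⟨x, hx, l, hl, rfl⟩, by simp⟩
    · rintro ⟨_, ⟨x, hx, l, hl, rfl⟩, rfl⟩
      exact ⟨T x, ⟨x, hx, rfl⟩, l, hl, by simp⟩
  refine ⟨h.cpt.image T.continuous, h.cvx.linear_image T.toLinearMap, ?_, ?_, ?_, ?_⟩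
  · rintro _ ⟨x, hx, rfl⟩
    exact ⟨-x, h.sym x hx, by simp⟩
  · rintro _ ⟨x, hx, rfl⟩
    have := h.bdd hx
    simpa using this
  · rw [hv]; exact h.vol
  · rintro _ ⟨a, ha, rfl⟩
    rw [hst, hv]; exact h.sta a ha

/-- Deep points of a set close to a closed convex set lie in that convex set. -/
lemma mem_of_ball_subset {L L' : Set E} (hL' : Convex ℝ L') (hcl : IsClosed L') {ε : ℝ} (hε : 0 < ε)
    {x : E} (hx : closedBall x ε ⊆ L) (h : ∀ z ∈ L, ∃ w ∈ L', dist z w < ε) : x ∈ L' := by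
  by_contra hcon
  obtain ⟨w0, hw0, -⟩ := h x (hx (mem_closedBall_self hε.le))
  obtain ⟨v, hv, hmin⟩ := exists_norm_eq_iInf_of_complete_convex ⟨w0, hw0⟩ hcl.isComplete hL' x
  rw [norm_eq_iInf_iff_real_inner_le_zero hL' hv] at hmin
  have hne : x - v ≠ 0 := fun h0 => hcon (by rw [sub_eq_zero.1 h0]; exact hv)
  have hpos : 0 < ‖x - v‖ := norm_pos_iff.2 hne
  obtain ⟨w, hw, hd⟩ := h (x + (ε / ‖x - v‖) • (x - v)) (hx (by
    rw [mem_closedBall, dist_eq_norm, add_sub_cancel_left, norm_smul, Real.norm_eq_abs,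
      abs_of_pos (by positivity), div_mul_cancel₀ _ hpos.ne']))
  have h1 := hmin w hw
  have h2 := real_inner_le_norm (x - v) (x + (ε / ‖x - v‖) • (x - v) - w)
  rw [dist_eq_norm] at hd
  have h3 : inner ℝ (x - v) (x + (ε / ‖x - v‖) • (x - v) - w) =
      ‖x - v‖ ^ 2 + ε * ‖x - v‖ - inner ℝ (x - v) (w - v) := by
    have : x + (ε / ‖x - v‖) • (x - v) - w = (x - v) + (ε / ‖x - v‖) • (x - v) - (w - v) := by abel
    rw [this, inner_sub_right, inner_add_right, inner_smul_right, real_inner_self_eq_norm_sq]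
    field_simp
  nlinarith

lemma usc_vol (B : Set E) (hB : IsCompact B) :
    UpperSemicontinuous (fun L : TopologicalSpace.NonemptyCompacts E =>
      volume ((L : Set E) ∩ B)) := by
  intro L c hc
  obtain ⟨U, hU1, hU2, hU3⟩ := ((L : Set E) ∩ B).exists_isOpen_lt_of_lt c hc
  have : IsOpen {K : TopologicalSpace.NonemptyCompacts E | (K : Set E) ⊆ U ∪ Bᶜ} :=
    TopologicalSpace.NonemptyCompacts.isOpen_subsets_of_isOpen
      (hU2.union hB.isClosed.isOpen_compl)
  filter_upwards [this.mem_nhds (show (L : Set E) ⊆ U ∪ Bᶜ from fun x hx => by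
    by_cases hxB : x ∈ B
    · exact Or.inl (hU1 ⟨hx, hxB⟩)
    · exact Or.inr hxB)] with K hK
  refine (measure_mono ?_).trans_lt hU3
  rintro x ⟨hx, hxB⟩
  exact (hK hx).resolve_right (fun h => h hxB)

lemma exists_ball_of_sym {L : Set E} (hc : Convex ℝ L) (hs : ∀ x ∈ L, -x ∈ L)
    (hv : volume L ≠ 0) : ∃ δ > 0, closedBall (0 : E) δ ⊆ L := by
  have hne : (interior L).Nonempty := by
    by_contra hcon
    rw [not_nonempty_iff_eq_empty] at hcon
    have h1 := hc.addHaar_frontier volume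
    have : L ⊆ frontier L := by
      intro x hx
      rw [frontier, hcon, sdiff_empty]; exact subset_closure hx
    exact hv (measure_mono_null this h1)
  obtain ⟨x, hx⟩ := hne
  have h0 : (0 : E) ∈ interior L := by
    have := hc.combo_interior_self_mem_interior hx (hs x (interior_subset hx))
      (a := 1/2) (b := 1/2) (by norm_num) (by norm_num) (by norm_num)
    simpa using this
  obtain ⟨δ, hδ, hsub⟩ := Metric.nhds_basis_closedBall.mem_iff.1 (mem_interior_iff_mem_nhds.1 h0)
  exact ⟨δ, hδ, hsub⟩

lemma good_closed {R : ℝ} {V m : ℝ≥0∞} (hV : V ≠ 0) :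
    IsClosed {L : TopologicalSpace.NonemptyCompacts E | Good R V m (L : Set E)} := by
  rw [← isSeqClosed_iff_isClosed]
  intro Ls L hLs hlim
  have hd : ∀ ε > 0, ∃ L' : TopologicalSpace.NonemptyCompacts E, Good R V m (L' : Set E) ∧
      (∀ z ∈ L, ∃ w ∈ L', dist z w < ε) ∧ (∀ z ∈ L', ∃ w ∈ L, dist z w < ε) := by
    intro ε hε
    obtain ⟨N, hN⟩ := Metric.tendsto_atTop.1 hlim ε hε
    have h1 := hN N le_rfl
    have hfin := Metric.hausdorffEDist_ne_top_of_nonempty_of_bounded (Ls N).nonempty L.nonempty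
      (Ls N).isCompact.isBounded L.isCompact.isBounded
    rw [Metric.NonemptyCompacts.dist_eq] at h1
    refine ⟨Ls N, hLs N, fun z hz => ?_, fun z hz => ?_⟩
    · obtain ⟨w, hw, h⟩ := exists_dist_lt_of_hausdorffDist_lt' hz h1 hfin
      exact ⟨w, hw, by rwa [dist_comm]⟩
    · exact exists_dist_lt_of_hausdorffDist_lt hz h1 hfin
  have hmem : ∀ z, (∀ ε > 0, ∃ w ∈ L, dist z w < ε) → z ∈ L := by
    intro z hz
    have : z ∈ closure (L : Set E) := Metric.mem_closure_iff.2 hz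
    rwa [L.isCompact.isClosed.closure_eq] at this
  have hcvx : Convex ℝ (L : Set E) := by
    intro x hx y hy a b ha hb hab
    refine hmem _ fun ε hε => ?_
    obtain ⟨L', hG, h1, h2⟩ := hd (ε / 2) (by positivity)
    obtain ⟨x', hx', hxd⟩ := h1 x hx
    obtain ⟨y', hy', hyd⟩ := h1 y hy
    obtain ⟨w, hw, hwd⟩ := h2 _ (hG.cvx hx' hy' ha hb hab)
    refine ⟨w, hw, ?_⟩
    have : dist (a • x + b • y) (a • x' + b • y') ≤ ε / 2 := by
      rw [dist_eq_norm] at *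
      have : a • x + b • y - (a • x' + b • y') = a • (x - x') + b • (y - y') := by module
      rw [this]
      refine (norm_add_le _ _).trans ?_
      rw [norm_smul, norm_smul, Real.norm_of_nonneg ha, Real.norm_of_nonneg hb]
      nlinarith
    linarith [dist_triangle (a • x + b • y) (a • x' + b • y') w]
  have hsym : ∀ x ∈ (L : Set E), -x ∈ (L : Set E) := by
    intro x hx
    refine hmem _ fun ε hε => ?_
    obtain ⟨L', hG, h1, h2⟩ := hd (ε / 2) (by positivity)
    obtain ⟨x', hx', hxd⟩ := h1 x hx
    obtain ⟨w, hw, hwd⟩ := h2 _ (hG.sym _ hx')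
    refine ⟨w, hw, ?_⟩
    have := dist_triangle (-x) (-x') w
    rw [dist_neg_neg] at this
    linarith
  have hbdd : (L : Set E) ⊆ closedBall 0 R := by
    intro x hx
    rw [mem_closedBall_zero_iff]
    refine le_of_forall_pos_lt_add fun ε hε => ?_
    obtain ⟨L', hG, h1, h2⟩ := hd ε hε
    obtain ⟨x', hx', hxd⟩ := h1 x hx
    have := hG.bdd hx'
    rw [mem_closedBall_zero_iff] at this
    rw [dist_eq_norm] at hxd
    linarith [norm_sub_norm_le x x']
  have hvol : V ≤ volume (L : Set E) := by
    by_contra hcon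
    rw [not_le] at hcon
    have := usc_vol (closedBall (0 : E) R) (isCompact_closedBall _ _) L V
      ((measure_mono inter_subset_left).trans_lt hcon)
    obtain ⟨N, hN⟩ := (hlim.eventually this).exists
    have h1 := (hLs N).vol
    have hN : volume ((Ls N : Set E) ∩ closedBall 0 R) < V := hN
    rw [inter_eq_left.2 (hLs N).bdd] at hN
    exact absurd h1 (not_le.2 hN)
  refine ⟨L.isCompact, hcvx, hsym, hbdd, hvol, fun a ha => ?_⟩
  obtain ⟨δ, hδ, hball⟩ := exists_ball_of_sym hcvx hsym (fun h => hV (by simpa [h] using hvol))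
  have key : ∀ θ : ℝ, 0 < θ → θ < 1 →
      ENNReal.ofReal (θ ^ Module.finrank ℝ E) * volume (stad (L : Set E) a) ≤ m := by
    intro θ h0 h1
    have hε : 0 < (1 - θ) * δ := mul_pos (by linarith) hδ
    obtain ⟨L', hG, hd1, -⟩ := hd _ hε
    have hsub : ∀ x ∈ L, θ • x ∈ (L' : Set E) := by
      intro x hx
      refine mem_of_ball_subset hG.cvx hG.cpt.isClosed hε (L := L) ?_ hd1
      intro z hz
      have hu : (1 - θ)⁻¹ • (z - θ • x) ∈ L := by
        apply hball
        rw [mem_closedBall, dist_eq_norm] at hz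
        rw [mem_closedBall_zero_iff, norm_smul, Real.norm_of_nonneg (by
          rw [inv_nonneg]; linarith)]
        rw [inv_mul_le_iff₀ (by linarith)]
        exact hz
      have := hcvx hx hu h0.le (by linarith : 0 ≤ 1 - θ) (by ring)
      rw [smul_smul, mul_inv_cancel₀ (by linarith), one_smul] at this
      simpa using this
    rw [← Measure.addHaar_smul_of_nonneg _ h0.le]
    refine (measure_mono ?_).trans (hG.sta (θ • a) (hsub a ha))
    rintro _ ⟨z, hz, rfl⟩
    obtain ⟨x, hx, l, hl, rfl⟩ := mem_stad.1 hz
    refine mem_stad.2 ⟨θ • x, hsub x hx, l, hl, ?_⟩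
    simp only [smul_add]
    rw [smul_comm]
  have hlim2 : Filter.Tendsto (fun θ : ℝ => ENNReal.ofReal (θ ^ Module.finrank ℝ E) *
      volume (stad (L : Set E) a)) (nhdsWithin 1 (Iio 1)) (nhds (1 * volume (stad (L : Set E) a))) := by
    refine ENNReal.Tendsto.mul_const ?_ (Or.inl one_ne_zero)
    have : Continuous (fun θ : ℝ => ENNReal.ofReal (θ ^ Module.finrank ℝ E)) :=
      ENNReal.continuous_ofReal.comp (by fun_prop)
    have h2 := (this.tendsto 1).mono_left (nhdsWithin_le_nhds (s := Iio 1))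
    simpa using h2
  rw [one_mul] at hlim2
  refine le_of_tendsto hlim2 ?_
  filter_upwards [Ioo_mem_nhdsLT (show (0 : ℝ) < 1 by norm_num)] with θ hθ
  exact key θ hθ.1 hθ.2

end comp

section main
variable {n : ℕ}

lemma exists_rot (v : EuclideanSpace ℝ (Fin (n + 1))) :
    ∃ T : EuclideanSpace ℝ (Fin (n + 1)) ≃ₗᵢ[ℝ] EuclideanSpace ℝ (Fin (n + 1)),
      T v = mkE ‖v‖ 0 := by
  have h : ‖v‖ = ‖(mkE ‖v‖ 0 : EuclideanSpace ℝ (Fin (n + 1)))‖ := by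
    have := norm_sq_eq (mkE ‖v‖ 0 : EuclideanSpace ℝ (Fin (n + 1)))
    simp only [mkE_zero, mkE_succ, Pi.zero_apply] at this
    simp at this
    exact this.symm
  exact ⟨_, Submodule.reflection_sub h⟩

lemma exists_good_ball {R r : ℝ} {V m : ℝ≥0∞} (hV : V ≠ 0) (hr : 0 < r)
    {K : Set (EuclideanSpace ℝ (Fin (n + 1)))} (hK : Good R V m K)
    (hVr : volume (closedBall (0 : EuclideanSpace ℝ (Fin (n + 1))) r) ≤ V) :
    ∃ L : Set (EuclideanSpace ℝ (Fin (n + 1))), Good R V m L ∧ closedBall 0 r ⊆ L := by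
  let S : Set (TopologicalSpace.NonemptyCompacts (EuclideanSpace ℝ (Fin (n + 1)))) :=
    {L | Good R V m (L : Set (EuclideanSpace ℝ (Fin (n + 1))))}
  have hne : ∀ {L : Set (EuclideanSpace ℝ (Fin (n + 1)))}, Good R V m L → L.Nonempty := by
    intro L hL
    by_contra hcon
    rw [not_nonempty_iff_eq_empty] at hcon
    have := hL.vol
    simp [hcon] at this
    exact hV this
  have hS : IsCompact S :=
    (TopologicalSpace.NonemptyCompacts.isCompact_subsets_of_isCompact
      (isCompact_closedBall (0 : EuclideanSpace ℝ (Fin (n + 1))) R)).of_isClosed_subset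
      (good_closed hV) (fun L hL => hL.bdd)
  obtain ⟨L, hL, hmax⟩ := UpperSemicontinuousOn.exists_isMaxOn
    (f := fun L : TopologicalSpace.NonemptyCompacts (EuclideanSpace ℝ (Fin (n + 1))) =>
      volume ((L : Set (EuclideanSpace ℝ (Fin (n + 1)))) ∩ closedBall 0 r))
    (s := S) ⟨⟨⟨K, hK.cpt⟩, hne hK⟩, hK⟩ hS
    ((usc_vol _ (isCompact_closedBall _ _)).upperSemicontinuousOn _)
  have hL : Good R V m (L : Set (EuclideanSpace ℝ (Fin (n + 1)))) := hL
  refine ⟨L, hL, ?_⟩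
  have hcb : ball 0 r ⊆ (L : Set (EuclideanSpace ℝ (Fin (n + 1)))) → closedBall 0 r ⊆
      (L : Set (EuclideanSpace ℝ (Fin (n + 1)))) := by
    intro h
    rw [← closure_ball _ hr.ne']
    exact closure_minimal h hL.cpt.isClosed
  apply hcb
  by_contra hcon
  obtain ⟨y, hy, hyL⟩ := not_subset.1 hcon
  have hint : ¬ interior (L : Set (EuclideanSpace ℝ (Fin (n + 1)))) ⊆ closedBall 0 r := by
    intro h
    obtain ⟨δ, hδ, hball⟩ := exists_ball_of_sym hL.cvx hL.sym
      (fun h => hV (by simpa [h] using hL.vol))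
    have hne : (interior (L : Set (EuclideanSpace ℝ (Fin (n + 1))))).Nonempty :=
      ⟨0, interior_mono hball (by
        rw [mem_interior_iff_mem_nhds]; exact closedBall_mem_nhds _ hδ)⟩
    have hLB : (L : Set (EuclideanSpace ℝ (Fin (n + 1)))) ⊆ closedBall 0 r := by
      refine subset_closure.trans ?_
      rw [← hL.cvx.closure_interior_eq_closure_of_nonempty_interior hne]
      exact closure_minimal h isClosed_closedBall
    have hop : IsOpen (ball 0 r \ (L : Set (EuclideanSpace ℝ (Fin (n + 1))))) :=
      isOpen_ball.sdiff hL.cpt.isClosed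
    have hpos := hop.measure_pos volume ⟨y, hy, hyL⟩
    have h0 : volume (closedBall 0 r \ (L : Set (EuclideanSpace ℝ (Fin (n + 1))))) = 0 := by
      rw [measure_sdiff hLB hL.cpt.measurableSet.nullMeasurableSet hL.cpt.measure_lt_top.ne]
      exact tsub_eq_zero_of_le (hVr.trans hL.vol)
    exact hpos.ne' (measure_mono_null (sdiff_subset_sdiff_left ball_subset_closedBall) h0)
  obtain ⟨x, hx, hxB⟩ := not_subset.1 hint
  obtain ⟨T, hT⟩ := exists_rot (x - y)
  have hG1 := hL.map T
  have hG2 := hG1.steiner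
  have hTB : T '' closedBall 0 r = closedBall 0 r := by
    rw [T.image_closedBall, map_zero]
  have hlt := steiner_strict hG1.cpt hG1.cvx r (x := T x) (y := T y) (by
      have h1 := T.toHomeomorph.image_interior (L : Set (EuclideanSpace ℝ (Fin (n + 1))))
      have h2 : T x ∈ interior (T.toHomeomorph '' (L : Set (EuclideanSpace ℝ (Fin (n + 1))))) := by
        rw [← h1]; exact ⟨x, hx, rfl⟩
      exact h2)
    (by simpa using hxB)
    (by rintro ⟨z, hz, hzy⟩; exact hyL (T.injective hzy ▸ hz))
    (by simpa using hy)
    (by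
      intro i
      have h1 : (T (x - y)) i.succ = 0 := by rw [hT]; simp
      rw [map_sub, PiLp.sub_apply] at h1
      linarith)
  have hle := hmax (show (⟨⟨_, hG2.cpt⟩, hne hG2⟩ :
    TopologicalSpace.NonemptyCompacts (EuclideanSpace ℝ (Fin (n + 1)))) ∈ S from hG2)
  have e : volume (T '' (L : Set (EuclideanSpace ℝ (Fin (n + 1)))) ∩ closedBall 0 r) =
      volume ((L : Set (EuclideanSpace ℝ (Fin (n + 1)))) ∩ closedBall 0 r) := by
    conv_lhs => rw [← hTB, ← image_inter T.injective]
    exact vol_image T _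
  rw [e] at hlt
  exact absurd hle (not_le.2 hlt)

lemma capsule {r : ℝ} (hr : 0 < r) :
    volume (closedBall (0 : EuclideanSpace ℝ (Fin (n + 1))) r) +
      ENNReal.ofReal (2 * r) * volume (closedBall (0 : EuclideanSpace ℝ (Fin n)) r) ≤
    volume (stad (closedBall (0 : EuclideanSpace ℝ (Fin (n + 1))) r) (mkE r 0)) := by
  have mB : MeasurableSet (closedBall (0 : EuclideanSpace ℝ (Fin (n + 1))) r) :=
    measurableSet_closedBall
  have cB : IsCompact (closedBall (0 : EuclideanSpace ℝ (Fin (n + 1))) r) := isCompact_closedBall _ _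
  have mS := (isCompact_stad cB (mkE r 0)).measurableSet
  have mP : MeasurableSet ((WithLp.toLp 2 : (Fin n → ℝ) → EuclideanSpace ℝ (Fin n)) ⁻¹'
      closedBall 0 r) := (PiLp.volume_preserving_toLp (Fin n)).measurable measurableSet_closedBall
  rw [← (PiLp.volume_preserving_toLp (Fin n)).measure_preimage
    measurableSet_closedBall.nullMeasurableSet, ← lintegral_indicator_const mP,
    volume_eq_lintegral_fib mB, volume_eq_lintegral_fib mS,
    ← lintegral_add_left (measurable_fib mB)]
  refine lintegral_mono fun y => ?_
  have hiff : mkE 0 y ∈ closedBall (0 : EuclideanSpace ℝ (Fin (n + 1))) r ↔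
      y ∈ (WithLp.toLp 2 : (Fin n → ℝ) → EuclideanSpace ℝ (Fin n)) ⁻¹' closedBall 0 r := by
    rw [mem_preimage, mem_closedBall_zero_iff, mem_closedBall_zero_iff,
      ← sq_le_sq₀ (norm_nonneg _) hr.le, ← sq_le_sq₀ (norm_nonneg _) hr.le, norm_sq_eq,
      EuclideanSpace.real_norm_sq_eq]
    simp
  by_cases hy : mkE 0 y ∈ closedBall (0 : EuclideanSpace ℝ (Fin (n + 1))) r
  · obtain ⟨j, hj, hB⟩ := exists_fib_ball (n := n) (r := r) (y := y) ⟨0, hy⟩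
    rw [indicator_of_mem (hiff.1 hy), hB, Real.volume_Icc,
      ← ENNReal.ofReal_add (by linarith) (by linarith)]
    have hj1 : mkE j y ∈ closedBall (0 : EuclideanSpace ℝ (Fin (n + 1))) r :=
      show j ∈ fib (closedBall (0 : EuclideanSpace ℝ (Fin (n + 1))) r) y by
        rw [hB]; exact ⟨by linarith, le_rfl⟩
    have hj2 : mkE (-j) y ∈ closedBall (0 : EuclideanSpace ℝ (Fin (n + 1))) r :=
      show -j ∈ fib (closedBall (0 : EuclideanSpace ℝ (Fin (n + 1))) r) y by
        rw [hB]; exact ⟨le_rfl, by linarith⟩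
    have h := le_vol_fib (convex_stad (convex_closedBall (0 : EuclideanSpace ℝ (Fin (n + 1))) r)
      (mkE r 0)) (y := y) (s := j + r) (t := -j - r)
      (mem_stad.2 ⟨_, hj1, 1, by simp, by rw [ext_iff']; simp⟩)
      (mem_stad.2 ⟨_, hj2, -1, by simp, by rw [ext_iff']; simp [sub_eq_add_neg]⟩)
    refine le_trans (le_of_eq ?_) h
    congr 1; ring
  · have : fib (closedBall (0 : EuclideanSpace ℝ (Fin (n + 1))) r) y = ∅ := by
      rw [eq_empty_iff_forall_notMem]
      intro s hs
      exact hy (fib_ball_mono hs (by simp))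
    rw [indicator_of_notMem (fun h => hy (hiff.2 h)), this]
    simp

end main

section upper
variable {E : Type*} [NormedAddCommGroup E] [InnerProductSpace ℝ E] [FiniteDimensional ℝ E]
  [MeasurableSpace E] [BorelSpace E]

/-- `L + [0, t a]` -/
def cyl (L : Set E) (a : E) (t : ℝ) : Set E :=
  (fun p : E × ℝ => p.1 + p.2 • a) '' (L ×ˢ Icc 0 t)

lemma mem_cyl {L : Set E} {a z : E} {t : ℝ} :
    z ∈ cyl L a t ↔ ∃ x ∈ L, ∃ l ∈ Icc (0 : ℝ) t, x + l • a = z := by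
  constructor
  · rintro ⟨⟨x, l⟩, ⟨hx, hl⟩, rfl⟩
    exact ⟨x, hx, l, hl, rfl⟩
  · rintro ⟨x, hx, l, hl, rfl⟩
    exact ⟨(x, l), ⟨hx, hl⟩, rfl⟩

lemma isCompact_cyl {L : Set E} (hL : IsCompact L) (a : E) (t : ℝ) : IsCompact (cyl L a t) :=
  (hL.prod isCompact_Icc).image (by fun_prop)

lemma cyl_step {L : Set E} (hL : IsCompact L) (a : E) {s h : ℝ} (hs : 0 ≤ s) (hh : 0 ≤ h) :
    volume.real (cyl L a (s + h)) ≤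
      volume.real (cyl L a s) + (volume.real (cyl L a h) - volume.real L) := by
  have hsub : L ⊆ cyl L a h := fun x hx => mem_cyl.2 ⟨x, hx, 0, ⟨le_rfl, hh⟩, by simp⟩
  rw [← measureReal_sdiff hsub hL.measurableSet (isCompact_cyl hL a h).measure_lt_top.ne]
  have h1 : cyl L a (s + h) ⊆ cyl L a s ∪ ((fun z => s • a + z) '' (cyl L a h \ L)) := by
    intro z hz
    obtain ⟨x, hx, l, hl, rfl⟩ := mem_cyl.1 hz
    by_cases hcase : x + l • a ∈ cyl L a s
    · exact Or.inl hcase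
    right
    refine ⟨x + (l - s) • a, ⟨mem_cyl.2 ⟨x, hx, l - s, ⟨?_, by linarith [hl.2]⟩, rfl⟩, ?_⟩, ?_⟩
    · by_contra hc
      exact hcase (mem_cyl.2 ⟨x, hx, l, ⟨hl.1, by linarith⟩, rfl⟩)
    · intro hmem
      exact hcase (mem_cyl.2 ⟨_, hmem, s, ⟨hs, le_rfl⟩, by module⟩)
    · simp only; module
  have hfin2 : volume (cyl L a h \ L) ≠ ∞ :=
    ((measure_mono sdiff_subset).trans_lt (isCompact_cyl hL a h).measure_lt_top).ne
  have e : volume ((fun z => s • a + z) '' (cyl L a h \ L)) = volume (cyl L a h \ L) := by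
    rw [image_add_left, measure_preimage_add]
  have e' : volume.real ((fun z => s • a + z) '' (cyl L a h \ L)) = volume.real (cyl L a h \ L) := by
    rw [measureReal_def, e, measureReal_def]
  rw [← e']
  refine (measureReal_mono h1 ?_).trans (measureReal_union_le _ _)
  exact measure_union_ne_top (isCompact_cyl hL a s).measure_lt_top.ne (by rw [e]; exact hfin2)

lemma cyl_nat {L : Set E} (hL : IsCompact L) (a : E) {h : ℝ} (hh : 0 ≤ h) (k : ℕ) :
    volume.real (cyl L a (k * h)) ≤
      volume.real L + k * (volume.real (cyl L a h) - volume.real L) := by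
  induction k with
  | zero =>
    have : cyl L a ((0 : ℕ) * h) = L := by
      ext z
      rw [mem_cyl]
      constructor
      · rintro ⟨x, hx, l, hl, rfl⟩
        simp at hl
        simpa [hl] using hx
      · intro hz
        exact ⟨z, hz, 0, by simp, by simp⟩
    rw [this]; simp
  | succ k ih =>
    have := cyl_step hL a (s := k * h) (h := h) (by positivity) hh
    have e : ((k + 1 : ℕ) : ℝ) * h = k * h + h := by push_cast; ring
    rw [e]
    push_cast
    linarith

lemma cyl_le {L : Set E} (hL : IsCompact L) (hc : Convex ℝ L) (hs : ∀ x ∈ L, -x ∈ L) {a : E}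
    (ha : a ∈ L) {t : ℝ} (ht : 0 < t) :
    volume.real (cyl L a (2 * t)) ≤ (1 + t) ^ Module.finrank ℝ E * volume.real L := by
  have hsub : cyl L a (2 * t) ⊆ (fun z => t • a + z) '' ((1 + t) • L) := by
    intro z hz
    obtain ⟨x, hx, l, hl, rfl⟩ := mem_cyl.1 hz
    refine ⟨x + (l - t) • a, ⟨(1 + t)⁻¹ • (x + (l - t) • a), ?_, ?_⟩, by simp only; module⟩
    · have hb : ((l - t) / t) • a ∈ L := by
        have := hc ha (hs a ha) (a := l / (2 * t)) (b := 1 - l / (2 * t))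
          (div_nonneg hl.1 (by linarith)) (by
            rw [sub_nonneg, div_le_one (by linarith)]; exact hl.2) (by ring)
        convert this using 1
        rw [smul_neg, ← sub_eq_add_neg, ← sub_smul]
        congr 1
        field_simp
        ring
      have := hc hx hb (a := (1 + t)⁻¹) (b := t * (1 + t)⁻¹) (by positivity) (by positivity)
        (by field_simp)
      convert this using 1
      rw [smul_add, smul_smul, smul_smul]
      congr 2
      field_simp
    · simp only
      rw [smul_smul, mul_inv_cancel₀ (by positivity), one_smul]
  have e : volume ((fun z => t • a + z) '' ((1 + t) • L)) =
      ENNReal.ofReal ((1 + t) ^ Module.finrank ℝ E) * volume L := by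
    rw [image_add_left, measure_preimage_add, Measure.addHaar_smul_of_nonneg _ (by positivity)]
  have hfin : volume ((fun z => t • a + z) '' ((1 + t) • L)) ≠ ∞ := by
    rw [e]; exact ENNReal.mul_ne_top ENNReal.ofReal_ne_top hL.measure_lt_top.ne
  refine (measureReal_mono hsub hfin).trans ?_
  rw [measureReal_def, e, ENNReal.toReal_mul, ENNReal.toReal_ofReal (by positivity), measureReal_def]

lemma stad_upper {L : Set E} (hL : IsCompact L) (hc : Convex ℝ L) (hs : ∀ x ∈ L, -x ∈ L) {a : E}
    (ha : a ∈ L) : volume.real (stad L a) ≤ (1 + Module.finrank ℝ E) * volume.real L := by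
  have e : stad L a = (fun z => -a + z) '' cyl L a 2 := by
    ext z
    rw [mem_stad]
    constructor
    · rintro ⟨x, hx, l, hl, rfl⟩
      exact ⟨x + (l + 1) • a, mem_cyl.2 ⟨x, hx, l + 1, ⟨by linarith [hl.1], by linarith [hl.2]⟩, rfl⟩,
        by simp only; module⟩
    · rintro ⟨_, hz, rfl⟩
      obtain ⟨x, hx, l, hl, rfl⟩ := mem_cyl.1 hz
      exact ⟨x, hx, l - 1, ⟨by linarith [hl.1], by linarith [hl.2]⟩, by simp only; module⟩
  have e2 : volume.real (stad L a) = volume.real (cyl L a 2) := by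
    rw [measureReal_def, measureReal_def, e, image_add_left, measure_preimage_add]
  rw [e2]
  set d := Module.finrank ℝ E
  have hN : ∀ N : ℕ, volume.real (cyl L a 2) ≤ volume.real L +
      (1 / ((N : ℝ) + 1))⁻¹ • ((1 + 1 / ((N : ℝ) + 1)) ^ d - 1 ^ d) * volume.real L := by
    intro N
    have h1 := cyl_nat hL a (h := 2 * (1 / ((N : ℝ) + 1))) (by positivity) (N + 1)
    have h2 := cyl_le hL hc hs ha (t := 1 / ((N : ℝ) + 1)) (by positivity)
    have e3 : ((N + 1 : ℕ) : ℝ) * (2 * (1 / ((N : ℝ) + 1))) = 2 := by push_cast; field_simp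
    rw [e3] at h1
    refine h1.trans ?_
    rw [one_div, inv_inv, smul_eq_mul, one_pow, mul_assoc, sub_mul, one_mul, ← one_div]
    push_cast
    gcongr
  have hder : HasDerivAt (fun x : ℝ => x ^ d) (d : ℝ) 1 := by
    simpa using hasDerivAt_pow d (1 : ℝ)
  have hlim := hasDerivAt_iff_tendsto_slope_zero.1 hder
  have hseq : Filter.Tendsto (fun N : ℕ => 1 / ((N : ℝ) + 1)) Filter.atTop (nhdsWithin 0 {0}ᶜ) := by
    refine tendsto_nhdsWithin_iff.2 ⟨tendsto_one_div_add_atTop_nhds_zero_nat, ?_⟩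
    exact Filter.Eventually.of_forall fun N => by
      simp only [mem_compl_iff, mem_singleton_iff]; positivity
  have h3 := ((hlim.comp hseq).mul_const (volume.real L)).const_add (volume.real L)
  have := ge_of_tendsto' h3 hN
  linarith

end upper

section final

variable {d : ℕ}

lemma hull_eq {K : Set (EuclideanSpace ℝ (Fin d))} (hK : Convex ℝ K)
    {c : EuclideanSpace ℝ (Fin d)} (hs : ∀ x ∈ K, (2 : ℝ) • c - x ∈ K)
    (a : EuclideanSpace ℝ (Fin d)) :
    convexHull ℝ (K ∪ reflAbout a K) =
      (fun z => a + z) '' stad ((fun x => -c + x) '' K) (a - c) := by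
  apply Subset.antisymm
  · apply convexHull_min
    · rintro z (hz | ⟨x, hx, rfl⟩)
      · refine ⟨(-c + z) + (-1 : ℝ) • (a - c), mem_stad.2 ⟨_, ⟨z, hz, rfl⟩, -1, by simp, rfl⟩, ?_⟩
        simp only [neg_smul, one_smul]; abel
      · refine ⟨(-c + ((2 : ℝ) • c - x)) + (1 : ℝ) • (a - c),
          mem_stad.2 ⟨_, ⟨_, hs x hx, rfl⟩, 1, by simp, rfl⟩, ?_⟩
        simp only [two_smul, one_smul]; abel
    · exact (convex_stad (hK.translate _) _).translate _
  · rintro _ ⟨z, hz, rfl⟩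
    obtain ⟨_, ⟨x, hx, rfl⟩, l, hl, rfl⟩ := mem_stad.1 hz
    have h1 : x ∈ convexHull ℝ (K ∪ reflAbout a K) := subset_convexHull ℝ _ (Or.inl hx)
    have h2 : (2 : ℝ) • a - ((2 : ℝ) • c - x) ∈ convexHull ℝ (K ∪ reflAbout a K) :=
      subset_convexHull ℝ _ (Or.inr ⟨_, hs x hx, rfl⟩)
    have hl' := abs_le.1 (by simpa [abs_le] using hl : |l| ≤ 1)
    have := convex_convexHull ℝ (K ∪ reflAbout a K) h1 h2
      (a := (1 - l) / 2) (b := (1 + l) / 2) (by linarith [hl'.2]) (by linarith [hl'.1]) (by ring)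
    convert this using 1
    simp only
    module

lemma vol_hull_eq {K : Set (EuclideanSpace ℝ (Fin d))} (hK : Convex ℝ K)
    {c : EuclideanSpace ℝ (Fin d)} (hs : ∀ x ∈ K, (2 : ℝ) • c - x ∈ K)
    (a : EuclideanSpace ℝ (Fin d)) :
    volume (convexHull ℝ (K ∪ reflAbout a K)) =
      volume (stad ((fun x => -c + x) '' K) (a - c)) := by
  rw [hull_eq hK hs, image_add_left, measure_preimage_add]

lemma upper_bound {K : Set (EuclideanSpace ℝ (Fin d))} (hKc : IsCompact K) (hK : Convex ℝ K)
    {c : EuclideanSpace ℝ (Fin d)} (hs : ∀ x ∈ K, (2 : ℝ) • c - x ∈ K)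
    {a : EuclideanSpace ℝ (Fin d)} (ha : a ∈ K) :
    (volume (convexHull ℝ (K ∪ reflAbout a K))).toReal ≤ (1 + (d : ℝ)) * (volume K).toReal := by
  rw [vol_hull_eq hK hs]
  have h := stad_upper (L := (fun x => -c + x) '' K) (a := a - c)
    (hKc.image (by fun_prop)) (hK.translate _)
    (by
      rintro _ ⟨x, hx, rfl⟩
      refine ⟨_, hs x hx, ?_⟩
      simp only [two_smul]; abel) ⟨a, ha, by simp only; abel⟩
  have hv : volume ((fun x => -c + x) '' K) = volume K := by
    rw [image_add_left, measure_preimage_add]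
  simpa [Measure.real, hv] using h

lemma lower_bound {n : ℕ} {K : Set (EuclideanSpace ℝ (Fin (n + 1)))} (hKc : IsCompact K)
    (hK : Convex ℝ K) (hKint : (interior K).Nonempty)
    {c : EuclideanSpace ℝ (Fin (n + 1))} (hs : ∀ x ∈ K, (2 : ℝ) • c - x ∈ K) {M : ℝ}
    (hM : ∀ a ∈ K, (volume (convexHull ℝ (K ∪ reflAbout a K))).toReal ≤ M) :
    (1 + 2 * unitBallVol n / unitBallVol (n + 1)) * (volume K).toReal ≤ M := by
  have hLc : IsCompact ((fun x => -c + x) '' K) := hKc.image (by fun_prop)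
  have hv : volume ((fun x => -c + x) '' K) = volume K := by
    rw [image_add_left, measure_preimage_add]
  have hKpos : 0 < volume K :=
    (isOpen_interior.measure_pos volume hKint).trans_le (measure_mono interior_subset)
  have hKfin : volume K ≠ ∞ := hKc.measure_lt_top.ne
  have hM0 : 0 ≤ M := by
    obtain ⟨a, ha⟩ := hKint
    exact ENNReal.toReal_nonneg.trans (hM a (interior_subset ha))
  obtain ⟨R, hR⟩ := hLc.isBounded.subset_closedBall 0
  have hG : Good R (volume K) (ENNReal.ofReal M) ((fun x => -c + x) '' K) := by
    refine ⟨hLc, hK.translate _, ?_, hR, hv.ge, ?_⟩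
    · rintro _ ⟨x, hx, rfl⟩
      refine ⟨_, hs x hx, ?_⟩
      simp only [two_smul]; abel
    · rintro _ ⟨a, ha, rfl⟩
      have h := hM a ha
      rw [vol_hull_eq hK hs] at h
      have e : (fun x => -c + x) a = a - c := by simp only; abel
      rw [e]
      rw [← ENNReal.ofReal_toReal (isCompact_stad hLc (a - c)).measure_lt_top.ne]
      exact ENNReal.ofReal_le_ofReal h
  set v := unitBallVol (n + 1) with hvd
  have hv1 : volume (closedBall (0 : EuclideanSpace ℝ (Fin (n + 1))) 1) ≠ ∞ :=
    measure_closedBall_lt_top.ne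
  have hvpos : 0 < v := ENNReal.toReal_pos (measure_closedBall_pos _ _ one_pos).ne' hv1
  have hVpos : 0 < (volume K).toReal := ENNReal.toReal_pos hKpos.ne' hKfin
  set V := (volume K).toReal with hVd
  set r := (V / v) ^ ((1 : ℝ) / ((n + 1 : ℕ) : ℝ)) with hrd
  have hrpos : 0 < r := Real.rpow_pos_of_pos (div_pos hVpos hvpos) _
  have hrn : r ^ (n + 1) = V / v := by
    rw [hrd, one_div]
    exact Real.rpow_inv_natCast_pow (div_pos hVpos hvpos).le (by simp)
  have hball : volume (closedBall (0 : EuclideanSpace ℝ (Fin (n + 1))) r) = ENNReal.ofReal V := by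
    rw [Measure.addHaar_closedBall' _ _ hrpos.le, finrank_euclideanSpace_fin,
      ← ENNReal.ofReal_toReal hv1, ← ENNReal.ofReal_mul (by positivity)]
    congr 1
    change r ^ (n + 1) * v = V
    rw [hrn]; field_simp
  have hVK : volume K = ENNReal.ofReal V := (ENNReal.ofReal_toReal hKfin).symm
  obtain ⟨L, hL, hLB⟩ := exists_good_ball hKpos.ne' hrpos hG (hball.trans hVK.symm).le
  have hmem : (mkE r 0 : EuclideanSpace ℝ (Fin (n + 1))) ∈
      closedBall (0 : EuclideanSpace ℝ (Fin (n + 1))) r := by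
    rw [mem_closedBall_zero_iff]
    have := norm_sq_eq (mkE r 0 : EuclideanSpace ℝ (Fin (n + 1)))
    simp only [mkE_zero, mkE_succ, Pi.zero_apply] at this
    apply le_of_sq_le_sq _ hrpos.le
    rw [this]; simp
  have h1 := (capsule (n := n) hrpos).trans
    ((measure_mono (stad_mono hLB _)).trans (hL.sta _ (hLB hmem)))
  have hv2 : volume (closedBall (0 : EuclideanSpace ℝ (Fin n)) 1) ≠ ∞ :=
    measure_closedBall_lt_top.ne
  rw [hball, Measure.addHaar_closedBall' _ _ hrpos.le, finrank_euclideanSpace_fin,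
      ← ENNReal.ofReal_toReal hv2, ← ENNReal.ofReal_mul (by positivity),
      ← ENNReal.ofReal_mul (by positivity), ← ENNReal.ofReal_add hVpos.le (by positivity),
      ENNReal.ofReal_le_ofReal_iff hM0] at h1
  change V + 2 * r * (r ^ n * unitBallVol n) ≤ M at h1
  have e : (1 + 2 * unitBallVol n / v) * V = V + 2 * r * (r ^ n * unitBallVol n) := by
    have : 2 * r * (r ^ n * unitBallVol n) = 2 * r ^ (n + 1) * unitBallVol n := by ring
    rw [this, hrn]; ring
  rw [e]; exact h1

end final

end RS

/-- Rogers–Shephard: for a centrally symmetric convex body `K` in Euclidean `d`-space,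
`(1 + 2·v_{d−1}/v_d)·vol(K) ≤ sup_{a ∈ K} vol(convexHull ℝ (K ∪ ((2•a) − K))) ≤ (1+d)·vol(K)`. -/
theorem rogers_shephard_centrally_symmetric (d : ℕ) (hd : 2 ≤ d)
    (K : Set (EuclideanSpace ℝ (Fin d)))
    (hKc : IsCompact K) (hKconv : Convex ℝ K) (hKint : (interior K).Nonempty)
    (hsym : ∃ c : EuclideanSpace ℝ (Fin d), K = reflAbout c K) :
    (1 + 2 * unitBallVol (d - 1) / unitBallVol d) * (volume K).toReal ≤
      sSup ((fun a => (volume (convexHull ℝ (K ∪ reflAbout a K))).toReal) '' K) ∧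
    sSup ((fun a => (volume (convexHull ℝ (K ∪ reflAbout a K))).toReal) '' K) ≤
      (1 + (d : ℝ)) * (volume K).toReal := by
  obtain ⟨c, hc⟩ := hsym
  have hs : ∀ x ∈ K, (2 : ℝ) • c - x ∈ K := by
    intro x hx
    have h : (2 : ℝ) • c - x ∈ reflAbout c K := ⟨x, hx, rfl⟩
    rw [hc]; exact h
  have hub : ∀ y ∈ (fun a => (volume (convexHull ℝ (K ∪ reflAbout a K))).toReal) '' K,
      y ≤ (1 + (d : ℝ)) * (volume K).toReal := by
    rintro _ ⟨a, ha, rfl⟩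
    exact RS.upper_bound hKc hKconv hs ha
  refine ⟨?_, csSup_le ((hKint.mono interior_subset).image _) hub⟩
  obtain ⟨n, rfl⟩ : ∃ n, d = n + 1 := ⟨d - 1, by omega⟩
  exact RS.lower_bound hKc hKconv hKint hs (fun a ha => le_csSup ⟨_, hub⟩ ⟨a, ha, rfl⟩)
end
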